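/- arXiv:2004.11290 — 3 statements merged into one kernel-verified Lean document; each statement's English description precedes it below -/
import Mathlib

section
/- The limit lim_{s→0⁺} (g₀(s) − ℓ·s)/s^{5/3} exists, is strictly negative, and equals ℓ · inf { H(η) : η ∈ A_H }. Equivalently, there exists a constant ℓ̃ > 0 such that g₀(s) = ℓ·s − ℓ̃·s^{5/3} + o(s^{5/3}) as s → 0⁺. -/
open MeasureTheory Set Filter

/-- Hypotheses on the function `f₁` from Section 6.1 of the paper. -/
structure F1Hyp (ℓ ℓ₁ : ℝ) (f₁ : ℝ → ℝ) : Prop where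
  hl : 0 < ℓ
  hl1 : 0 < ℓ₁
  cont : ContinuousOn f₁ (Icc 0 1)
  diff : ∃ d : ℝ → ℝ, ContinuousOn d (Ioc 0 1) ∧
    ∀ t ∈ Ioc (0:ℝ) 1, HasDerivWithinAt f₁ (d t) (Ioc 0 1) t
  anti : StrictAntiOn f₁ (Icc 0 1)
  nonneg : ∀ t ∈ Icc (0:ℝ) 1, 0 ≤ f₁ t
  f10 : f₁ 0 = ℓ
  f11 : f₁ 1 = 0
  convexSqrt : ConvexOn ℝ (Icc 0 1) (fun u => f₁ (Real.sqrt u))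
  lim0 : Tendsto (fun s => (f₁ s - ℓ + ℓ₁ * s) / s) (nhdsWithin 0 (Ioi 0)) (nhds 0)

/-- `γ` is admissible, with a.e. derivative `γ'` (absolute continuity is encoded by the
fundamental theorem of calculus representation with an `L¹` derivative). -/
def Admissible (γ γ' : ℝ → ℝ) : Prop :=
  IntegrableOn γ' (Icc 0 1) ∧
  (∀ t ∈ Icc (0:ℝ) 1, γ t = ∫ u in (0:ℝ)..t, γ' u) ∧
  (∀ t ∈ Icc (0:ℝ) 1, 0 ≤ γ t ∧ γ t ≤ 1) ∧
  γ 0 = 0 ∧ γ 1 = 0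

/-- The energy in the characterization (6.11). -/
noncomputable def energy (f₁ : ℝ → ℝ) (s : ℝ) (γ γ' : ℝ → ℝ) : ℝ :=
  ∫ t in (0:ℝ)..1, Real.sqrt (s ^ 2 * (f₁ (Real.sqrt (γ t))) ^ 2 + (γ' t) ^ 2 / 4)

/-- The cohesive energy density of pristine material, via characterization (6.11). -/
noncomputable def g0 (f₁ : ℝ → ℝ) (s : ℝ) : ℝ :=
  sInf {x | ∃ γ γ' : ℝ → ℝ, Admissible γ γ' ∧ x = energy f₁ s γ γ'}


/-- `η` belongs to the class `A_H`, with derivative `η' ∈ L²(0,1)`. -/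
def AdmissibleH (η η' : ℝ → ℝ) : Prop :=
  IntegrableOn η' (Icc 0 1) ∧
  IntegrableOn (fun t => (η' t) ^ 2) (Icc 0 1) ∧
  (∀ t ∈ Icc (0:ℝ) 1, η t = ∫ u in (0:ℝ)..t, η' u) ∧
  (∀ t ∈ Icc (0:ℝ) 1, 0 ≤ η t) ∧
  η 0 = 0 ∧ η 1 = 0

/-- The limit functional `H` of (8.12). -/
noncomputable def Hfun (ℓ ℓ₁ : ℝ) (η η' : ℝ → ℝ) : ℝ :=
  ∫ t in (0:ℝ)..1, (-(ℓ₁ / ℓ) * Real.sqrt (η t) + (η' t) ^ 2 / (8 * ℓ ^ 2))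

/-- The infimum of `H` over the class `A_H`. -/
noncomputable def minH (ℓ ℓ₁ : ℝ) : ℝ :=
  sInf {x | ∃ η η' : ℝ → ℝ, AdmissibleH η η' ∧ x = Hfun ℓ ℓ₁ η η'}

namespace Pf

noncomputable def w (t : ℝ) : ℝ := 2 * Real.sin (Real.arcsin (2 * t - 1) / 3)

noncomputable def k (t : ℝ) : ℝ := 4 / (3 * (1 - w t ^ 2))

lemma w_cont : Continuous w := by
  unfold w
  have := Real.continuous_arcsin
  fun_prop

lemma w_zero : w 0 = -1 := by
  have h : Real.arcsin (2 * 0 - 1) / 3 = -(Real.pi / 6) := by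
    norm_num
    ring
  rw [w, h, Real.sin_neg, Real.sin_pi_div_six]; norm_num

lemma w_one : w 1 = 1 := by
  have h : Real.arcsin (2 * 1 - 1) / 3 = (Real.pi / 6) := by
    norm_num
    ring
  rw [w, h, Real.sin_pi_div_six]; norm_num

lemma w_sq_lt {t : ℝ} (ht : t ∈ Ioo (0:ℝ) 1) : w t ^ 2 < 1 := by
  have h1 : -(Real.pi / 2) < Real.arcsin (2 * t - 1) :=
    Real.neg_pi_div_two_lt_arcsin.2 (by linarith [ht.1])
  have h2 : Real.arcsin (2 * t - 1) < Real.pi / 2 :=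
    Real.arcsin_lt_pi_div_two.2 (by linarith [ht.2])
  have hp := Real.pi_pos
  have h3 : Real.sin (Real.arcsin (2 * t - 1) / 3) < Real.sin (Real.pi / 6) :=
    Real.sin_lt_sin_of_lt_of_le_pi_div_two (by linarith) (by linarith) (by linarith)
  have h4 : Real.sin (-(Real.pi / 6)) < Real.sin (Real.arcsin (2 * t - 1) / 3) :=
    Real.sin_lt_sin_of_lt_of_le_pi_div_two (by linarith) (by linarith) (by linarith)
  rw [Real.sin_neg] at h4
  rw [Real.sin_pi_div_six] at h3 h4
  unfold w
  nlinarith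

lemma w_sq_le {t : ℝ} (ht : t ∈ Icc (0:ℝ) 1) : w t ^ 2 ≤ 1 := by
  rcases eq_or_lt_of_le ht.1 with h | h
  · rw [← h, w_zero]; norm_num
  rcases eq_or_lt_of_le ht.2 with h' | h'
  · rw [h', w_one]; norm_num
  exact (w_sq_lt ⟨h, h'⟩).le

lemma k_pos {t : ℝ} (ht : t ∈ Ioo (0:ℝ) 1) : 0 < k t := by
  have := w_sq_lt ht
  unfold k
  apply div_pos <;> linarith

lemma w_deriv {t : ℝ} (ht : t ∈ Ioo (0:ℝ) 1) : HasDerivAt w (k t) t := by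
  have hx1 : (2 * t - 1) ≠ -1 := by linarith [ht.1] |> fun (h : 0 < t) => by intro h'; linarith
  have hx2 : (2 * t - 1) ≠ 1 := by intro h'; linarith [ht.2]
  have h1 : HasDerivAt (fun t : ℝ => 2 * t - 1) 2 t := by
    simpa using ((hasDerivAt_id t).const_mul 2).sub_const 1
  have h2 := (Real.hasDerivAt_arcsin hx1 hx2).comp t h1
  have h3 := ((h2.div_const 3).sin).const_mul 2
  refine h3.congr_deriv ?_
  have hw := w_sq_lt ht
  unfold k
  unfold w at *
  simp only [Function.comp]
  rw [← Real.cos_arcsin]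
  set θ := Real.arcsin (2 * t - 1) with hθ
  have hc : Real.cos θ = 4 * Real.cos (θ / 3) ^ 3 - 3 * Real.cos (θ / 3) := by
    rw [← Real.cos_three_mul]; congr 1; ring
  have hs := Real.sin_sq_add_cos_sq (θ / 3)
  have hcpos : 0 < Real.cos θ := by
    apply Real.cos_pos_of_mem_Ioo
    exact ⟨Real.neg_pi_div_two_lt_arcsin.2 (by linarith [ht.1]),
      Real.arcsin_lt_pi_div_two.2 (by linarith [ht.2])⟩
  have hv : 1 - (2 * Real.sin (θ / 3)) ^ 2 = 4 * Real.cos (θ / 3) ^ 2 - 3 := by linarith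
  have hv0 : 0 < 4 * Real.cos (θ / 3) ^ 2 - 3 := by linarith
  have hc' : Real.cos θ = Real.cos (θ / 3) * (4 * Real.cos (θ / 3) ^ 2 - 3) := by rw [hc]; ring
  rw [hv, hc']
  have : Real.cos (θ / 3) ≠ 0 := by
    intro h; rw [hc', h] at hcpos; simp at hcpos
  field_simp
  ring

lemma k_int : IntervalIntegrable k volume 0 1 := by
  rw [intervalIntegrable_iff_integrableOn_Ioc_of_le zero_le_one]
  exact intervalIntegral.integrableOn_deriv_of_nonneg w_cont.continuousOn
    (fun t ht => w_deriv ht) (fun t ht => (k_pos ht).le)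

lemma k_ftc {t : ℝ} (ht : t ∈ Icc (0:ℝ) 1) : w t + 1 = ∫ u in (0:ℝ)..t, k u := by
  rw [intervalIntegral.integral_eq_sub_of_hasDerivAt_of_le ht.1 w_cont.continuousOn
    (fun u hu => w_deriv ⟨hu.1, hu.2.trans_le ht.2⟩)
    (k_int.mono_set (by rw [uIcc_of_le ht.1, uIcc_of_le zero_le_one]; exact Icc_subset_Icc_right ht.2)),
    w_zero]
  ring

lemma w_sq_int : ∫ t in (0:ℝ)..1, w t ^ 2 = 1 / 5 := by
  have hc : Continuous (fun t => (3/4:ℝ) * (w t ^ 3 / 3 - w t ^ 5 / 5)) := by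
    have := w_cont
    fun_prop
  rw [intervalIntegral.integral_eq_sub_of_hasDerivAt_of_le
    (f := fun t => (3/4:ℝ) * (w t ^ 3 / 3 - w t ^ 5 / 5)) zero_le_one hc.continuousOn]
  · simp only [w_zero, w_one]; norm_num
  · intro t ht
    have h := w_deriv ht
    refine ((((h.pow 3).div_const 3).sub ((h.pow 5).div_const 5)).const_mul (3/4:ℝ)).congr_deriv ?_
    have hw := w_sq_lt ht
    have : 1 - w t ^ 2 ≠ 0 := by linarith
    unfold k
    push_cast
    field_simp
  · exact (w_cont.pow 2).intervalIntegrable _ _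

lemma parts {f f' g g' : ℝ → ℝ} (hf' : IntervalIntegrable f' volume 0 1)
    (hg' : IntervalIntegrable g' volume 0 1)
    (hf : ∀ t ∈ Icc (0:ℝ) 1, f t = ∫ u in (0:ℝ)..t, f' u)
    (hg : ∀ t ∈ Icc (0:ℝ) 1, g t = ∫ u in (0:ℝ)..t, g' u) :
    ∫ t in (0:ℝ)..1, (f' t * g t + f t * g' t) = f 1 * g 1 := by
  have hF := hf'.absolutelyContinuousOnInterval_intervalIntegral (c := 0) (by simp)
  have hG := hg'.absolutelyContinuousOnInterval_intervalIntegral (c := 0) (by simp)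
  have h := hF.integral_deriv_mul_eq_sub hG
  rw [hf 1 (by simp), hg 1 (by simp)]
  simp only [intervalIntegral.integral_same, mul_zero, sub_zero] at h
  rw [← h]
  apply intervalIntegral.integral_congr_ae
  filter_upwards [hf'.ae_hasDerivAt_integral, hg'.ae_hasDerivAt_integral] with t h1 h2 ht
  have ht' : t ∈ uIcc (0:ℝ) 1 := uIoc_subset_uIcc ht
  have ht'' := ht'
  rw [uIcc_of_le zero_le_one] at ht''
  rw [(h1 ht' 0 (by simp)).deriv, (h2 ht' 0 (by simp)).deriv, hf t ht'', hg t ht'']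

lemma parts_w {γ γ' : ℝ → ℝ} (hi : IntegrableOn γ' (Icc 0 1))
    (hγ : ∀ t ∈ Icc (0:ℝ) 1, γ t = ∫ u in (0:ℝ)..t, γ' u) (h1 : γ 1 = 0) :
    IntervalIntegrable (fun t => γ' t * w t + γ t * k t) volume 0 1 ∧
    ∫ t in (0:ℝ)..1, (γ' t * w t + γ t * k t) = 0 := by
  have hii : IntervalIntegrable γ' volume 0 1 := by
    rw [intervalIntegrable_iff_integrableOn_Ioc_of_le zero_le_one]
    exact hi.mono_set Ioc_subset_Icc_self
  have hcont : ContinuousOn γ (uIcc 0 1) := by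
    rw [uIcc_of_le zero_le_one]
    refine (intervalIntegral.continuousOn_primitive_interval
      (by rwa [uIcc_of_le zero_le_one])).congr ?_ |>.mono (by rw [uIcc_of_le zero_le_one])
    intro t ht
    rw [uIcc_of_le zero_le_one] at ht
    exact hγ t ht
  have hA : IntervalIntegrable (fun t => γ' t * w t + γ t * k t) volume 0 1 :=
    (hii.mul_continuousOn w_cont.continuousOn).add (k_int.continuousOn_mul hcont)
  refine ⟨hA, ?_⟩
  have hp := parts (g := fun t => w t + 1) hii k_int hγ (fun t ht => k_ftc ht)
  rw [h1, zero_mul] at hp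
  have h0 := hγ 1 (by simp)
  rw [h1] at h0
  have : ∫ t in (0:ℝ)..1, (γ' t * (w t + 1) + γ t * k t)
      = (∫ t in (0:ℝ)..1, (γ' t * w t + γ t * k t)) + ∫ t in (0:ℝ)..1, γ' t := by
    rw [← intervalIntegral.integral_add hA hii]
    congr 1; ext t; ring
  rw [this, ← h0] at hp
  linarith

lemma quad_int (P Q : ℝ) : ∫ t in (0:ℝ)..1, (P + Q * w t ^ 2) = P + Q / 5 := by
  have h : IntervalIntegrable (fun t => Q * w t ^ 2) volume 0 1 :=
    (continuous_const.mul (w_cont.pow 2)).intervalIntegrable _ _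
  rw [intervalIntegral.integral_add (by simp) h,
    intervalIntegral.integral_const_mul, w_sq_int]
  simp; ring

lemma quad_ii (P Q : ℝ) : IntervalIntegrable (fun t => P + Q * w t ^ 2) volume 0 1 :=
  (continuous_const.add (continuous_const.mul (w_cont.pow 2))).intervalIntegrable _ _

lemma int_lower {γ γ' φ : ℝ → ℝ} (hi : IntegrableOn γ' (Icc 0 1))
    (hγ : ∀ t ∈ Icc (0:ℝ) 1, γ t = ∫ u in (0:ℝ)..t, γ' u) (h1 : γ 1 = 0)
    (hφ : IntervalIntegrable φ volume 0 1) (c P Q : ℝ)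
    (h : ∀ t ∈ Ioo (0:ℝ) 1, c * (γ' t * w t + γ t * k t) + (P + Q * w t ^ 2) ≤ φ t) :
    P + Q / 5 ≤ ∫ t in (0:ℝ)..1, φ t := by
  obtain ⟨hA, h0⟩ := parts_w hi hγ h1
  have := intervalIntegral.integral_mono_on_of_le_Ioo zero_le_one
    ((hA.const_mul c).add (quad_ii P Q)) hφ h
  rw [intervalIntegral.integral_add (hA.const_mul c) (quad_ii P Q),
    intervalIntegral.integral_const_mul, h0, quad_int] at this
  linarith


lemma cont_of_prim {γ γ' : ℝ → ℝ} (hi : IntegrableOn γ' (Icc 0 1))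
    (hγ : ∀ t ∈ Icc (0:ℝ) 1, γ t = ∫ u in (0:ℝ)..t, γ' u) : ContinuousOn γ (Icc 0 1) := by
  refine (intervalIntegral.continuousOn_primitive_interval
    (by rwa [uIcc_of_le zero_le_one])).congr ?_ |>.mono (by rw [uIcc_of_le zero_le_one])
  intro t ht
  rw [uIcc_of_le zero_le_one] at ht
  exact hγ t ht

/-! ### The limit functional -/

lemma H_lower {ℓ B : ℝ} (hl : 0 < ℓ) (hB : 0 < B) {η η' : ℝ → ℝ} (h : AdmissibleH η η') :
    -(32 * B ^ 4) / (15 * ℓ ^ 2) ≤ Hfun ℓ (32 * B ^ 3 / (9 * ℓ)) η η' := by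
  obtain ⟨h1, h2, h3, h4, h5, h6⟩ := h
  have hc := cont_of_prim h1 h3
  have hφ : IntervalIntegrable (fun t => -((32 * B ^ 3 / (9 * ℓ)) / ℓ) * Real.sqrt (η t)
      + (η' t) ^ 2 / (8 * ℓ ^ 2)) volume 0 1 := by
    apply IntervalIntegrable.add
    · apply ContinuousOn.intervalIntegrable
      rw [uIcc_of_le zero_le_one]
      exact continuousOn_const.mul hc.sqrt
    · apply IntervalIntegrable.div_const
      rw [intervalIntegrable_iff_integrableOn_Ioc_of_le zero_le_one]
      exact h2.mono_set Ioc_subset_Icc_self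
  have := int_lower h1 h3 h6 hφ (-(4 * B ^ 2 / (3 * ℓ ^ 2))) (-(16 * B ^ 4 / (9 * ℓ ^ 2)))
    (-(16 * B ^ 4 / (9 * ℓ ^ 2))) ?_
  · refine le_trans (le_of_eq ?_) this
    field_simp
    ring
  intro t ht
  have hx := Real.sq_sqrt (h4 t ⟨ht.1.le, ht.2.le⟩)
  set x := Real.sqrt (η t)
  have hw := w_sq_lt ht
  rw [← hx]
  unfold k
  set W := w t
  set p := η' t
  have hv : 0 < 1 - W ^ 2 := by linarith
  rw [← sub_nonneg]
  have : -(32 * B ^ 3 / (9 * ℓ) / ℓ) * x + p ^ 2 / (8 * ℓ ^ 2) -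
      (-(4 * B ^ 2 / (3 * ℓ ^ 2)) * (p * W + x ^ 2 * (4 / (3 * (1 - W ^ 2)))) +
        (-(16 * B ^ 4 / (9 * ℓ ^ 2)) + -(16 * B ^ 4 / (9 * ℓ ^ 2)) * W ^ 2))
      = (p + 16 * B ^ 2 * W / 3) ^ 2 / (8 * ℓ ^ 2)
        + 16 * B ^ 2 / (9 * ℓ ^ 2 * (1 - W ^ 2)) * (x - B * (1 - W ^ 2)) ^ 2 := by
    field_simp
    ring
  rw [this]
  positivity

noncomputable def eta (B t : ℝ) : ℝ := B ^ 2 * (1 - w t ^ 2) ^ 2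
noncomputable def eta' (B t : ℝ) : ℝ := -(16 * B ^ 2 / 3) * w t

lemma eta'_cont (B : ℝ) : Continuous (eta' B) := by
  unfold eta'
  exact continuous_const.mul w_cont

lemma eta_cont (B : ℝ) : Continuous (eta B) := by
  unfold eta
  have := w_cont
  fun_prop

lemma eta_zero (B : ℝ) : eta B 0 = 0 := by simp [eta, w_zero]
lemma eta_one (B : ℝ) : eta B 1 = 0 := by simp [eta, w_one]

lemma eta_ftc (B : ℝ) {t : ℝ} (ht : t ∈ Icc (0:ℝ) 1) :
    eta B t = ∫ u in (0:ℝ)..t, eta' B u := by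
  rw [intervalIntegral.integral_eq_sub_of_hasDerivAt_of_le ht.1 (eta_cont B).continuousOn
    _ ((eta'_cont B).intervalIntegrable _ _), eta_zero, sub_zero]
  intro u hu
  have hu' : u ∈ Ioo (0:ℝ) 1 := ⟨hu.1, hu.2.trans_le ht.2⟩
  have h := w_deriv hu'
  refine ((((h.pow 2).const_sub 1).pow 2).const_mul (B ^ 2)).congr_deriv ?_
  have hw := w_sq_lt hu'
  have : 1 - w u ^ 2 ≠ 0 := by linarith
  unfold k eta'
  simp only [Pi.pow_apply]
  push_cast
  field_simp
  ring

lemma eta_sqrt {B : ℝ} (hB : 0 < B) {t : ℝ} (ht : t ∈ Icc (0:ℝ) 1) :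
    Real.sqrt (eta B t) = B * (1 - w t ^ 2) := by
  have := w_sq_le ht
  rw [eta, ← mul_pow, Real.sqrt_sq]
  exact mul_nonneg hB.le (by linarith)

lemma eta_adm {B : ℝ} : AdmissibleH (eta B) (eta' B) := by
  refine ⟨(eta'_cont B).continuousOn.integrableOn_Icc,
    ((eta'_cont B).pow 2).continuousOn.integrableOn_Icc, fun t ht => eta_ftc B ht,
    fun t _ => ?_, eta_zero B, eta_one B⟩
  unfold eta
  positivity

lemma H_eta {ℓ B : ℝ} (hl : 0 < ℓ) (hB : 0 < B) :
    Hfun ℓ (32 * B ^ 3 / (9 * ℓ)) (eta B) (eta' B) = -(32 * B ^ 4) / (15 * ℓ ^ 2) := by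
  unfold Hfun
  have : ∀ t ∈ uIcc (0:ℝ) 1, (-((32 * B ^ 3 / (9 * ℓ)) / ℓ) * Real.sqrt (eta B t)
      + (eta' B t) ^ 2 / (8 * ℓ ^ 2)) = -(32 * B ^ 4 / (9 * ℓ ^ 2))
        + (64 * B ^ 4 / (9 * ℓ ^ 2)) * w t ^ 2 := by
    intro t ht
    rw [uIcc_of_le zero_le_one] at ht
    rw [eta_sqrt hB ht, eta']
    field_simp
    ring
  rw [intervalIntegral.integral_congr this, quad_int]
  field_simp
  ring

lemma minH_eq {ℓ B : ℝ} (hl : 0 < ℓ) (hB : 0 < B) :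
    minH ℓ (32 * B ^ 3 / (9 * ℓ)) = -(32 * B ^ 4) / (15 * ℓ ^ 2) := by
  apply IsLeast.csInf_eq
  refine ⟨⟨_, _, eta_adm, (H_eta hl hB).symm⟩, ?_⟩
  rintro x ⟨η, η', h, rfl⟩
  exact H_lower hl hB h

/-! ### Behaviour of `f₁` near zero -/

lemma f_near {ℓ ℓ₁ : ℝ} {f₁ : ℝ → ℝ} (hf : F1Hyp ℓ ℓ₁ f₁) {ε : ℝ} (hε : 0 < ε) :
    ∃ δ > 0, ∀ x, 0 ≤ x → x < δ → |f₁ x - ℓ + ℓ₁ * x| ≤ ε * x := by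
  have h := hf.lim0
  rw [Metric.tendsto_nhdsWithin_nhds] at h
  obtain ⟨δ, hδ, h⟩ := h ε hε
  refine ⟨δ, hδ, fun x hx hxd => ?_⟩
  rcases eq_or_lt_of_le hx with h0 | h0
  · rw [← h0, hf.f10]; simp
  have := h (x := x) h0 (by rw [Real.dist_eq, sub_zero, abs_of_pos h0]; exact hxd)
  rw [Real.dist_eq, sub_zero, abs_div, abs_of_pos h0, div_lt_iff₀ h0] at this
  exact this.le

lemma f_lower {ℓ ℓ₁ : ℝ} {f₁ : ℝ → ℝ} (hf : F1Hyp ℓ ℓ₁ f₁) {ε : ℝ} (hε : 0 < ε) :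
    ∃ C ≥ 0, ∀ x ∈ Icc (0:ℝ) 1, ℓ - (ℓ₁ + ε) * x - C * x ^ 2 ≤ f₁ x := by
  obtain ⟨δ, hδ, h⟩ := f_near hf hε
  have hl := hf.hl
  have hl1 := hf.hl1
  refine ⟨ℓ / δ ^ 2, by positivity, fun x hx => ?_⟩
  have h0 : 0 ≤ ℓ / δ ^ 2 * x ^ 2 := by positivity
  rcases lt_or_ge x δ with hd | hd
  · have := (abs_le.1 (h x hx.1 hd)).1
    linarith
  · have h1 := hf.nonneg x hx
    have h2 : ℓ ≤ ℓ / δ ^ 2 * x ^ 2 := by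
      rw [div_mul_eq_mul_div, le_div_iff₀ (by positivity)]
      gcongr
    have h3 : 0 ≤ (ℓ₁ + ε) * x := mul_nonneg (by linarith) hx.1
    linarith

/-! ### Lower bound -/

lemma sqrt_taylor {y : ℝ} (h0 : 0 ≤ y) (h1 : y ≤ 1) : 1 - y / 2 - y ^ 2 ≤ Real.sqrt (1 - y) := by
  by_cases h : 1 - y / 2 - y ^ 2 ≤ 0
  · exact h.trans (Real.sqrt_nonneg _)
  apply Real.le_sqrt_of_sq_le
  have h2 : 0 ≤ y ^ 2 * (7/4 - y - y ^ 2) := by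
    apply mul_nonneg (sq_nonneg y)
    linarith
  nlinarith

lemma point_lower {ℓ m C β ε τ f x p W : ℝ} (hl : 0 < ℓ) (hm : 0 < m) (hC : 0 ≤ C) (hβ : 0 < β)
    (hε : 0 < ε) (hε1 : ε < 1) (hτ : 0 < τ) (hβτ : β * τ ≤ 1) (hCτ : C * τ ^ 2 ≤ 2 * β / 3 * ε)
    (hf0 : 0 ≤ f) (hx : 0 ≤ x) (hf : ℓ - m * x - C * x ^ 2 ≤ f) (hW : W ^ 2 < 1) :
    -(β * τ / 2) * (p * W + x ^ 2 * (4 / (3 * (1 - W ^ 2)))) +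
      ((τ ^ 3 * ℓ - τ ^ 5 * (3 * m ^ 2 / (8 * β * (1 - ε)) + ℓ * β ^ 4 * τ ^ 2))
        + (τ ^ 5 * (3 * m ^ 2 / (8 * β * (1 - ε)) - ℓ * β ^ 2 / 2)) * W ^ 2)
      ≤ Real.sqrt ((τ ^ 3) ^ 2 * f ^ 2 + p ^ 2 / 4) := by
  have hv : 0 < 1 - W ^ 2 := by linarith
  have he : 0 < 1 - ε := by linarith
  have hr1 : (β * τ * W) ^ 2 ≤ 1 := by
    rw [mul_pow]
    have : (β * τ) ^ 2 ≤ 1 := pow_le_one₀ (by positivity) hβτ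
    nlinarith [sq_nonneg W]
  have hT := sqrt_taylor (sq_nonneg (β * τ * W)) hr1
  have hc0 := Real.sqrt_nonneg (1 - (β * τ * W) ^ 2)
  have hc2 := Real.sq_sqrt (show 0 ≤ 1 - (β * τ * W) ^ 2 by linarith)
  have hc1 : Real.sqrt (1 - (β * τ * W) ^ 2) ≤ 1 := by
    exact Real.sqrt_le_one.2 (by linarith [sq_nonneg (β * τ * W)])
  set cs := Real.sqrt (1 - (β * τ * W) ^ 2)
  have h1 : τ ^ 3 * f * cs - p / 2 * (β * τ * W) ≤
      Real.sqrt ((τ ^ 3) ^ 2 * f ^ 2 + p ^ 2 / 4) := by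
    apply Real.le_sqrt_of_sq_le
    have : (τ ^ 3) ^ 2 * f ^ 2 + p ^ 2 / 4 - (τ ^ 3 * f * cs - p / 2 * (β * τ * W)) ^ 2
      = (τ ^ 3 * f * (β * τ * W) + p / 2 * cs) ^ 2 := by
      have e : cs ^ 2 = 1 - (β * τ * W) ^ 2 := hc2
      have : (τ ^ 3) ^ 2 * f ^ 2 + p ^ 2 / 4 - (τ ^ 3 * f * cs - p / 2 * (β * τ * W)) ^ 2
        - (τ ^ 3 * f * (β * τ * W) + p / 2 * cs) ^ 2
        = ((τ ^ 3) ^ 2 * f ^ 2 + p ^ 2 / 4) * (1 - (β * τ * W) ^ 2 - cs ^ 2) := by ring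
      rw [e, sub_self, mul_zero] at this
      linarith
    linarith [sq_nonneg (τ ^ 3 * f * (β * τ * W) + p / 2 * cs)]
  refine le_trans ?_ h1
  have h2 : ℓ * (1 - (β * τ * W) ^ 2 / 2 - ((β * τ * W) ^ 2) ^ 2) - m * x - C * x ^ 2 ≤ f * cs := by
    have a1 : (ℓ - m * x - C * x ^ 2) * cs ≤ f * cs := mul_le_mul_of_nonneg_right hf hc0
    have a2 : ℓ * (1 - (β * τ * W) ^ 2 / 2 - ((β * τ * W) ^ 2) ^ 2) ≤ ℓ * cs :=
      mul_le_mul_of_nonneg_left hT hl.le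
    have a3 : (m * x + C * x ^ 2) * cs ≤ (m * x + C * x ^ 2) * 1 :=
      mul_le_mul_of_nonneg_left hc1 (by positivity)
    linarith
  have h3 : ℓ * ((β * τ * W) ^ 2) ^ 2 ≤ ℓ * β ^ 4 * τ ^ 4 := by
    have : (W ^ 2) ^ 2 ≤ 1 := pow_le_one₀ (sq_nonneg W) hW.le
    calc ℓ * ((β * τ * W) ^ 2) ^ 2 = ℓ * β ^ 4 * τ ^ 4 * (W ^ 2) ^ 2 := by ring
      _ ≤ ℓ * β ^ 4 * τ ^ 4 * 1 := by gcongr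
      _ = _ := by ring
  have h4 : 0 ≤ τ ^ 2 * (-(m * x) - C * x ^ 2) + 2 * β / (3 * (1 - W ^ 2)) * x ^ 2
      + τ ^ 4 * (3 * m ^ 2 / (8 * β * (1 - ε))) * (1 - W ^ 2) := by
    have b1 : C * τ ^ 2 ≤ 2 * β / (3 * (1 - W ^ 2)) * ε := by
      refine hCτ.trans ?_
      gcongr
      nlinarith [sq_nonneg W]
    have b2 : C * τ ^ 2 * x ^ 2 ≤ 2 * β / (3 * (1 - W ^ 2)) * ε * x ^ 2 := by gcongr
    have b3 : 2 * β / (3 * (1 - W ^ 2)) * (1 - ε) * x ^ 2 - τ ^ 2 * m * x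
      + τ ^ 4 * (3 * m ^ 2 / (8 * β * (1 - ε))) * (1 - W ^ 2)
      = 2 * β / (3 * (1 - W ^ 2)) * (1 - ε) *
        (x - 3 * m * τ ^ 2 * (1 - W ^ 2) / (4 * β * (1 - ε))) ^ 2 := by
      field_simp
      ring
    have b4 : 0 ≤ 2 * β / (3 * (1 - W ^ 2)) * (1 - ε) *
        (x - 3 * m * τ ^ 2 * (1 - W ^ 2) / (4 * β * (1 - ε))) ^ 2 := by positivity
    linarith
  have h2' := mul_le_mul_of_nonneg_left h2 (pow_pos hτ 3).le
  have h3' := mul_le_mul_of_nonneg_left h3 (pow_pos hτ 3).le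
  have h4' := mul_nonneg hτ.le h4
  have e1 : 4 / (3 * (1 - W ^ 2)) = 2 / β * (2 * β / (3 * (1 - W ^ 2))) := by
    field_simp
    ring
  have e2 : β * τ / 2 * (x ^ 2 * (2 / β * (2 * β / (3 * (1 - W ^ 2)))))
    = τ * (2 * β / (3 * (1 - W ^ 2)) * x ^ 2) := by
    field_simp
  rw [e1]
  generalize 2 * β / (3 * (1 - W ^ 2)) = K at *
  generalize 3 * m ^ 2 / (8 * β * (1 - ε)) = M at *
  nlinarith

lemma energy_ii {ℓ ℓ₁ s : ℝ} {f₁ : ℝ → ℝ} (hf : F1Hyp ℓ ℓ₁ f₁) {γ γ' : ℝ → ℝ}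
    (h : Admissible γ γ') :
    IntervalIntegrable (fun t => Real.sqrt (s ^ 2 * (f₁ (Real.sqrt (γ t))) ^ 2 + (γ' t) ^ 2 / 4))
      volume 0 1 := by
  obtain ⟨h1, h2, h3, h4, h5⟩ := h
  have hc := cont_of_prim h1 h2
  have hF : ContinuousOn (fun t => f₁ (Real.sqrt (γ t))) (Icc 0 1) := by
    refine hf.cont.comp hc.sqrt ?_
    intro t ht
    exact ⟨Real.sqrt_nonneg _, Real.sqrt_le_one.2 (h3 t ht).2⟩
  rw [intervalIntegrable_iff_integrableOn_Icc_of_le zero_le_one]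
  have hFi : IntegrableOn (fun t => |s| * |f₁ (Real.sqrt (γ t))| + |γ' t| / 2) (Icc 0 1) :=
    ((continuousOn_const.mul hF.abs).integrableOn_Icc).add (h1.abs.div_const 2)
  refine Integrable.mono' hFi ?_ ?_
  · have hm := hF.aestronglyMeasurable measurableSet_Icc (μ := volume)
    have a1 := (hm.aemeasurable.pow_const 2).const_mul (s ^ 2)
    have a2 := (h1.aestronglyMeasurable.aemeasurable.pow_const 2).div_const 4
    exact (a1.add a2).sqrt.aestronglyMeasurable
  · refine Eventually.of_forall fun t => ?_
    rw [Real.norm_eq_abs, abs_of_nonneg (Real.sqrt_nonneg _)]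
    apply Real.sqrt_le_iff.2
    refine ⟨by positivity, ?_⟩
    rw [add_sq, mul_pow, sq_abs, sq_abs, div_pow, sq_abs]
    have : 0 ≤ 2 * (|s| * |f₁ (Real.sqrt (γ t))|) * (|γ' t| / 2) := by positivity
    linarith

lemma energy_lower {ℓ ℓ₁ : ℝ} {f₁ : ℝ → ℝ} (hf : F1Hyp ℓ ℓ₁ f₁) {m C β ε τ : ℝ}
    (hm : 0 < m) (hC : 0 ≤ C) (hβ : 0 < β)
    (hε : 0 < ε) (hε1 : ε < 1) (hτ : 0 < τ) (hβτ : β * τ ≤ 1) (hCτ : C * τ ^ 2 ≤ 2 * β / 3 * ε)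
    (hfl : ∀ x ∈ Icc (0:ℝ) 1, ℓ - m * x - C * x ^ 2 ≤ f₁ x)
    {γ γ' : ℝ → ℝ} (h : Admissible γ γ') :
    τ ^ 3 * ℓ - τ ^ 5 * (3 * m ^ 2 / (10 * β * (1 - ε)) + ℓ * β ^ 2 / 10 + ℓ * β ^ 4 * τ ^ 2)
      ≤ energy f₁ (τ ^ 3) γ γ' := by
  have hii := energy_ii (s := τ ^ 3) hf h
  obtain ⟨h1, h2, h3, h4, h5⟩ := h
  have := int_lower h1 h2 h5 hii (-(β * τ / 2))
    ((τ ^ 3 * ℓ - τ ^ 5 * (3 * m ^ 2 / (8 * β * (1 - ε)) + ℓ * β ^ 4 * τ ^ 2)))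
    (τ ^ 5 * (3 * m ^ 2 / (8 * β * (1 - ε)) - ℓ * β ^ 2 / 2)) ?_
  · refine le_trans (le_of_eq ?_) this
    have : 1 - ε ≠ 0 := by linarith
    field_simp
    ring
  intro t ht
  have ht' : t ∈ Icc (0:ℝ) 1 := ⟨ht.1.le, ht.2.le⟩
  have hx := Real.sq_sqrt (h3 t ht').1
  have hx1 : Real.sqrt (γ t) ∈ Icc (0:ℝ) 1 :=
    ⟨Real.sqrt_nonneg _, Real.sqrt_le_one.2 (h3 t ht').2⟩
  have := point_lower (p := γ' t) hf.hl hm hC hβ hε hε1 hτ hβτ hCτ (hf.nonneg _ hx1) hx1.1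
    (hfl _ hx1) (w_sq_lt ht)
  rw [hx] at this
  exact this

/-! ### Upper bound -/

lemma energy_upper {ℓ ℓ₁ : ℝ} {f₁ : ℝ → ℝ} (hf : F1Hyp ℓ ℓ₁ f₁) {B ε τ : ℝ} (hB : 0 < B)
    (hτ : 0 < τ) (hε : 0 < ε) (hεl : ε < ℓ) (hτ1 : τ ^ 2 * B ≤ 1)
    (hfu : ∀ x, 0 ≤ x → x ≤ τ ^ 2 * B → ℓ - ε ≤ f₁ x ∧ f₁ x ≤ ℓ - (ℓ₁ - ε) * x) :
    ∃ γ γ', Admissible γ γ' ∧ energy f₁ (τ ^ 3) γ γ' ≤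
      τ ^ 3 * ℓ + τ ^ 5 * (-(ℓ₁ - ε) * B * (4 / 5) + 32 * B ^ 4 / (45 * (ℓ - ε))) := by
  have hadm : Admissible (fun t => τ ^ 4 * eta B t) (fun t => τ ^ 4 * eta' B t) := by
    refine ⟨(continuous_const.mul (eta'_cont B)).continuousOn.integrableOn_Icc, ?_, ?_, ?_, ?_⟩
    · intro t ht
      rw [intervalIntegral.integral_const_mul, ← eta_ftc B ht]
    · intro t ht
      have hw := w_sq_le ht
      refine ⟨by unfold eta; positivity, ?_⟩
      have h1 : (1 - w t ^ 2) ≤ 1 := by linarith [sq_nonneg (w t)]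
      have h0 : 0 ≤ (1 - w t ^ 2) := by linarith
      calc τ ^ 4 * eta B t = (τ ^ 2 * B * (1 - w t ^ 2)) ^ 2 := by unfold eta; ring
        _ ≤ 1 := pow_le_one₀ (by positivity) (mul_le_one₀ hτ1 h0 h1)
    · simp [eta_zero]
    · simp [eta_one]
  refine ⟨_, _, hadm, ?_⟩
  have hD : 0 < ℓ - ε := by linarith
  unfold energy
  have hq := quad_int (τ ^ 3 * ℓ - τ ^ 5 * ((ℓ₁ - ε) * B))
    (τ ^ 5 * ((ℓ₁ - ε) * B + 32 * B ^ 4 / (9 * (ℓ - ε))))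
  have := intervalIntegral.integral_mono_on zero_le_one (energy_ii (s := τ ^ 3) hf hadm)
    (quad_ii (τ ^ 3 * ℓ - τ ^ 5 * ((ℓ₁ - ε) * B))
    (τ ^ 5 * ((ℓ₁ - ε) * B + 32 * B ^ 4 / (9 * (ℓ - ε))))) ?_
  · rw [hq] at this
    refine this.trans (le_of_eq ?_)
    field_simp
    ring
  intro t ht
  have hw := w_sq_le ht
  have h1 : (1 - w t ^ 2) ≤ 1 := by linarith [sq_nonneg (w t)]
  have h0 : 0 ≤ (1 - w t ^ 2) := by linarith
  have hs : Real.sqrt (τ ^ 4 * eta B t) = τ ^ 2 * B * (1 - w t ^ 2) := by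
    rw [show τ ^ 4 * eta B t = (τ ^ 2 * B * (1 - w t ^ 2)) ^ 2 by unfold eta; ring, Real.sqrt_sq]
    positivity
  rw [hs]
  obtain ⟨ha, hb⟩ := hfu (τ ^ 2 * B * (1 - w t ^ 2)) (by positivity)
    (mul_le_of_le_one_right (by positivity) h1)
  set F := f₁ (τ ^ 2 * B * (1 - w t ^ 2))
  have hF : 0 < F := by linarith
  have hb' := mul_le_mul_of_nonneg_left hb (pow_pos hτ 3).le
  have key : Real.sqrt ((τ ^ 3) ^ 2 * F ^ 2 + (τ ^ 4 * eta' B t) ^ 2 / 4) ≤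
      τ ^ 3 * F + τ ^ 5 * (32 * B ^ 4 / (9 * (ℓ - ε))) * w t ^ 2 := by
    apply Real.sqrt_le_iff.2
    refine ⟨by positivity, ?_⟩
    have hFD : 32 * B ^ 4 / 9 ≤ F * (32 * B ^ 4 / (9 * (ℓ - ε))) := by
      rw [← mul_div_assoc, div_le_div_iff₀ (by norm_num) (by positivity)]
      have := mul_le_mul_of_nonneg_left ha (show 0 ≤ 32 * B ^ 4 * 9 by positivity)
      linarith
    generalize 32 * B ^ 4 / (9 * (ℓ - ε)) = D at *
    have h5 := mul_le_mul_of_nonneg_left hFD (show 0 ≤ 2 * τ ^ 8 * w t ^ 2 by positivity)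
    unfold eta'
    nlinarith [sq_nonneg (τ ^ 5 * D * w t ^ 2)]
  refine key.trans ?_
  linarith

/-! ### Conclusion -/

lemma tau_tendsto : Tendsto (fun s : ℝ => s ^ ((1:ℝ)/3)) (nhdsWithin 0 (Ioi 0)) (nhds 0) := by
  have : ContinuousAt (fun s : ℝ => s ^ ((1:ℝ)/3)) 0 :=
    Real.continuousAt_rpow_const _ _ (Or.inr (by norm_num))
  have h := this.tendsto
  rw [Real.zero_rpow (by norm_num)] at h
  exact h.mono_left nhdsWithin_le_nhds

/-- Reduction to the variable `τ = s ^ (1/3)`. -/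
lemma limit_of_tau {g : ℝ → ℝ} {ℓ L : ℝ}
    (hlow : ∀ a < L, ∃ τ₀ > 0, ∀ τ, 0 < τ → τ < τ₀ → τ ^ 3 * ℓ + τ ^ 5 * a ≤ g (τ ^ 3))
    (hup : ∀ a > L, ∃ τ₀ > 0, ∀ τ, 0 < τ → τ < τ₀ → g (τ ^ 3) ≤ τ ^ 3 * ℓ + τ ^ 5 * a) :
    Tendsto (fun s => (g s - ℓ * s) / s ^ ((5:ℝ)/3)) (nhdsWithin 0 (Ioi 0)) (nhds L) := by
  have e3 : ∀ s : ℝ, 0 < s → (s ^ ((1:ℝ)/3)) ^ 3 = s := by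
    intro s hs
    rw [← Real.rpow_natCast, ← Real.rpow_mul hs.le]; norm_num
  have e5 : ∀ s : ℝ, 0 < s → (s ^ ((1:ℝ)/3)) ^ 5 = s ^ ((5:ℝ)/3) := by
    intro s hs
    rw [← Real.rpow_natCast, ← Real.rpow_mul hs.le]; norm_num
  have ht0 : ∀ τ₀ > 0, ∀ᶠ s in nhdsWithin (0:ℝ) (Ioi 0), s ^ ((1:ℝ)/3) < τ₀ :=
    fun τ₀ h => tau_tendsto.eventually (gt_mem_nhds h)
  rw [tendsto_order]
  constructor
  · intro a ha
    obtain ⟨b, hab, hb⟩ := exists_between ha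
    obtain ⟨τ₀, h0, h⟩ := hlow b hb
    filter_upwards [ht0 τ₀ h0, self_mem_nhdsWithin] with s hs hs0
    have hs0 : 0 < s := hs0
    have := h _ (Real.rpow_pos_of_pos hs0 _) hs
    rw [e3 s hs0, e5 s hs0] at this
    refine hab.trans_le ?_
    rw [le_div_iff₀ (Real.rpow_pos_of_pos hs0 _)]
    linarith
  · intro a ha
    obtain ⟨b, hb, hab⟩ := exists_between ha
    obtain ⟨τ₀, h0, h⟩ := hup b hb
    filter_upwards [ht0 τ₀ h0, self_mem_nhdsWithin] with s hs hs0
    have hs0 : 0 < s := hs0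
    have := h _ (Real.rpow_pos_of_pos hs0 _) hs
    rw [e3 s hs0, e5 s hs0] at this
    refine lt_of_le_of_lt ?_ hab
    rw [div_le_iff₀ (Real.rpow_pos_of_pos hs0 _)]
    linarith

lemma zero_adm : Admissible (fun _ => 0) (fun _ => 0) := by
  refine ⟨by simp, by simp, by simp, rfl, rfl⟩

lemma g0_le {f₁ : ℝ → ℝ} {s : ℝ} {γ γ' : ℝ → ℝ} (h : Admissible γ γ') :
    g0 f₁ s ≤ energy f₁ s γ γ' := by
  refine csInf_le ⟨0, ?_⟩ ⟨γ, γ', h, rfl⟩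
  rintro x ⟨γ, γ', -, rfl⟩
  exact intervalIntegral.integral_nonneg zero_le_one (fun t _ => Real.sqrt_nonneg _)

lemma le_g0 {f₁ : ℝ → ℝ} {s a : ℝ} (h : ∀ γ γ', Admissible γ γ' → a ≤ energy f₁ s γ γ') :
    a ≤ g0 f₁ s := by
  refine le_csInf ⟨_, ⟨_, _, zero_adm, rfl⟩⟩ ?_
  rintro x ⟨γ, γ', hγ, rfl⟩
  exact h γ γ' hγ

lemma exists_eps {F : ℝ → ℝ} (hF : ContinuousAt F 0) {c : ℝ} (hc : 0 < c) {U : Set ℝ}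
    (hU : U ∈ nhds (F 0)) : ∃ ε, 0 < ε ∧ ε < c ∧ F ε ∈ U := by
  have h1 : ∀ᶠ ε in nhdsWithin (0:ℝ) (Ioi 0), F ε ∈ U :=
    (hF.tendsto.mono_left nhdsWithin_le_nhds) hU
  have h2 : ∀ᶠ ε in nhdsWithin (0:ℝ) (Ioi 0), ε < c :=
    nhdsWithin_le_nhds (gt_mem_nhds hc)
  obtain ⟨ε, ⟨ha, hb⟩, hd⟩ := ((h1.and h2).and self_mem_nhdsWithin).exists
  exact ⟨ε, hd, hb, ha⟩

lemma sq_small {τ τ₀ : ℝ} (h0 : 0 < τ) (h1 : τ < τ₀) (h2 : τ₀ ≤ 1) : τ ^ 2 ≤ τ₀ := by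
  nlinarith

lemma main_lower {ℓ ℓ₁ B : ℝ} {f₁ : ℝ → ℝ} (hf : F1Hyp ℓ ℓ₁ f₁) (hB : 0 < B)
    (hℓ₁ : ℓ₁ = 32 * B ^ 3 / (9 * ℓ)) :
    ∀ a < -(32 * B ^ 4) / (15 * ℓ), ∃ τ₀ > 0, ∀ τ, 0 < τ → τ < τ₀ →
      τ ^ 3 * ℓ + τ ^ 5 * a ≤ g0 f₁ (τ ^ 3) := by
  intro a ha
  have hl := hf.hl
  have hl1 := hf.hl1
  obtain ⟨β, hβd⟩ : ∃ β, β = 8 * B ^ 2 / (3 * ℓ) := ⟨_, rfl⟩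
  have hβ : 0 < β := by rw [hβd]; positivity
  let F : ℝ → ℝ := fun ε => -(3 * (ℓ₁ + ε) ^ 2 / (10 * β * (1 - ε)) + ℓ * β ^ 2 / 10
    + ℓ * β ^ 4 * ε)
  have hFc : ContinuousAt F 0 := by
    have : (10 * β * (1 - 0)) ≠ 0 := by positivity
    fun_prop (disch := exact this)
  have hF0 : F 0 = -(32 * B ^ 4) / (15 * ℓ) := by
    simp only [F]
    rw [hβd, hℓ₁]
    field_simp
    ring
  obtain ⟨ε, hε, hε1, hFε⟩ := exists_eps hFc one_pos (U := Ioi a)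
    (by rw [hF0]; exact Ioi_mem_nhds ha)
  obtain ⟨C, hC, hfl⟩ := f_lower hf hε
  refine ⟨min (min 1 ε) (min (1 / β) ((2 * β / 3 * ε) / (C + 1))), by positivity, ?_⟩
  intro τ hτ hτ0
  have t1 : τ < 1 := hτ0.trans_le ((min_le_left _ _).trans (min_le_left _ _))
  have t2 : τ < ε := hτ0.trans_le ((min_le_left _ _).trans (min_le_right _ _))
  have t3 : τ < 1 / β := hτ0.trans_le ((min_le_right _ _).trans (min_le_left _ _))
  have t4 : τ < (2 * β / 3 * ε) / (C + 1) :=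
    hτ0.trans_le ((min_le_right _ _).trans (min_le_right _ _))
  rw [lt_div_iff₀ hβ] at t3
  rw [lt_div_iff₀ (by positivity)] at t4
  have ts : τ ^ 2 ≤ τ := by nlinarith
  have hCτ : C * τ ^ 2 ≤ 2 * β / 3 * ε := by
    have := mul_le_mul_of_nonneg_left ts hC
    nlinarith
  apply le_g0
  intro γ γ' hγ
  refine le_trans ?_ (energy_lower hf (m := ℓ₁ + ε) (by linarith) hC hβ hε hε1 hτ
    (by linarith) hCτ hfl hγ)
  have h1 : a < F ε := hFε
  have h2 : ℓ * β ^ 4 * τ ^ 2 ≤ ℓ * β ^ 4 * ε := by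
    gcongr; linarith
  have h3 : a ≤ -(3 * (ℓ₁ + ε) ^ 2 / (10 * β * (1 - ε)) + ℓ * β ^ 2 / 10
    + ℓ * β ^ 4 * τ ^ 2) := by
    simp only [F] at h1
    linarith
  have := mul_le_mul_of_nonneg_left h3 (pow_pos hτ 5).le
  linarith

lemma main_upper {ℓ ℓ₁ B : ℝ} {f₁ : ℝ → ℝ} (hf : F1Hyp ℓ ℓ₁ f₁) (hB : 0 < B)
    (hℓ₁ : ℓ₁ = 32 * B ^ 3 / (9 * ℓ)) :
    ∀ a > -(32 * B ^ 4) / (15 * ℓ), ∃ τ₀ > 0, ∀ τ, 0 < τ → τ < τ₀ →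
      g0 f₁ (τ ^ 3) ≤ τ ^ 3 * ℓ + τ ^ 5 * a := by
  intro a ha
  have hl := hf.hl
  have hl1 := hf.hl1
  let F : ℝ → ℝ := fun ε => (-(ℓ₁ - ε) * B * (4 / 5) + 32 * B ^ 4 / (45 * (ℓ - ε)))
  have hFc : ContinuousAt F 0 := by
    have : (45 * (ℓ - 0)) ≠ 0 := by simp [hl.ne']
    fun_prop (disch := exact this)
  have hF0 : F 0 = -(32 * B ^ 4) / (15 * ℓ) := by
    simp only [F]
    rw [hℓ₁, sub_zero, sub_zero]
    field_simp
    ring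
  obtain ⟨ε, hε, hεl, hFε⟩ := exists_eps hFc hl (U := Iio a)
    (by rw [hF0]; exact Iio_mem_nhds ha)
  obtain ⟨δ, hδ, hn⟩ := f_near hf hε
  refine ⟨min (min 1 (1 / B)) (min (δ / B) (ε / (ℓ₁ + ε) / B)), by positivity, ?_⟩
  intro τ hτ hτ0
  have t1 : τ < 1 := hτ0.trans_le ((min_le_left _ _).trans (min_le_left _ _))
  have t2 : τ < 1 / B := hτ0.trans_le ((min_le_left _ _).trans (min_le_right _ _))
  have t3 : τ < δ / B := hτ0.trans_le ((min_le_right _ _).trans (min_le_left _ _))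
  have t4 : τ < ε / (ℓ₁ + ε) / B := hτ0.trans_le ((min_le_right _ _).trans (min_le_right _ _))
  rw [lt_div_iff₀ hB] at t2 t3 t4
  rw [lt_div_iff₀ (by positivity)] at t4
  have ts : τ ^ 2 ≤ τ := by nlinarith
  have tB : τ ^ 2 * B ≤ τ * B := by gcongr
  obtain ⟨γ, γ', hγ, hE⟩ := energy_upper (τ := τ) hf hB hτ hε hεl (by linarith) (by
    intro x hx0 hx
    have hx' : x ≤ τ * B := hx.trans tB
    have := abs_le.1 (hn x hx0 (by linarith))
    have h2 : x * (ℓ₁ + ε) ≤ τ * B * (ℓ₁ + ε) := by gcongr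
    constructor <;> linarith [this.1, this.2])
  refine (g0_le hγ).trans (hE.trans ?_)
  have h1 : F ε < a := hFε
  have := mul_le_mul_of_nonneg_left h1.le (pow_pos hτ 5).le
  simp only [F] at this
  linarith

end Pf

/-- the limit of `(g₀(s) − ℓ s)/s^{5/3}` as `s → 0⁺` exists, equals
`ℓ · inf H`, and is strictly negative. -/
theorem stmt_1 (ℓ ℓ₁ : ℝ) (f₁ : ℝ → ℝ) (hf : F1Hyp ℓ ℓ₁ f₁) :
    ℓ * minH ℓ ℓ₁ < 0 ∧
    Tendsto (fun s => (g0 f₁ s - ℓ * s) / s ^ ((5:ℝ)/3))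
      (nhdsWithin 0 (Ioi 0)) (nhds (ℓ * minH ℓ ℓ₁)) := by 
  have hl := hf.hl
  have hl1 := hf.hl1
  obtain ⟨B, hB, hBe⟩ : ∃ B : ℝ, 0 < B ∧ B ^ 3 = 9 * ℓ₁ * ℓ / 32 := by
    refine ⟨(9 * ℓ₁ * ℓ / 32) ^ ((1:ℝ)/3), by positivity, ?_⟩
    rw [← Real.rpow_natCast, ← Real.rpow_mul (by positivity)]
    norm_num
  have hℓ₁ : ℓ₁ = 32 * B ^ 3 / (9 * ℓ) := by
    rw [hBe]; field_simp
  have hmin : ℓ * minH ℓ ℓ₁ = -(32 * B ^ 4) / (15 * ℓ) := by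
    rw [hℓ₁, Pf.minH_eq hl hB]
    field_simp
  rw [hmin]
  constructor
  · rw [neg_div]
    have : 0 < 32 * B ^ 4 / (15 * ℓ) := by positivity
    linarith
  · exact Pf.limit_of_tau (Pf.main_lower hf hB hℓ₁) (Pf.main_upper hf hB hℓ₁)
end

section
/- Let s > 0 be such that g₀(s) < 1. Then there exists exactly one admissible γ_s with ∫₀¹ √( s² f₁(√(γ_s(t)))² + γ_s'(t)²/4 ) dt = g₀(s); moreover γ_s is continuously differentiable on (0,1) and attains its maximum over [0,1] at the point t = 1/2. -/
open MeasureTheory Set Filter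

open scoped Topology

theorem inv_lemma {f : ℝ → ℝ} {a b : ℝ} (hab : a ≤ b) (hc : ContinuousOn f (Icc a b))
    (hm : StrictMonoOn f (Icc a b)) :
    ∃ g : ℝ → ℝ, ContinuousOn g (Icc (f a) (f b)) ∧ StrictMonoOn g (Icc (f a) (f b)) ∧
      (∀ y ∈ Icc (f a) (f b), g y ∈ Icc a b ∧ f (g y) = y) ∧ (∀ x ∈ Icc a b, g (f x) = x) := by
  have hsurj : ∀ y ∈ Icc (f a) (f b), ∃ x ∈ Icc a b, f x = y := fun y hy =>
    intermediate_value_Icc hab hc hy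
  choose! g hg1 hg2 using hsurj
  have hmaps : ∀ x ∈ Icc a b, f x ∈ Icc (f a) (f b) := fun x hx =>
    ⟨hm.monotoneOn ⟨le_rfl, hab⟩ hx hx.1, hm.monotoneOn hx ⟨hab, le_rfl⟩ hx.2⟩
  have hleft : ∀ x ∈ Icc a b, g (f x) = x := fun x hx =>
    hm.injOn (hg1 _ (hmaps x hx)) hx (hg2 _ (hmaps x hx))
  have hmono : StrictMonoOn g (Icc (f a) (f b)) := by
    intro y hy z hz hyz
    by_contra hcon
    push Not at hcon
    have := hm.monotoneOn (hg1 z hz) (hg1 y hy) hcon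
    rw [hg2 z hz, hg2 y hy] at this
    linarith
  refine ⟨g, ?_, hmono, fun y hy => ⟨hg1 y hy, hg2 y hy⟩, hleft⟩
  intro y hy
  have h1 : Continuous (Icc (f a) (f b) |>.domRestrict g) := by
    let g' : Icc (f a) (f b) → Icc a b := fun y => ⟨g y, hg1 y y.2⟩
    have hg'm : StrictMono g' := fun y z hyz => hmono y.2 z.2 hyz
    have hg's : Function.Surjective g' := fun x => ⟨⟨f x, hmaps x x.2⟩, Subtype.ext (hleft x x.2)⟩
    have : Continuous g' := hg'm.monotone.continuous_of_surjective hg's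
    exact continuous_subtype_val.comp this
  exact (continuousOn_iff_continuous_domRestrict.mpr h1) y hy

theorem ibp {f g f' g' : ℝ → ℝ} (hf' : IntervalIntegrable f' volume 0 1)
    (hg' : IntervalIntegrable g' volume 0 1)
    (hf : ∀ t ∈ Icc (0:ℝ) 1, f t = f 0 + ∫ u in (0:ℝ)..t, f' u)
    (hg : ∀ t ∈ Icc (0:ℝ) 1, g t = g 0 + ∫ u in (0:ℝ)..t, g' u) :
    ∫ t in (0:ℝ)..1, (f' t * g t + f t * g' t) = f 1 * g 1 - f 0 * g 0 := by
  have hF := hf'.absolutelyContinuousOnInterval_intervalIntegral (c := 0) (by simp)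
  have hG := hg'.absolutelyContinuousOnInterval_intervalIntegral (c := 0) (by simp)
  have cac : ∀ c : ℝ, AbsolutelyContinuousOnInterval (fun _ => c) 0 1 := by
    intro c
    apply LipschitzOnWith.absolutelyContinuousOnInterval (K := 0)
    exact (LipschitzWith.const c).lipschitzOnWith
  have hF2 := (cac (f 0)).add hF
  have hG2 := (cac (g 0)).add hG
  have key := AbsolutelyContinuousOnInterval.integral_deriv_mul_eq_sub hF2 hG2
  have e0 : (0:ℝ) ∈ Icc (0:ℝ) 1 := by simp
  have e1 : (1:ℝ) ∈ Icc (0:ℝ) 1 := by simp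
  simp only [Pi.add_apply] at key
  rw [← hf 1 e1, ← hg 1 e1, ← hf 0 e0, ← hg 0 e0] at key
  rw [← key]
  apply intervalIntegral.integral_congr_ae
  filter_upwards [hf'.ae_hasDerivAt_integral, hg'.ae_hasDerivAt_integral] with x h1 h2 h3
  have h3' : x ∈ uIcc (0:ℝ) 1 := uIoc_subset_uIcc h3
  have h3'' : x ∈ Icc (0:ℝ) 1 := by rwa [uIcc_of_le zero_le_one] at h3'
  have d1 := ((h1 h3' 0 (by simp)).const_add (f 0)).deriv
  have d2 := ((h2 h3' 0 (by simp)).const_add (g 0)).deriv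
  rw [← hf x h3'', ← hg x h3'']
  have e1 : deriv ((fun _ => f 0) + fun x => ∫ u in (0:ℝ)..x, f' u) x = f' x := d1
  have e2 : deriv ((fun _ => g 0) + fun x => ∫ u in (0:ℝ)..x, g' u) x = g' x := d2
  rw [e1, e2]

theorem h_facts {ℓ ℓ₁ : ℝ} {f₁ : ℝ → ℝ} (hf : F1Hyp ℓ ℓ₁ f₁) :
    ∃ h h' : ℝ → ℝ, (∀ u, h u = f₁ (Real.sqrt u)) ∧ ContinuousOn h (Icc 0 1) ∧ h 0 = ℓ ∧ h 1 = 0 ∧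
      StrictAntiOn h (Icc 0 1) ∧ (∀ u ∈ Ioo (0:ℝ) 1, HasDerivAt h (h' u) u) ∧
      ContinuousOn h' (Ioo 0 1) ∧ (∀ u ∈ Ioo (0:ℝ) 1, h' u < 0) ∧
      (∀ u ∈ Ioo (0:ℝ) 1, ∀ v ∈ Icc (0:ℝ) 1, h u + h' u * (v - u) ≤ h v) ∧
      Tendsto h' (𝓝[>] 0) atBot := by
  obtain ⟨d, hd, hd'⟩ := hf.diff
  have smem : ∀ u ∈ Icc (0:ℝ) 1, Real.sqrt u ∈ Icc (0:ℝ) 1 := fun u hu =>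
    ⟨Real.sqrt_nonneg u, Real.sqrt_le_one.mpr hu.2⟩
  have smem' : ∀ u ∈ Ioo (0:ℝ) 1, Real.sqrt u ∈ Ioo (0:ℝ) 1 := fun u hu =>
    ⟨Real.sqrt_pos.mpr hu.1, by rw [Real.sqrt_lt' one_pos]; simpa using hu.2⟩
  set h : ℝ → ℝ := fun u => f₁ (Real.sqrt u) with hh
  set h' : ℝ → ℝ := fun u => d (Real.sqrt u) * (1 / (2 * Real.sqrt u)) with hh'
  have hcont : ContinuousOn h (Icc 0 1) := hf.cont.comp Real.continuous_sqrt.continuousOn smem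
  have h0 : h 0 = ℓ := by simp [hh, hf.f10]
  have h1 : h 1 = 0 := by simp [hh, hf.f11]
  have hanti : StrictAntiOn h (Icc 0 1) := by
    intro u hu v hv huv
    exact hf.anti (smem u hu) (smem v hv) (Real.sqrt_lt_sqrt hu.1 huv)
  have hder : ∀ u ∈ Ioo (0:ℝ) 1, HasDerivAt h (h' u) u := by
    intro u hu
    have hs := smem' u hu
    have a1 := (hd' (Real.sqrt u) ⟨hs.1, hs.2.le⟩).hasDerivAt
      (Filter.mem_of_superset (Ioo_mem_nhds hs.1 hs.2) Ioo_subset_Ioc_self)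
    exact a1.comp u (Real.hasDerivAt_sqrt hu.1.ne')
  have hcont' : ContinuousOn h' (Ioo 0 1) := by
    apply ContinuousOn.mul
    · exact hd.comp Real.continuous_sqrt.continuousOn (fun u hu => Ioo_subset_Ioc_self (smem' u hu))
    · apply ContinuousOn.div continuousOn_const (by fun_prop)
      intro u hu
      have := (smem' u hu).1
      positivity
  have htan : ∀ u ∈ Ioo (0:ℝ) 1, ∀ v ∈ Icc (0:ℝ) 1, h u + h' u * (v - u) ≤ h v := by
    intro u hu v hv
    rcases lt_trichotomy u v with huv | huv | huv
    · have := hf.convexSqrt.le_slope_of_hasDerivAt (Ioo_subset_Icc_self hu) hv huv (hder u hu)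
      rw [slope_def_field, le_div_iff₀ (by linarith)] at this
      simp only [hh] at *
      linarith
    · subst huv; simp
    · have := hf.convexSqrt.slope_le_of_hasDerivAt hv (Ioo_subset_Icc_self hu) huv (hder u hu)
      rw [slope_def_field, div_le_iff₀ (by linarith)] at this
      simp only [hh] at *
      linarith
  refine ⟨h, h', fun _ => rfl, hcont, h0, h1, hanti, hder, hcont', ?_, htan, ?_⟩
  · intro u hu
    have a := htan u hu 1 (by simp)
    have b := hanti (Ioo_subset_Icc_self hu) (by simp : (1:ℝ) ∈ Icc (0:ℝ) 1) hu.2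
    rw [h1] at a b
    by_contra hc
    push Not at hc
    nlinarith [mul_nonneg hc (by linarith [hu.2] : (0:ℝ) ≤ 1 - u)]
  · rw [tendsto_atBot]
    intro M
    -- choose v with (h v - ℓ)/v < M - 1 and then u small
    have hlim : Tendsto (fun s => (f₁ s - ℓ) / s) (𝓝[>] 0) (𝓝 (-ℓ₁)) := by
      have := hf.lim0.sub_const ℓ₁
      rw [zero_sub] at this
      refine this.congr' ?_
      filter_upwards [self_mem_nhdsWithin] with s hs
      have hs' : s ≠ 0 := ne_of_gt hs
      field_simp
      ring
    have hev : ∀ᶠ s in 𝓝[>] (0:ℝ), (f₁ s - ℓ) / s < -ℓ₁ / 2 :=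
      hlim.eventually_lt_const (by linarith [hf.hl1])
    obtain ⟨r, hr1, hr2, hr3, hr4⟩ : ∃ r : ℝ, 0 < r ∧ r < 1 ∧ (f₁ r - ℓ) / r < -ℓ₁ / 2 ∧
        -ℓ₁ / 2 < r * M := by
      have e1 : ∀ᶠ s in 𝓝[>] (0:ℝ), s < 1 :=
        nhdsWithin_le_nhds (gt_mem_nhds one_pos)
      have e2 : ∀ᶠ s in 𝓝[>] (0:ℝ), -ℓ₁ / 2 < s * M := by
        apply nhdsWithin_le_nhds
        have : Tendsto (fun s : ℝ => s * M) (𝓝 0) (𝓝 (0 * M)) :=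
          (continuous_id.mul continuous_const).tendsto 0
        exact this.eventually_const_lt (by linarith [hf.hl1])
      have := (hev.and (e1.and (e2.and self_mem_nhdsWithin))).exists
      obtain ⟨r, a, b, c, e⟩ := this
      exact ⟨r, e, b, a, c⟩
    set v := r ^ 2 with hv
    have hv0 : 0 < v := by positivity
    have hv1 : v < 1 := by rw [hv]; nlinarith
    have hhv : h v = f₁ r := by simp only [hh, hv]; rw [Real.sqrt_sq hr1.le]
    have hlt : h v - ℓ < M * v := by
      rw [hhv]
      rw [div_lt_iff₀ hr1] at hr3
      have : r * (-ℓ₁/2) < r * (r * M) := mul_lt_mul_of_pos_left hr4 hr1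
      rw [hv]; nlinarith
    have hc0 : Tendsto (fun u => h v - h u - M * (v - u)) (𝓝[>] 0) (𝓝 (h v - h 0 - M * (v - 0))) := by
      have : ContinuousWithinAt (fun u => h v - h u - M * (v - u)) (Icc 0 1) 0 := by
        have := hcont 0 (by simp)
        fun_prop
      refine this.tendsto.mono_left ?_
      rw [← nhdsWithin_Ioc_eq_nhdsGT (zero_lt_one)]
      exact nhdsWithin_mono _ Ioc_subset_Icc_self
    have hev2 := hc0.eventually_lt_const (u := 0) (by rw [h0]; linarith)
    have e1 : ∀ᶠ s in 𝓝[>] (0:ℝ), s < v := nhdsWithin_le_nhds (gt_mem_nhds hv0)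
    filter_upwards [hev2, e1, self_mem_nhdsWithin] with u hu1 hu2 hu3
    have hu3 : 0 < u := hu3
    have t := htan u ⟨hu3, by linarith⟩ v ⟨hv0.le, hv1.le⟩
    by_contra hc
    push Not at hc
    nlinarith [mul_pos (sub_pos.mpr hc) (sub_pos.mpr hu2)]

theorem kappa_facts {ℓ : ℝ} (hl : 0 < ℓ) {h h' : ℝ → ℝ} (hcont : ContinuousOn h (Icc 0 1))
    (h0 : h 0 = ℓ) (h1 : h 1 = 0) (hanti : StrictAntiOn h (Icc 0 1))
    (hder : ∀ u ∈ Ioo (0:ℝ) 1, HasDerivAt h (h' u) u)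
    (hcont' : ContinuousOn h' (Ioo 0 1)) (hneg : ∀ u ∈ Ioo (0:ℝ) 1, h' u < 0)
    (htan : ∀ u ∈ Ioo (0:ℝ) 1, ∀ v ∈ Icc (0:ℝ) 1, h u + h' u * (v - u) ≤ h v)
    (hbot : Tendsto h' (𝓝[>] 0) atBot) :
    ∃ ψ κ : ℝ → ℝ, Continuous ψ ∧ Continuous κ ∧ (∀ x, ψ x ∈ Ico (0:ℝ) 1) ∧
      (∀ x, x ≤ 1 / ℓ → ψ x = 0 ∧ κ x = 0) ∧ (∀ x, 1 / ℓ ≤ x → h (ψ x) = 1 / x) ∧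
      (∀ x, 1 / ℓ < x → ψ x ∈ Ioo (0:ℝ) 1 ∧ κ x = -1 / h' (ψ x) ∧ 0 < κ x ∧
        HasDerivAt ψ (κ x / x ^ 2) x) ∧ Monotone κ ∧ (∀ x, 0 ≤ κ x) ∧
      (∀ u ∈ Ioo (0:ℝ) 1, 1 / ℓ < 1 / h u ∧ ψ (1 / h u) = u) ∧ Monotone ψ := by
  have hlinv : 0 < 1 / ℓ := by positivity
  obtain ⟨g, hgc, hgm, hg1, hg2⟩ := inv_lemma (f := fun u => - h u) zero_le_one hcont.neg hanti.neg
  simp only [h0, h1, neg_zero] at hgc hgm hg1 hg2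
  have hg10 : g (-ℓ) = 0 := by have := hg2 0 (by simp); rwa [h0] at this
  have hg11 : g 0 = 1 := by have := hg2 1 (by simp); rwa [h1, neg_zero] at this
  set y : ℝ → ℝ := fun x => -(1 / max x (1 / ℓ)) with hy
  have hmaxpos : ∀ x, 0 < max x (1 / ℓ) := fun x => lt_of_lt_of_le hlinv (le_max_right _ _)
  have hyc : Continuous y := by
    apply Continuous.neg
    apply Continuous.div continuous_const (by fun_prop)
    intro x; exact (hmaxpos x).ne'
  have hymem : ∀ x, y x ∈ Ico (-ℓ) 0 := by
    intro x
    have := hmaxpos x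
    constructor
    · simp only [hy, neg_le_neg_iff]
      rw [div_le_iff₀ this]
      calc (1:ℝ) = ℓ * (1 / ℓ) := by field_simp
        _ ≤ _ := mul_le_mul_of_nonneg_left (le_max_right _ _) hl.le
    · simp only [hy]; rw [neg_lt_zero]; positivity
  have hymono : Monotone y := by
    intro a b hab
    simp only [hy, neg_le_neg_iff]
    exact one_div_le_one_div_of_le (hmaxpos a) (max_le_max hab le_rfl)
  have hyle : ∀ x, x ≤ 1 / ℓ → y x = -ℓ := by
    intro x hx; simp only [hy, max_eq_right hx]; simp
  have hyge : ∀ x, 1 / ℓ ≤ x → y x = -(1 / x) := by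
    intro x hx; simp only [hy, max_eq_left hx]
  set ψ : ℝ → ℝ := fun x => g (y x) with hψ
  have hψc : Continuous ψ := hgc.comp_continuous hyc (fun x => Ico_subset_Icc_self (hymem x))
  have hψmem : ∀ x, ψ x ∈ Ico (0:ℝ) 1 := by
    intro x
    refine ⟨(hg1 _ (Ico_subset_Icc_self (hymem x))).1.1, ?_⟩
    rw [← hg11]
    exact hgm (Ico_subset_Icc_self (hymem x)) ⟨by linarith, le_rfl⟩ (hymem x).2
  have hψmono : Monotone ψ := fun a b hab =>
    hgm.monotoneOn (Ico_subset_Icc_self (hymem a)) (Ico_subset_Icc_self (hymem b)) (hymono hab)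
  have hψle : ∀ x, x ≤ 1 / ℓ → ψ x = 0 := by
    intro x hx; simp only [hψ, hyle x hx, hg10]
  have hhψ : ∀ x, 1 / ℓ ≤ x → h (ψ x) = 1 / x := by
    intro x hx
    have := (hg1 _ (Ico_subset_Icc_self (hymem x))).2
    rw [hyge x hx] at this
    simp only [hψ, hyge x hx]
    linarith
  have hψpos : ∀ x, 1 / ℓ < x → ψ x ∈ Ioo (0:ℝ) 1 := by
    intro x hx
    refine ⟨?_, (hψmem x).2⟩
    rcases (hψmem x).1.lt_or_eq with h | h
    · exact h
    · exfalso
      have e := hhψ x hx.le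
      rw [← h, h0] at e
      rw [e] at hx
      simp at hx
  set q : ℝ → ℝ := fun u => if u ≤ 0 then 0 else -1 / h' u with hq
  have hqpos : ∀ u, 0 < u → q u = -1 / h' u := by
    intro u hu; simp only [hq, if_neg (not_le.mpr hu)]
  have hqc : ContinuousOn q (Ico 0 1) := by
    intro u hu
    rcases hu.1.lt_or_eq with h | h
    · have hu' : u ∈ Ioo (0:ℝ) 1 := ⟨h, hu.2⟩
      have : ContinuousAt (fun u => -1 / h' u) u :=
        ContinuousAt.div continuousAt_const (hcont'.continuousAt (Ioo_mem_nhds h hu.2)) (hneg u hu').ne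
      refine ContinuousAt.continuousWithinAt (this.congr ?_)
      filter_upwards [lt_mem_nhds h] with v hv
      rw [hqpos v hv]
    · subst h
      have hq0 : q 0 = 0 := by simp [hq]
      rw [← Ioo_insert_left zero_lt_one, continuousWithinAt_insert_self]
      have : Tendsto (fun u => -1 / h' u) (𝓝[>] 0) (𝓝 0) := by
        have := (tendsto_inv_atBot_zero.comp hbot).neg
        rw [neg_zero] at this
        refine this.congr (fun u => ?_)
        simp [neg_div]
      show Tendsto q _ _
      rw [hq0]
      have t2 := this.mono_left (nhdsWithin_mono 0 (Ioo_subset_Ioi_self : Ioo (0:ℝ) 1 ⊆ _))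
      refine t2.congr' ?_
      filter_upwards [self_mem_nhdsWithin] with v hv
      rw [hqpos v hv.1]
  have hqnn : ∀ u ∈ Ico (0:ℝ) 1, 0 ≤ q u := by
    intro u hu
    rcases hu.1.lt_or_eq with h | h
    · rw [hqpos u h]; exact div_nonneg_of_nonpos (by norm_num) (hneg u ⟨h, hu.2⟩).le
    · simp [hq, ← h]
  have hqmono : MonotoneOn q (Ico 0 1) := by
    intro u hu v hv huv
    rcases hu.1.lt_or_eq with h | h
    · have hv0 : 0 < v := lt_of_lt_of_le h huv
      rcases huv.lt_or_eq with huv | huv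
      swap
      · rw [huv]
      rw [hqpos u h, hqpos v hv0]
      have a := htan u ⟨h, hu.2⟩ v ⟨hv.1, hv.2.le⟩
      have b := htan v ⟨hv0, hv.2⟩ u ⟨hu.1, hu.2.le⟩
      have hle : h' u ≤ h' v := by
        by_contra hc
        push Not at hc
        nlinarith [mul_pos (sub_pos.mpr hc) (sub_pos.mpr huv)]
      have n1 := hneg u ⟨h, hu.2⟩
      have n2 := hneg v ⟨hv0, hv.2⟩
      rw [neg_div, neg_div, neg_le_neg_iff]
      exact one_div_le_one_div_of_neg_of_le n2 hle
    · have : q u = 0 := by simp [hq, ← h]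
      rw [this]; exact hqnn v hv
  refine ⟨ψ, fun x => q (ψ x), hψc, hqc.comp_continuous hψc hψmem, hψmem, ?_, hhψ, ?_, ?_, ?_, ?_, hψmono⟩
  · intro x hx
    refine ⟨hψle x hx, ?_⟩
    simp only [hψle x hx]; simp [hq]
  · intro x hx
    have hp := hψpos x hx
    have hk : q (ψ x) = -1 / h' (ψ x) := hqpos _ hp.1
    have hx0 : 0 < x := lt_trans hlinv hx
    refine ⟨hp, hk, ?_, ?_⟩
    · simp only [hk]; exact div_pos_of_neg_of_neg (by norm_num) (hneg _ hp)
    · -- inverse function of 1/h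
      have hd : HasDerivAt (fun u => 1 / h u) (x ^ 2 / q (ψ x)) (ψ x) := by
        have hne : h (ψ x) ≠ 0 := by rw [hhψ x hx.le]; positivity
        have := (hder _ hp).inv hne
        have h3 := (hneg _ hp).ne
        simp only [one_div]
        refine HasDerivAt.congr_deriv (f := fun u => (h u)⁻¹) this ?_
        rw [hk, hhψ x hx.le]
        field_simp
      have hkpos : 0 < q (ψ x) := by
        rw [hk]; exact div_pos_of_neg_of_neg (by norm_num) (hneg _ hp)
      have hh := HasDerivAt.of_local_left_inverse (f := fun u => 1 / h u) (g := ψ) (a := x)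
        hψc.continuousAt hd (by positivity) (by
          filter_upwards [lt_mem_nhds hx] with z hz
          rw [hhψ z hz.le]; simp)
      exact hh.congr_deriv (by rw [inv_div])
  · intro a b hab
    exact hqmono (hψmem a) (hψmem b) (hψmono hab)
  · intro x; exact hqnn _ (hψmem x)
  · intro u hu
    have a1 : h u < ℓ := by rw [← h0]; exact hanti (by simp) (Ioo_subset_Icc_self hu) hu.1
    have a2 : 0 < h u := by rw [← h1]; exact hanti (Ioo_subset_Icc_self hu) (by simp) hu.2
    have a3 : 1 / ℓ < 1 / h u := one_div_lt_one_div_of_lt a2 a1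
    refine ⟨a3, ?_⟩
    simp only [hψ]
    rw [hyge _ a3.le, one_div_one_div]
    exact hg2 u (Ioo_subset_Icc_self hu)

theorem theta_facts {ℓ s b : ℝ} (hl : 0 < ℓ) (hs : 0 < s) (hb : 1 / ℓ < b) {κ : ℝ → ℝ}
    (hκ : Continuous κ) (hk0 : ∀ x, x ≤ 1 / ℓ → κ x = 0) (hkpos : ∀ x, 1 / ℓ < x → 0 < κ x)
    (hG : ∫ θ in (0:ℝ)..(Real.pi / 2), κ (b * Real.cos θ) = s) :
    ∃ Θ : ℝ → ℝ, ContinuousOn Θ (Icc 0 1) ∧ Θ (1 / 2) = 0 ∧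
      (∀ t ∈ Icc (0:ℝ) 1, Θ t ∈ Ioo (-(Real.pi / 2)) (Real.pi / 2) ∧ 1 / ℓ ≤ b * Real.cos (Θ t)) ∧
      StrictMonoOn Θ (Icc 0 1) ∧ b * Real.cos (Θ 0) = 1 / ℓ ∧ b * Real.cos (Θ 1) = 1 / ℓ ∧
      (∀ t ∈ Ioo (0:ℝ) 1, 1 / ℓ < b * Real.cos (Θ t) ∧
        HasDerivAt Θ (2 * s / κ (b * Real.cos (Θ t))) t) := by
  have hlinv : 0 < 1 / ℓ := by positivity
  have hb0 : 0 < b := hlinv.trans hb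
  set m := Real.arccos (1 / ℓ / b) with hm
  have hr0 : 0 < 1 / ℓ / b := by positivity
  have hr1 : 1 / ℓ / b < 1 := by rw [div_lt_one hb0]; exact hb
  have hcosm : Real.cos m = 1 / ℓ / b := Real.cos_arccos (by linarith) hr1.le
  have hbm : b * Real.cos m = 1 / ℓ := by rw [hcosm]; field_simp
  have hm0 : 0 < m := Real.arccos_pos.mpr hr1
  have hm1 : m < Real.pi / 2 := Real.arccos_lt_pi_div_two.mpr hr0
  have hpi := Real.pi_pos
  have hcos_in : ∀ θ ∈ Ioo (-m) m, 1 / ℓ < b * Real.cos θ := by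
    intro θ hθ
    rw [← hbm]
    apply mul_lt_mul_of_pos_left _ hb0
    rw [← Real.cos_abs θ]
    exact Real.cos_lt_cos_of_nonneg_of_le_pi (abs_nonneg θ) (by linarith) (abs_lt.mpr hθ)
  have hcos_in' : ∀ θ ∈ Icc (-m) m, 1 / ℓ ≤ b * Real.cos θ := by
    intro θ hθ
    rw [← hbm]
    apply mul_le_mul_of_nonneg_left _ hb0.le
    rw [← Real.cos_abs θ]
    exact Real.cos_le_cos_of_nonneg_of_le_pi (abs_nonneg θ) (by linarith) (abs_le.mpr hθ)
  have hkc : Continuous (fun θ => κ (b * Real.cos θ)) := by fun_prop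
  set A : ℝ → ℝ := fun x => ∫ θ in (0:ℝ)..x, κ (b * Real.cos θ) with hA
  have hAder : ∀ x, HasDerivAt A (κ (b * Real.cos x)) x := fun x =>
    (hkc.integral_hasStrictDerivAt 0 x).hasDerivAt
  have hAm : A m = s := by
    rw [← hG, hA]
    have := intervalIntegral.integral_add_adjacent_intervals
      (hkc.intervalIntegrable 0 m (μ := volume)) (hkc.intervalIntegrable m (Real.pi / 2) (μ := volume))
    have z : ∫ θ in m..(Real.pi / 2), κ (b * Real.cos θ) = 0 := by
      rw [intervalIntegral.integral_congr (g := fun _ => (0:ℝ))]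
      · simp
      · intro θ hθ
        rw [uIcc_of_le hm1.le] at hθ
        apply hk0
        rw [← hbm]
        apply mul_le_mul_of_nonneg_left _ hb0.le
        exact Real.cos_le_cos_of_nonneg_of_le_pi hm0.le (by linarith [hθ.2]) hθ.1
    rw [z, add_zero] at this
    exact this
  have hAm' : A (-m) = -s := by
    rw [← hAm, hA]
    have := intervalIntegral.integral_comp_neg (a := 0) (b := m) (fun θ => κ (b * Real.cos θ))
    simp only [Real.cos_neg, neg_zero] at this
    simp only
    rw [intervalIntegral.integral_symm, ← this]
  set τ : ℝ → ℝ := fun x => 1 / 2 + 1 / (2 * s) * A x with hτ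
  have hτder : ∀ x, HasDerivAt τ (1 / (2 * s) * κ (b * Real.cos x)) x := fun x =>
    ((hAder x).const_mul _).const_add _
  have hτc : Continuous τ := continuous_iff_continuousAt.mpr fun x => (hτder x).continuousAt
  have hτm : StrictMonoOn τ (Icc (-m) m) := by
    apply strictMonoOn_of_deriv_pos (convex_Icc _ _) hτc.continuousOn
    intro x hx
    rw [interior_Icc] at hx
    rw [(hτder x).deriv]
    have := hkpos _ (hcos_in x hx)
    positivity
  have t1 : τ m = 1 := by simp only [hτ, hAm]; field_simp; norm_num
  have t0 : τ (-m) = 0 := by simp only [hτ, hAm']; field_simp; norm_num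
  have th : τ 0 = 1 / 2 := by simp [hτ, hA]
  obtain ⟨Θ, hc, hmo, hg1, hg2⟩ := inv_lemma (by linarith : -m ≤ m) hτc.continuousOn hτm
  rw [t1, t0] at hc hmo hg1
  have m1 : m ∈ Icc (-m) m := ⟨by linarith, le_rfl⟩
  have m0 : -m ∈ Icc (-m) m := ⟨le_rfl, by linarith⟩
  have mh : (0:ℝ) ∈ Icc (-m) m := ⟨by linarith, by linarith⟩
  have T1 : Θ 1 = m := by have := hg2 m m1; rwa [t1] at this
  have T0 : Θ 0 = -m := by have := hg2 (-m) m0; rwa [t0] at this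
  have Th : Θ (1 / 2) = 0 := by have := hg2 0 mh; rwa [th] at this
  refine ⟨Θ, hc, Th, ?_, hmo, ?_, ?_, ?_⟩
  · intro t ht
    have := (hg1 t ht).1
    exact ⟨⟨by linarith [this.1], by linarith [this.2]⟩, hcos_in' _ this⟩
  · rw [T0, Real.cos_neg, hbm]
  · rw [T1, hbm]
  · intro t ht
    have hin : Θ t ∈ Ioo (-m) m := by
      constructor
      · rw [← T0]; exact hmo (by simp) (Ioo_subset_Icc_self ht) ht.1
      · rw [← T1]; exact hmo (Ioo_subset_Icc_self ht) (by simp) ht.2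
    have hlt := hcos_in _ hin
    have hkp := hkpos _ hlt
    refine ⟨hlt, ?_⟩
    have := HasDerivAt.of_local_left_inverse (f := τ) (g := Θ) (a := t)
      (hc.continuousAt (Icc_mem_nhds ht.1 ht.2)) (hτder (Θ t)) (by positivity) (by
        filter_upwards [Icc_mem_nhds ht.1 ht.2] with z hz
        exact (hg1 z hz).2)
    exact this.congr_deriv (by field_simp)

theorem cs_le {A B C S : ℝ} (h : C ^ 2 + S ^ 2 = 1) : A * C + B * S ≤ Real.sqrt (A ^ 2 + B ^ 2) := by
  apply Real.le_sqrt_of_sq_le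
  have : (A * C + B * S) ^ 2 + (A * S - B * C) ^ 2 = (A ^ 2 + B ^ 2) * (C ^ 2 + S ^ 2) := by ring
  rw [h, mul_one] at this
  nlinarith [sq_nonneg (A * S - B * C)]

theorem cs_eq {A B C S : ℝ} (h : C ^ 2 + S ^ 2 = 1)
    (he : A * C + B * S = Real.sqrt (A ^ 2 + B ^ 2)) : A * S = B * C := by
  have : (A * C + B * S) ^ 2 + (A * S - B * C) ^ 2 = (A ^ 2 + B ^ 2) * (C ^ 2 + S ^ 2) := by ring
  rw [h, mul_one, he, Real.sq_sqrt (by positivity)] at this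
  have h2 : (A * S - B * C) ^ 2 = 0 := by linarith
  have := pow_eq_zero_iff (two_ne_zero) |>.mp h2
  linarith

theorem adm_ii {δ δ' : ℝ → ℝ} (hδ : Admissible δ δ') : IntervalIntegrable δ' volume 0 1 := by
  rw [intervalIntegrable_iff_integrableOn_Icc_of_le zero_le_one]
  exact hδ.1

theorem adm_cont {δ δ' : ℝ → ℝ} (hδ : Admissible δ δ') : ContinuousOn δ (Icc 0 1) := by
  have := intervalIntegral.continuousOn_primitive_interval (μ := volume) (f := δ') (a := 0) (b := 1)
    (by rw [uIcc_of_le zero_le_one]; exact hδ.1)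
  rw [uIcc_of_le zero_le_one] at this
  exact this.congr hδ.2.1

theorem lag_int {f₁ h : ℝ → ℝ} {s : ℝ} {δ δ' : ℝ → ℝ} (hδ : Admissible δ δ')
    (hh : ∀ u, h u = f₁ (Real.sqrt u)) (hc : ContinuousOn h (Icc 0 1)) :
    IntervalIntegrable
      (fun t => Real.sqrt (s ^ 2 * (f₁ (Real.sqrt (δ t))) ^ 2 + (δ' t) ^ 2 / 4)) volume 0 1 := by
  rw [intervalIntegrable_iff_integrableOn_Icc_of_le zero_le_one]
  have hcomp : ContinuousOn (fun t => h (δ t)) (Icc 0 1) := hc.comp (adm_cont hδ) hδ.2.2.1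
  have hi : IntegrableOn (fun t => |s| * |h (δ t)| + |δ' t| / 2) (Icc 0 1) := by
    apply Integrable.add
    · exact (continuousOn_const.mul hcomp.abs).integrableOn_compact isCompact_Icc
    · exact hδ.1.abs.div_const 2
  refine Integrable.mono' hi ?_ ?_
  · apply Real.continuous_sqrt.comp_aestronglyMeasurable
    have m1 : AEStronglyMeasurable (fun t => h (δ t)) (volume.restrict (Icc 0 1)) :=
      hcomp.aestronglyMeasurable measurableSet_Icc
    have m2 : AEStronglyMeasurable δ' (volume.restrict (Icc 0 1)) := hδ.1.aestronglyMeasurable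
    simp only [← hh]
    have : Continuous (fun p : ℝ × ℝ => s ^ 2 * p.1 ^ 2 + p.2 ^ 2 / 4) := by fun_prop
    exact this.comp_aestronglyMeasurable (m1.prodMk m2)
  · refine Eventually.of_forall (fun t => ?_)
    rw [Real.norm_eq_abs, abs_of_nonneg (Real.sqrt_nonneg _), ← hh]
    apply Real.sqrt_le_iff.mpr
    refine ⟨by positivity, ?_⟩
    have e1 := sq_abs s
    have e2 := sq_abs (h (δ t))
    have e3 := sq_abs (δ' t)
    rw [← e1, ← e2, ← e3]
    have : 0 ≤ |s| * |h (δ t)| * |δ' t| := by positivity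
    nlinarith

theorem bad_case {f₁ h : ℝ → ℝ} {s : ℝ} {δ δ' : ℝ → ℝ} (hδ : Admissible δ δ')
    (hh : ∀ u, h u = f₁ (Real.sqrt u)) (hc : ContinuousOn h (Icc 0 1))
    (hlow : ∀ v ∈ Icc (0:ℝ) 1, Real.pi / 2 * (1 - v) ≤ s * h v) :
    1 ≤ energy f₁ s δ δ' := by
  have hii := adm_ii hδ
  have key := ibp (f := fun t => 1 - δ t) (f' := fun t => - δ' t)
    (g := fun t => Real.cos (Real.pi * t)) (g' := fun t => -Real.pi * Real.sin (Real.pi * t))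
    hii.neg (Continuous.intervalIntegrable (by fun_prop) _ _)
    (by
      intro t ht
      simp only [intervalIntegral.integral_neg, hδ.2.2.2.1]
      rw [hδ.2.1 t ht]; ring)
    (by
      intro t ht
      have : ∀ x ∈ uIcc 0 t, HasDerivAt (fun t => Real.cos (Real.pi * t))
          (-Real.pi * Real.sin (Real.pi * x)) x := by
        intro x _
        have := (Real.hasDerivAt_cos (Real.pi * x)).comp x ((hasDerivAt_id x).const_mul Real.pi)
        refine HasDerivAt.congr_deriv this (by simp; ring)
      rw [intervalIntegral.integral_eq_sub_of_hasDerivAt this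
        (Continuous.intervalIntegrable (by fun_prop) _ _)]
      ring)
  simp only [hδ.2.2.2.1, hδ.2.2.2.2, mul_one, mul_zero, Real.cos_pi, Real.cos_zero, sub_zero] at key
  have hle : ∫ t in (0:ℝ)..1, (-1 / 2) * (-δ' t * Real.cos (Real.pi * t) +
      (1 - δ t) * (-Real.pi * Real.sin (Real.pi * t))) ≤ energy f₁ s δ δ' := by
    unfold energy
    apply intervalIntegral.integral_mono_on zero_le_one
    · apply IntervalIntegrable.const_mul
      apply IntervalIntegrable.add
      · exact hii.neg.mul_continuousOn (by fun_prop)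
      · apply ContinuousOn.intervalIntegrable
        rw [uIcc_of_le zero_le_one]
        have := adm_cont hδ
        fun_prop
    · exact lag_int hδ hh hc
    · intro t ht
      rw [← hh]
      have e : s ^ 2 * h (δ t) ^ 2 + δ' t ^ 2 / 4 = (s * h (δ t)) ^ 2 + (δ' t / 2) ^ 2 := by ring
      rw [e]
      refine le_trans ?_ (cs_le (Real.sin_sq_add_cos_sq (Real.pi * t)))
      have h1 := hlow (δ t) (hδ.2.2.1 t ht)
      have h2 : 0 ≤ Real.sin (Real.pi * t) := Real.sin_nonneg_of_nonneg_of_le_pi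
        (mul_nonneg Real.pi_pos.le ht.1) (by nlinarith [Real.pi_pos, ht.2])
      nlinarith [mul_le_mul_of_nonneg_right h1 h2]
  rw [intervalIntegral.integral_const_mul, key] at hle
  linarith

theorem exists_b {ℓ s : ℝ} (hl : 0 < ℓ) (hs : 0 < s) {h h' ψ κ : ℝ → ℝ}
    (h1 : h 1 = 0) (hanti : StrictAntiOn h (Icc 0 1))
    (hneg : ∀ u ∈ Ioo (0:ℝ) 1, h' u < 0)
    (htan : ∀ u ∈ Ioo (0:ℝ) 1, ∀ v ∈ Icc (0:ℝ) 1, h u + h' u * (v - u) ≤ h v)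
    (hκ : Continuous κ) (hk0 : ∀ x, x ≤ 1 / ℓ → κ x = 0)
    (hk1 : ∀ x, 1 / ℓ < x → κ x = -1 / h' (ψ x))
    (hmono : Monotone κ) (hnn : ∀ x, 0 ≤ κ x)
    (hψ : ∀ u ∈ Ioo (0:ℝ) 1, 1 / ℓ < 1 / h u ∧ ψ (1 / h u) = u) :
    (∃ b, 1 / ℓ < b ∧ ∫ θ in (0:ℝ)..(Real.pi / 2), κ (b * Real.cos θ) = s) ∨
    ∀ v ∈ Icc (0:ℝ) 1, Real.pi / 2 * (1 - v) ≤ s * h v := by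
  have hpi := Real.pi_pos
  have hlinv : 0 < 1 / ℓ := by positivity
  set G : ℝ → ℝ := fun b => ∫ θ in (0:ℝ)..(Real.pi / 2), κ (b * Real.cos θ) with hG
  have hGc : Continuous G := by
    apply intervalIntegral.continuous_parametric_intervalIntegral_of_continuous'
    fun_prop
  have hG0 : G (1 / ℓ) = 0 := by
    simp only [hG]
    rw [intervalIntegral.integral_congr (g := fun _ => (0:ℝ))]
    · simp
    · intro θ _
      apply hk0
      nlinarith [Real.cos_le_one θ]
  by_cases hex : ∃ b, 1 / ℓ < b ∧ s ≤ G b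
  · left
    obtain ⟨b, hb1, hb2⟩ := hex
    obtain ⟨c, hc1, hc2⟩ := intermediate_value_Icc hb1.le hGc.continuousOn
      (show s ∈ Icc (G (1 / ℓ)) (G b) from ⟨by rw [hG0]; exact hs.le, hb2⟩)
    refine ⟨c, lt_of_le_of_ne hc1.1 ?_, hc2⟩
    rintro rfl
    rw [hG0] at hc2
    linarith
  · right
    push Not at hex
    have hkb : ∀ u ∈ Ioo (0:ℝ) 1, Real.pi / 2 ≤ s * (- h' u) := by
      intro u hu
      obtain ⟨a1, a2⟩ := hψ u hu
      set x := 1 / h u with hx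
      have a3 := hk1 x a1
      rw [a2] at a3
      have hn := hneg u hu
      have kpos : 0 < κ x := by rw [a3]; exact div_pos_of_neg_of_neg (by norm_num) hn
      have hx0 : 0 < x := hlinv.trans a1
      have main : Real.pi / 2 * κ x ≤ s := by
        by_contra hcon
        push Not at hcon
        set β := s / κ x with hβ
        have hβ0 : 0 < β := by positivity
        have hβ1 : β < Real.pi / 2 := by rw [hβ, div_lt_iff₀ kpos]; exact hcon
        have hcβ : 0 < Real.cos β := Real.cos_pos_of_mem_Ioo ⟨by linarith, hβ1⟩
        set b := x / Real.cos β with hb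
        have hbx : x ≤ b := by
          rw [hb, le_div_iff₀ hcβ]; nlinarith [Real.cos_le_one β]
        have hb0 : 0 < b := lt_of_lt_of_le hx0 hbx
        have hlt := hex b (lt_of_lt_of_le a1 hbx)
        have hkc : Continuous (fun θ => κ (b * Real.cos θ)) := by fun_prop
        have hsum := intervalIntegral.integral_add_adjacent_intervals
          (hkc.intervalIntegrable 0 β (μ := volume)) (hkc.intervalIntegrable β (Real.pi / 2) (μ := volume))
        have p1 : 0 ≤ ∫ θ in β..(Real.pi / 2), κ (b * Real.cos θ) :=
          intervalIntegral.integral_nonneg hβ1.le (fun θ _ => hnn _)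
        have p2 : ∫ θ in (0:ℝ)..β, κ x ≤ ∫ θ in (0:ℝ)..β, κ (b * Real.cos θ) := by
          apply intervalIntegral.integral_mono_on hβ0.le (by simp) (hkc.intervalIntegrable _ _)
          intro θ hθ
          apply hmono
          have : Real.cos β ≤ Real.cos θ :=
            Real.cos_le_cos_of_nonneg_of_le_pi hθ.1 (by linarith) hθ.2
          calc x = b * Real.cos β := by rw [hb]; field_simp
            _ ≤ _ := mul_le_mul_of_nonneg_left this hb0.le
        rw [intervalIntegral.integral_const, smul_eq_mul, sub_zero] at p2
        have : β * κ x = s := by rw [hβ]; field_simp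
        have hGb : G b = ∫ θ in (0:ℝ)..(Real.pi / 2), κ (b * Real.cos θ) := rfl
        linarith
      rw [a3, neg_div, mul_neg, ← neg_mul, ← div_eq_mul_one_div, div_le_iff_of_neg hn] at main
      linarith
    intro v hv
    by_contra hcon
    push Not at hcon
    have hv1 : v < 1 := by
      rcases hv.2.lt_or_eq with h | h
      · exact h
      · exfalso; rw [h, h1] at hcon; simp at hcon
    have hvpos : 0 < h v := by rw [← h1]; exact hanti hv (by simp) hv1
    obtain ⟨w, hw1, hw2⟩ : ∃ w, v + s * h v / (Real.pi / 2) < w ∧ w < 1 := by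
      apply exists_between
      have : s * h v / (Real.pi / 2) < 1 - v := by rw [div_lt_iff₀ (by positivity)]; linarith
      linarith
    have hp : 0 < s * h v / (Real.pi / 2) := by positivity
    have hw0 : v < w := by linarith
    have hwm : w ∈ Ioo (0:ℝ) 1 := ⟨by linarith [hv.1], hw2⟩
    have t := htan w hwm v hv
    have k := hkb w hwm
    have hwpos : 0 < h w := by rw [← h1]; exact hanti (Ioo_subset_Icc_self hwm) (by simp) hw2
    have e : s * h v / (Real.pi / 2) < w - v := by linarith
    rw [div_lt_iff₀ (by positivity)] at e
    have t2 := mul_le_mul_of_nonneg_left t hs.le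
    have k2 := mul_le_mul_of_nonneg_right k (sub_pos.mpr hw0).le
    nlinarith [mul_pos hs hwpos]

theorem uniq_aux {h w γ δ : ℝ → ℝ} (hanti : StrictAntiOn h (Icc 0 1))
    (hγc : ContinuousOn γ (Icc 0 1)) (hδc : ContinuousOn δ (Icc 0 1))
    (hγm : ∀ t ∈ Icc (0:ℝ) 1, γ t ∈ Icc (0:ℝ) 1) (hδm : ∀ t ∈ Icc (0:ℝ) 1, δ t ∈ Icc (0:ℝ) 1)
    (hγd : ∀ t ∈ Ioo (0:ℝ) 1, HasDerivAt γ (-(w t * h (γ t))) t)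
    (hδd : ∀ t ∈ Ioo (0:ℝ) 1, HasDerivAt δ (-(w t * h (δ t))) t)
    (hw1 : ∀ t ∈ Icc (0:ℝ) (1 / 2), w t ≤ 0) (hw2 : ∀ t ∈ Icc (1 / 2 : ℝ) 1, 0 ≤ w t)
    (e0 : δ 0 = γ 0) (e1 : δ 1 = γ 1) : ∀ t ∈ Icc (0:ℝ) 1, δ t = γ t := by
  set E : ℝ → ℝ := fun t => (δ t - γ t) ^ 2 with hE
  have hEc : ContinuousOn E (Icc 0 1) := (hδc.sub hγc).pow 2
  have hEd : ∀ t ∈ Ioo (0:ℝ) 1,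
      HasDerivAt E (-2 * w t * ((δ t - γ t) * (h (δ t) - h (γ t)))) t := by
    intro t ht
    have := ((hδd t ht).sub (hγd t ht)).pow 2
    exact HasDerivAt.congr_deriv (f := E) this (by
      simp only [Nat.cast_ofNat, Nat.add_one_sub_one, pow_one, Pi.sub_apply]; ring)
  have hprod : ∀ t ∈ Icc (0:ℝ) 1, (δ t - γ t) * (h (δ t) - h (γ t)) ≤ 0 := by
    intro t ht
    rcases le_total (δ t) (γ t) with hle | hle
    · have := hanti.antitoneOn (hδm t ht) (hγm t ht) hle
      exact mul_nonpos_of_nonpos_of_nonneg (by linarith) (by linarith)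
    · have := hanti.antitoneOn (hγm t ht) (hδm t ht) hle
      exact mul_nonpos_of_nonneg_of_nonpos (by linarith) (by linarith)
  have E0 : E 0 = 0 := by simp [hE, e0]
  have E1 : E 1 = 0 := by simp [hE, e1]
  have hle : ∀ t ∈ Icc (0:ℝ) 1, E t ≤ 0 := by
    intro t ht
    rcases le_total t (1 / 2) with hth | hth
    · have hanti' : AntitoneOn E (Icc 0 (1 / 2)) := by
        apply antitoneOn_of_deriv_nonpos (convex_Icc _ _)
          (hEc.mono (Icc_subset_Icc le_rfl (by norm_num)))
        · intro x hx
          rw [interior_Icc] at hx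
          exact (hEd x ⟨hx.1, by linarith [hx.2]⟩).differentiableAt.differentiableWithinAt
        · intro x hx
          rw [interior_Icc] at hx
          have hx' : x ∈ Ioo (0:ℝ) 1 := ⟨hx.1, by linarith [hx.2]⟩
          rw [(hEd x hx').deriv]
          have a := hprod x (Ioo_subset_Icc_self hx')
          have b := hw1 x (Ioo_subset_Icc_self hx)
          nlinarith [mul_nonneg_of_nonpos_of_nonpos b a]
      rw [← E0]
      exact hanti' ⟨le_rfl, by norm_num⟩ ⟨ht.1, hth⟩ ht.1
    · have hmono' : MonotoneOn E (Icc (1 / 2) 1) := by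
        apply monotoneOn_of_deriv_nonneg (convex_Icc _ _)
          (hEc.mono (Icc_subset_Icc (by norm_num) le_rfl))
        · intro x hx
          rw [interior_Icc] at hx
          exact (hEd x ⟨by linarith [hx.1], hx.2⟩).differentiableAt.differentiableWithinAt
        · intro x hx
          rw [interior_Icc] at hx
          have hx' : x ∈ Ioo (0:ℝ) 1 := ⟨by linarith [hx.1], hx.2⟩
          rw [(hEd x hx').deriv]
          have a := hprod x (Ioo_subset_Icc_self hx')
          have b := hw2 x (Ioo_subset_Icc_self hx)
          nlinarith [mul_nonpos_of_nonneg_of_nonpos b a]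
      rw [← E1]
      exact hmono' ⟨hth, ht.2⟩ ⟨by norm_num, le_rfl⟩ ht.2
  intro t ht
  have h1 : E t = 0 := le_antisymm (hle t ht) (sq_nonneg _)
  have := pow_eq_zero_iff (two_ne_zero) |>.mp h1
  linarith

/-- for `s > 0` with `g₀(s) < 1`, the infimum defining `g₀(s)` is attained by
exactly one admissible `γ_s`, which moreover is `C¹` on `(0,1)` and attains its maximum over
`[0,1]` at `t = 1/2`. -/
theorem stmt_8 (ℓ ℓ₁ : ℝ) (f₁ : ℝ → ℝ) (hf : F1Hyp ℓ ℓ₁ f₁)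
    (s : ℝ) (hs : 0 < s) (hlt : g0 f₁ s < 1) :
    ∃ γ γ' : ℝ → ℝ, Admissible γ γ' ∧ energy f₁ s γ γ' = g0 f₁ s ∧
      (∃ d : ℝ → ℝ, ContinuousOn d (Ioo 0 1) ∧
        ∀ t ∈ Ioo (0:ℝ) 1, HasDerivAt γ (d t) t) ∧
      (∀ t ∈ Icc (0:ℝ) 1, γ t ≤ γ (1/2)) ∧
      (∀ δ δ' : ℝ → ℝ, Admissible δ δ' → energy f₁ s δ δ' = g0 f₁ s →
        ∀ t ∈ Icc (0:ℝ) 1, δ t = γ t) := by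
  have hl := hf.hl
  have hlinv : 0 < 1 / ℓ := by positivity
  obtain ⟨h, h', hh, hcont, h0, h1, hanti, hder, hcont', hneg, htan, hbot⟩ := h_facts hf
  obtain ⟨ψ, κ, hψc, hκc, hψmem, hle, hge, hgt, hκm, hκnn, hψinv, hψmono⟩ :=
    kappa_facts hl hcont h0 h1 hanti hder hcont' hneg htan hbot
  rcases exists_b hl hs h1 hanti hneg htan hκc (fun x hx => (hle x hx).2)
    (fun x hx => (hgt x hx).2.1) hκm hκnn hψinv with ⟨b, hb, hG⟩ | hlow
  swap
  · exfalso
    have : 1 ≤ g0 f₁ s := by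
      apply le_csInf
      · exact ⟨_, fun _ => 0, fun _ => 0, ⟨by simp, by simp, by simp, rfl, rfl⟩, rfl⟩
      · rintro x ⟨δ, δ', hδ, rfl⟩
        exact bad_case hδ hh hcont hlow
    linarith
  have hb0 : 0 < b := hlinv.trans hb
  obtain ⟨Θ, hΘc, hΘh, hΘm, hΘmono, hΘ0, hΘ1, hΘd⟩ :=
    theta_facts hl hs hb hκc (fun x hx => (hle x hx).2) (fun x hx => (hgt x hx).2.2.1) hG
  have hcos : ∀ t ∈ Icc (0:ℝ) 1, 0 < Real.cos (Θ t) := fun t ht =>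
    Real.cos_pos_of_mem_Ioo (hΘm t ht).1
  have hcosc : ContinuousOn (fun t => Real.cos (Θ t)) (Icc 0 1) :=
    Real.continuous_cos.comp_continuousOn hΘc
  have hsinc : ContinuousOn (fun t => Real.sin (Θ t)) (Icc 0 1) :=
    Real.continuous_sin.comp_continuousOn hΘc
  set γ : ℝ → ℝ := fun t => ψ (b * Real.cos (Θ t)) with hγ
  have hγc : ContinuousOn γ (Icc 0 1) :=
    hψc.comp_continuousOn (continuousOn_const.mul hcosc)
  have hγm : ∀ t ∈ Icc (0:ℝ) 1, γ t ∈ Icc (0:ℝ) 1 := fun t _ => Ico_subset_Icc_self (hψmem _)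
  have hhγ : ∀ t ∈ Icc (0:ℝ) 1, h (γ t) = 1 / (b * Real.cos (Θ t)) := fun t ht =>
    hge _ (hΘm t ht).2
  set w : ℝ → ℝ := fun t => 2 * s * (Real.sin (Θ t) / Real.cos (Θ t)) with hw
  have hwc : ContinuousOn w (Icc 0 1) :=
    continuousOn_const.mul (hsinc.div hcosc (fun t ht => (hcos t ht).ne'))
  set γ' : ℝ → ℝ := fun t => -(w t * h (γ t)) with hγ'
  have hγ'c : ContinuousOn γ' (Icc 0 1) := (hwc.mul (hcont.comp hγc hγm)).neg
  have hγd : ∀ t ∈ Ioo (0:ℝ) 1, HasDerivAt γ (γ' t) t := by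
    intro t ht
    obtain ⟨a1, a2⟩ := hΘd t ht
    obtain ⟨b1, b2, b3, b4⟩ := hgt _ a1
    have hct := hcos t (Ioo_subset_Icc_self ht)
    have d1 := (a2.cos.const_mul b)
    have := b4.comp t d1
    refine HasDerivAt.congr_deriv (f := γ) this ?_
    simp only [hγ', hw, hhγ t (Ioo_subset_Icc_self ht)]
    field_simp
  have hγ0 : γ 0 = 0 := by simp only [hγ, hΘ0]; exact (hle _ le_rfl).1
  have hγ1 : γ 1 = 0 := by simp only [hγ, hΘ1]; exact (hle _ le_rfl).1
  have hadm : Admissible γ γ' := by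
    refine ⟨hγ'c.integrableOn_compact isCompact_Icc, ?_, fun t ht => hγm t ht, hγ0, hγ1⟩
    intro t ht
    rw [intervalIntegral.integral_eq_sub_of_hasDerivAt_of_le ht.1
      (hγc.mono (Icc_subset_Icc le_rfl ht.2)) (fun x hx => hγd x ⟨hx.1, lt_of_lt_of_le hx.2 ht.2⟩)
      (ContinuousOn.intervalIntegrable (by
        rw [uIcc_of_le ht.1]; exact hγ'c.mono (Icc_subset_Icc le_rfl ht.2))), hγ0, sub_zero]
  -- the momentum
  set S : ℝ → ℝ := fun t => Real.sin (Θ t) with hS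
  set S' : ℝ → ℝ := fun t => Real.cos (Θ t) * (2 * s / κ (b * Real.cos (Θ t))) with hS'
  have hSd : ∀ t ∈ Ioo (0:ℝ) 1, HasDerivAt S (S' t) t := fun t ht => (hΘd t ht).2.sin
  have hS'nn : ∀ t ∈ Ioo (0:ℝ) 1, 0 ≤ S' t := fun t ht => by
    have := hcos t (Ioo_subset_Icc_self ht)
    have := hκnn (b * Real.cos (Θ t))
    simp only [hS']; positivity
  have hS'i : IntervalIntegrable S' volume 0 1 := by
    rw [intervalIntegrable_iff_integrableOn_Ioc_of_le zero_le_one]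
    exact intervalIntegral.integrableOn_deriv_of_nonneg hsinc hSd hS'nn
  have hSint : ∀ t ∈ Icc (0:ℝ) 1, S t = S 0 + ∫ u in (0:ℝ)..t, S' u := by
    intro t ht
    rw [intervalIntegral.integral_eq_sub_of_hasDerivAt_of_le ht.1
      (hsinc.mono (Icc_subset_Icc le_rfl ht.2)) (fun x hx => hSd x ⟨hx.1, lt_of_lt_of_le hx.2 ht.2⟩)
      (hS'i.mono_set (by
        rw [uIcc_of_le ht.1, uIcc_of_le zero_le_one]; exact Icc_subset_Icc le_rfl ht.2))]
    ring
  have hLγ := lag_int (s := s) hadm hh hcont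
  -- for each competitor
  have hcomp : ∀ δ δ' : ℝ → ℝ, Admissible δ δ' → energy f₁ s γ γ' ≤ energy f₁ s δ δ' ∧
      (energy f₁ s δ δ' = energy f₁ s γ γ' → ∀ t ∈ Icc (0:ℝ) 1, δ t = γ t) := by
    intro δ δ' hδ
    have hδc := adm_cont hδ
    have hδi := adm_ii hδ
    have hγi := adm_ii hadm
    have hLδ := lag_int (s := s) hδ hh hcont
    set Lδ : ℝ → ℝ := fun t => Real.sqrt (s ^ 2 * (f₁ (Real.sqrt (δ t))) ^ 2 + (δ' t) ^ 2 / 4) with hLδd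
    set Lγ : ℝ → ℝ := fun t => Real.sqrt (s ^ 2 * (f₁ (Real.sqrt (γ t))) ^ 2 + (γ' t) ^ 2 / 4) with hLγd
    have hEδ : energy f₁ s δ δ' = ∫ t in (0:ℝ)..1, Lδ t := rfl
    have hEγ : energy f₁ s γ γ' = ∫ t in (0:ℝ)..1, Lγ t := rfl
    have key := ibp (f := S) (f' := S') (g := fun t => δ t - γ t) (g' := fun t => δ' t - γ' t)
      hS'i (hδi.sub hγi) hSint (by
        intro t ht
        have hsub : uIcc 0 t ⊆ uIcc (0:ℝ) 1 := by
          rw [uIcc_of_le ht.1, uIcc_of_le zero_le_one]; exact Icc_subset_Icc le_rfl ht.2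
        rw [intervalIntegral.integral_sub (hδi.mono_set hsub) (hγi.mono_set hsub),
          ← hδ.2.1 t ht, ← hadm.2.1 t ht, hδ.2.2.2.1, hγ0]
        ring)
    simp only [hδ.2.2.2.1, hδ.2.2.2.2, hγ0, hγ1, sub_self, mul_zero] at key
    set P : ℝ → ℝ := fun t => S' t * (δ t - γ t) + S t * (δ' t - γ' t) with hP
    have hPi : IntervalIntegrable P volume 0 1 := by
      apply IntervalIntegrable.add
      · exact hS'i.mul_continuousOn (by rw [uIcc_of_le zero_le_one]; exact hδc.sub hγc)
      · exact (hδi.sub hγi).continuousOn_mul (by rw [uIcc_of_le zero_le_one]; exact hsinc)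
    have hptA : ∀ t, s * h (δ t) * Real.cos (Θ t) + δ' t / 2 * (- Real.sin (Θ t)) ≤ Lδ t := by
      intro t
      have e : Lδ t = Real.sqrt ((s * h (δ t)) ^ 2 + (δ' t / 2) ^ 2) := by
        simp only [hLδd, ← hh]; congr 1; ring
      rw [e]
      exact cs_le (by rw [neg_sq]; exact Real.cos_sq_add_sin_sq _)
    have hptB : ∀ t ∈ Ioo (0:ℝ) 1, Lγ t - 1 / 2 * P t ≤
        s * h (δ t) * Real.cos (Θ t) + δ' t / 2 * (- Real.sin (Θ t)) := by
      intro t ht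
      have ht' := Ioo_subset_Icc_self ht
      have hct := hcos t ht'
      obtain ⟨a1, a2⟩ := hΘd t ht
      obtain ⟨b1, b2, b3, b4⟩ := hgt _ a1
      have hn := hneg _ b1
      have hLγt : Lγ t = s / (b * Real.cos (Θ t) ^ 2) := by
        have e : s ^ 2 * (f₁ (Real.sqrt (γ t))) ^ 2 + (γ' t) ^ 2 / 4 =
            (s / (b * Real.cos (Θ t) ^ 2)) ^ 2 := by
          rw [← hh]
          simp only [hγ', hw, hhγ t ht']
          have := Real.cos_sq_add_sin_sq (Θ t)
          have e2 : Real.sin (Θ t) ^ 2 = 1 - Real.cos (Θ t) ^ 2 := by linarith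
          field_simp
          rw [e2]; ring
        simp only [hLγd]
        rw [e, Real.sqrt_sq (by positivity)]
      have hS't : S' t = - 2 * s * h' (γ t) * Real.cos (Θ t) := by
        simp only [hS', b2]
        have : h' (ψ (b * Real.cos (Θ t))) ≠ 0 := hn.ne
        simp only [hγ]
        field_simp
      have hγ't : γ' t * S t = - 2 * (s / (b * Real.cos (Θ t) ^ 2)
          - s * h (γ t) * Real.cos (Θ t)) := by
        simp only [hγ', hw, hS, hhγ t ht']
        have := Real.cos_sq_add_sin_sq (Θ t)
        have e2 : Real.sin (Θ t) ^ 2 = 1 - Real.cos (Θ t) ^ 2 := by linarith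
        field_simp
        rw [e2]
      have ht1 := htan (γ t) b1 (δ t) (hδ.2.2.1 t ht')
      have ht2 := mul_le_mul_of_nonneg_left ht1 (mul_pos hs hct).le
      simp only [hP]
      rw [hLγt, hS't, mul_sub (S t), mul_comm (S t) (γ' t), hγ't]
      simp only [hS]
      nlinarith
    have hRi : IntervalIntegrable (fun t => Lγ t - 1 / 2 * P t) volume 0 1 :=
      hLγ.sub (hPi.const_mul _)
    have hRint : ∫ t in (0:ℝ)..1, (Lγ t - 1 / 2 * P t) = energy f₁ s γ γ' := by
      rw [intervalIntegral.integral_sub hLγ (hPi.const_mul _),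
        intervalIntegral.integral_const_mul, key, hEγ]
      ring
    have hpt : ∀ t ∈ Ioo (0:ℝ) 1, Lγ t - 1 / 2 * P t ≤ Lδ t := fun t ht =>
      (hptB t ht).trans (hptA t)
    refine ⟨?_, ?_⟩
    · rw [← hRint, hEδ]
      exact intervalIntegral.integral_mono_on_of_le_Ioo zero_le_one hRi hLδ hpt
    · intro heq
      have hz : ∫ t in (0:ℝ)..1, (Lδ t - (Lγ t - 1 / 2 * P t)) = 0 := by
        rw [intervalIntegral.integral_sub hLδ hRi, hRint, ← hEδ, heq, sub_self]
      rw [intervalIntegral.integral_of_le zero_le_one, integral_Ioc_eq_integral_Ioo,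
        integral_eq_zero_iff_of_nonneg_ae] at hz
      rotate_left
      · filter_upwards [ae_restrict_mem measurableSet_Ioo] with t ht
        have := hpt t ht
        simp only [Pi.zero_apply]; linarith
      · exact ((hLδ.sub hRi).1).mono_set Ioo_subset_Ioc_self
      have hae : ∀ᵐ t ∂(volume.restrict (Ioo (0:ℝ) 1)), δ' t = -(w t * h (δ t)) := by
        filter_upwards [hz, ae_restrict_mem measurableSet_Ioo] with t hzt ht
        simp only [Pi.zero_apply] at hzt
        have hct := hcos t (Ioo_subset_Icc_self ht)
        have e : Lδ t = Real.sqrt ((s * h (δ t)) ^ 2 + (δ' t / 2) ^ 2) := by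
          simp only [hLδd, ← hh]; congr 1; ring
        have A := hptA t
        have B := hptB t ht
        have := cs_eq (A := s * h (δ t)) (B := δ' t / 2) (C := Real.cos (Θ t))
          (S := - Real.sin (Θ t)) (by rw [neg_sq]; exact Real.cos_sq_add_sin_sq _)
          (by rw [← e]; linarith)
        simp only [hw]
        field_simp
        linarith
      have hvc : ContinuousOn (fun t => -(w t * h (δ t))) (Icc 0 1) :=
        (hwc.mul (hcont.comp hδc hδ.2.2.1)).neg
      have hδint : ∀ t ∈ Icc (0:ℝ) 1, δ t = ∫ u in (0:ℝ)..t, -(w u * h (δ u)) := by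
        intro t ht
        rw [hδ.2.1 t ht, intervalIntegral.integral_of_le ht.1, intervalIntegral.integral_of_le ht.1,
          integral_Ioc_eq_integral_Ioo, integral_Ioc_eq_integral_Ioo]
        apply integral_congr_ae
        exact ae_restrict_of_ae_restrict_of_subset (Ioo_subset_Ioo le_rfl ht.2) hae
      have hδd : ∀ t ∈ Ioo (0:ℝ) 1, HasDerivAt δ (-(w t * h (δ t))) t := by
        intro t ht
        have hd := intervalIntegral.integral_hasDerivAt_right (a := 0) (b := t)
          (f := fun u => -(w u * h (δ u)))
          (ContinuousOn.intervalIntegrable (by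
            rw [uIcc_of_le ht.1.le]; exact hvc.mono (Icc_subset_Icc le_rfl ht.2.le)))
          ((hvc.mono Ioo_subset_Icc_self).stronglyMeasurableAtFilter isOpen_Ioo t ht)
          (hvc.continuousAt (Icc_mem_nhds ht.1 ht.2))
        refine hd.congr_of_eventuallyEq ?_
        filter_upwards [Icc_mem_nhds ht.1 ht.2] with z hz
        exact hδint z hz
      refine uniq_aux (w := w) hanti hγc hδc hγm hδ.2.2.1 hγd hδd ?_ ?_ ?_ ?_
      · intro t ht
        have ht' : t ∈ Icc (0:ℝ) 1 := ⟨ht.1, by linarith [ht.2]⟩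
        have a := hΘmono.monotoneOn ht' (by constructor <;> norm_num) ht.2
        rw [hΘh] at a
        have := Real.sin_nonpos_of_nonpos_of_neg_pi_le a
          (by linarith [(hΘm t ht').1.1, Real.pi_pos])
        simp only [hw]
        exact mul_nonpos_of_nonneg_of_nonpos (by positivity)
          (div_nonpos_of_nonpos_of_nonneg this (hcos t ht').le)
      · intro t ht
        have ht' : t ∈ Icc (0:ℝ) 1 := ⟨by linarith [ht.1], ht.2⟩
        have a := hΘmono.monotoneOn (by constructor <;> norm_num) ht' ht.1
        rw [hΘh] at a
        have := Real.sin_nonneg_of_nonneg_of_le_pi a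
          (by linarith [(hΘm t ht').1.2, Real.pi_pos])
        simp only [hw]
        exact mul_nonneg (by positivity) (div_nonneg this (hcos t ht').le)
      · rw [hδ.2.2.2.1, hγ0]
      · rw [hδ.2.2.2.2, hγ1]
  have hmin : g0 f₁ s = energy f₁ s γ γ' := by
    apply IsLeast.csInf_eq
    refine ⟨⟨γ, γ', hadm, rfl⟩, ?_⟩
    rintro x ⟨δ, δ', hδ, rfl⟩
    exact (hcomp δ δ' hδ).1
  refine ⟨γ, γ', hadm, hmin.symm, ⟨γ', hγ'c.mono Ioo_subset_Icc_self, hγd⟩, ?_, ?_⟩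
  · intro t _
    simp only [hγ, hΘh, Real.cos_zero]
    apply hψmono
    nlinarith [Real.cos_le_one (Θ t)]
  · intro δ δ' hδ he
    exact (hcomp δ δ' hδ).2 (he.trans hmin)
end

section
/- Let 0 < s₁ < s₂ with g₀(s₂) < 1, and let γ₁, γ₂ be admissible functions attaining the infima defining g₀(s₁) and g₀(s₂) respectively. Then 0 < γ₁(t) < γ₂(t) for every t ∈ (0,1). -/
open MeasureTheory Set Filter

/-- The properties of `h u = f₁ (√u)` that are used. -/
structure HH (h : ℝ → ℝ) : Prop where
  cont : ContinuousOn h (Icc 0 1)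
  anti : StrictAntiOn h (Icc 0 1)
  conv : ConvexOn ℝ (Icc 0 1) h
  h1 : h 1 = 0

lemma HH.nonneg {h : ℝ → ℝ} (H : HH h) {x : ℝ} (hx : x ∈ Icc (0:ℝ) 1) : 0 ≤ h x := by
  rw [← H.h1]
  exact H.anti.antitoneOn hx (by simp) hx.2

lemma HH.pos {h : ℝ → ℝ} (H : HH h) {x : ℝ} (hx : x ∈ Icc (0:ℝ) 1) (hx1 : x < 1) : 0 < h x := by
  rw [← H.h1]
  exact H.anti hx (by simp) hx1

/-- Lagrangian with horizontal speed `l`. -/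
noncomputable def Lg (h : ℝ → ℝ) (l : ℝ) (γ γ' : ℝ → ℝ) (t : ℝ) : ℝ :=
  Real.sqrt (l ^ 2 * (h (γ t)) ^ 2 + (γ' t) ^ 2 / 4)

/-- An absolutely continuous arc on `[a,b]` with values in `[0,1]`. -/
structure Arc (a b : ℝ) (γ γ' : ℝ → ℝ) : Prop where
  hi : IntervalIntegrable γ' volume a b
  hv : ∀ t ∈ Icc a b, γ t = γ a + ∫ u in a..t, γ' u
  hm : ∀ t ∈ Icc a b, γ t ∈ Icc (0:ℝ) 1

lemma Arc.cont {a b : ℝ} {γ γ' : ℝ → ℝ} (A : Arc a b γ γ') (hab : a ≤ b) :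
    ContinuousOn γ (Icc a b) := by
  have := intervalIntegral.continuousOn_primitive_interval' A.hi (left_mem_uIcc)
  rw [uIcc_of_le hab] at this
  exact (continuousOn_const.add this).congr A.hv

lemma Arc.hisub {a b c d : ℝ} {γ γ' : ℝ → ℝ} (A : Arc a b γ γ') (hac : a ≤ c) (hcd : c ≤ d)
    (hdb : d ≤ b) : IntervalIntegrable γ' volume c d := by
  apply A.hi.mono_set
  rw [uIcc_of_le hcd, uIcc_of_le (by linarith)]
  exact Icc_subset_Icc hac hdb

lemma Arc.diff {a b c d : ℝ} {γ γ' : ℝ → ℝ} (A : Arc a b γ γ') (hac : a ≤ c) (hcd : c ≤ d)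
    (hdb : d ≤ b) : γ d = γ c + ∫ u in c..d, γ' u := by
  rw [A.hv d ⟨by linarith, hdb⟩, A.hv c ⟨hac, by linarith⟩,
    ← intervalIntegral.integral_add_adjacent_intervals (A.hisub le_rfl hac (by linarith))
      (A.hisub hac hcd hdb)]
  ring

lemma Arc.sub {a b c d : ℝ} {γ γ' : ℝ → ℝ} (A : Arc a b γ γ') (hac : a ≤ c) (hcd : c ≤ d)
    (hdb : d ≤ b) : Arc c d γ γ' := by
  refine ⟨A.hisub hac hcd hdb, fun t ht => A.diff hac ht.1 (ht.2.trans hdb), fun t ht => ?_⟩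
  exact A.hm t ⟨hac.trans ht.1, ht.2.trans hdb⟩

lemma Arc.hcont {a b : ℝ} {γ γ' h : ℝ → ℝ} (H : HH h) (A : Arc a b γ γ') (hab : a ≤ b) :
    ContinuousOn (fun t => h (γ t)) (Icc a b) :=
  H.cont.comp (A.cont hab) A.hm

lemma sqrt_add_le' (x y : ℝ) : Real.sqrt (x ^ 2 + y ^ 2) ≤ |x| + |y| := by
  rw [Real.sqrt_le_iff]
  refine ⟨by positivity, ?_⟩
  nlinarith [sq_abs x, sq_abs y, abs_nonneg x, abs_nonneg y, mul_nonneg (abs_nonneg x) (abs_nonneg y)]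

lemma Lg_meas {a b : ℝ} {γ γ' h : ℝ → ℝ} (H : HH h) (A : Arc a b γ γ') (hab : a ≤ b) (l : ℝ) :
    AEStronglyMeasurable (Lg h l γ γ') (volume.restrict (Ioc a b)) := by
  have h1 : AEStronglyMeasurable (fun t => h (γ t)) (volume.restrict (Ioc a b)) :=
    ((A.hcont H hab).intervalIntegrable_of_Icc hab).1.aestronglyMeasurable
  have h2 : AEStronglyMeasurable γ' (volume.restrict (Ioc a b)) := A.hi.1.aestronglyMeasurable
  refine Real.continuous_sqrt.comp_aestronglyMeasurable (f := fun t => l ^ 2 * (h (γ t)) ^ 2 + (γ' t) ^ 2 / 4) ?_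
  have h3 := ((h1.aemeasurable.pow_const 2).const_mul (l^2)).add ((h2.aemeasurable.pow_const 2).div_const 4)
  exact h3.aestronglyMeasurable

lemma Lg_int {a b : ℝ} {γ γ' h : ℝ → ℝ} (H : HH h) (A : Arc a b γ γ') (hab : a ≤ b) (l : ℝ) :
    IntervalIntegrable (Lg h l γ γ') volume a b := by
  rw [intervalIntegrable_iff_integrableOn_Ioc_of_le hab]
  have h1 : IntegrableOn (fun t => |l * h (γ t)| + |γ' t / 2|) (Ioc a b) := by
    have h1 := ((A.hcont H hab).intervalIntegrable_of_Icc (μ := volume) hab).1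
    exact (h1.const_mul l).abs.add (A.hi.1.div_const 2).abs
  refine Integrable.mono' h1 (Lg_meas H A hab l) (Eventually.of_forall fun t => ?_)
  unfold Lg
  rw [Real.norm_of_nonneg (Real.sqrt_nonneg _)]
  refine le_trans (le_of_eq ?_) (sqrt_add_le' _ _)
  congr 1; ring

/-- existence of an arc of horizontal width `w`, cost at most `e`, joining heights `y₀, y₁`. -/
def Seg (h : ℝ → ℝ) (w e y₀ y₁ : ℝ) : Prop :=
  ∃ γ γ' : ℝ → ℝ, Arc 0 w γ γ' ∧ γ 0 = y₀ ∧ γ w = y₁ ∧ ∫ t in (0:ℝ)..w, Lg h 1 γ γ' t ≤ e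

lemma Arc.toSeg {a b : ℝ} {γ γ' h : ℝ → ℝ} (A : Arc a b γ γ') (hab : a ≤ b)
    {l : ℝ} (hl : 0 < l) :
    Seg h (l * (b - a)) (∫ t in a..b, Lg h l γ γ' t) (γ a) (γ b) := by
  have key : ∀ (f : ℝ → ℝ) (x : ℝ), ∫ u in (0:ℝ)..x, f (a + u / l) = l * ∫ u in a..(a + x / l), f u := by
    intro f x
    have := intervalIntegral.integral_comp_add_div (a := 0) (b := x) f hl.ne' a
    simpa using this
  have hb : a + l * (b - a) / l = b := by field_simp; ring
  refine ⟨fun x => γ (a + x / l), fun x => γ' (a + x / l) / l, ⟨?_, ?_, ?_⟩, by simp, by simp only [hb], ?_⟩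
  · have h1 := (A.hi.comp_add_left a).comp_mul_left (c := l⁻¹)
    have h2 : IntervalIntegrable (fun x => γ' (a + l⁻¹ * x) / l) volume 0 (l * (b - a)) := by
      apply IntervalIntegrable.div_const
      convert h1 using 1 <;> field_simp <;> ring
    convert h2 using 4
    field_simp
  · intro t ht
    have h0 : 0 ≤ t / l := div_nonneg ht.1 hl.le
    have h1 : t / l ≤ b - a := by rw [div_le_iff₀ hl]; linarith [ht.2]
    have := A.hv (a + t / l) ⟨by linarith, by linarith⟩
    simp only [zero_div, add_zero]
    rw [this, key (fun x => γ' x / l), intervalIntegral.integral_div]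
    field_simp
  · intro t ht
    have h0 : 0 ≤ t / l := div_nonneg ht.1 hl.le
    have h1 : t / l ≤ b - a := by rw [div_le_iff₀ hl]; linarith [ht.2]
    exact A.hm _ ⟨by linarith, by linarith⟩
  · have h1 := key (fun x => Lg h l γ γ' x / l) (l * (b - a))
    rw [hb, intervalIntegral.integral_div (f := Lg h l γ γ') (a := a), mul_div_cancel₀ _ hl.ne'] at h1
    rw [← h1]
    apply le_of_eq
    congr 1
    ext x
    unfold Lg
    rw [eq_div_iff hl.ne']
    have e : ∀ z : ℝ, Real.sqrt z * l = Real.sqrt (z * l ^ 2) := fun z => by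
      rw [Real.sqrt_mul' _ (by positivity), Real.sqrt_sq hl.le]
    rw [e]
    congr 1
    field_simp

lemma glue_left {Fa Fb : ℝ → ℝ} {w t : ℝ} (h0 : 0 ≤ t) (ht : t ≤ w) :
    ∫ u in (0:ℝ)..t, (if u ≤ w then Fa u else Fb (u - w)) = ∫ u in (0:ℝ)..t, Fa u := by
  apply intervalIntegral.integral_congr_ae
  refine Eventually.of_forall fun x hx => ?_
  rw [uIoc_of_le h0] at hx
  simp [hx.2.trans ht]

lemma glue_right {Fa Fb : ℝ → ℝ} {w r : ℝ} (h0 : 0 ≤ w) (hr : 0 ≤ r)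
    (ia : IntervalIntegrable Fa volume 0 w) (ib : IntervalIntegrable Fb volume 0 r) :
    IntervalIntegrable (fun u => if u ≤ w then Fa u else Fb (u - w)) volume 0 (w + r) ∧
    ∫ u in (0:ℝ)..(w + r), (if u ≤ w then Fa u else Fb (u - w)) =
      (∫ u in (0:ℝ)..w, Fa u) + ∫ u in (0:ℝ)..r, Fb u := by
  have i1 : IntervalIntegrable (fun u => if u ≤ w then Fa u else Fb (u - w)) volume 0 w := by
    refine (intervalIntegrable_congr ?_).mpr ia
    intro x hx
    rw [uIoc_of_le h0] at hx
    simp [hx.2]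
  have e2 : EqOn (fun u => if u ≤ w then Fa u else Fb (u - w)) (fun u => Fb (u - w)) (uIoc w (w + r)) := by
    intro x hx
    rw [uIoc_of_le (by linarith)] at hx
    simp [hx.1]
  have i2 : IntervalIntegrable (fun u => if u ≤ w then Fa u else Fb (u - w)) volume w (w + r) := by
    refine (intervalIntegrable_congr e2).mpr ?_
    have := ib.comp_sub_right w
    rwa [zero_add, add_comm] at this
  refine ⟨i1.trans i2, ?_⟩
  rw [← intervalIntegral.integral_add_adjacent_intervals i1 i2, glue_left h0 le_rfl]
  congr 1
  rw [intervalIntegral.integral_congr_ae (Eventually.of_forall e2), intervalIntegral.integral_comp_sub_right]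
  simp

lemma Seg.trans {h : ℝ → ℝ} (H : HH h) {w e w' e' y₀ y₁ y₂ : ℝ} (hw : 0 ≤ w) (hw' : 0 ≤ w')
    (S : Seg h w e y₀ y₁) (S' : Seg h w' e' y₁ y₂) : Seg h (w + w') (e + e') y₀ y₂ := by
  obtain ⟨p, p', A, a0, a1, ae⟩ := S
  obtain ⟨q, q', B, b0, b1, be⟩ := S'
  refine ⟨fun u => if u ≤ w then p u else q (u - w), fun u => if u ≤ w then p' u else q' (u - w),
    ⟨(glue_right hw hw' A.hi B.hi).1, ?_, ?_⟩, ?_, ?_, ?_⟩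
  · intro t ht
    by_cases h1 : t ≤ w
    · rw [glue_left ht.1 h1]
      simp only [h1, hw, if_true]
      exact A.hv t ⟨ht.1, h1⟩
    · push Not at h1
      have := (glue_right (r := t - w) hw (by linarith) A.hi (B.hisub le_rfl (by linarith) (by linarith [ht.2]))).2
      rw [add_sub_cancel] at this
      rw [this]
      simp only [not_le.mpr h1, hw, if_true, if_false]
      rw [B.hv (t - w) ⟨by linarith, by linarith [ht.2]⟩, b0, ← a1, A.hv w ⟨hw, le_rfl⟩]
      ring
  · intro t ht
    by_cases h1 : t ≤ w
    · simp only [h1, if_true]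
      exact A.hm t ⟨ht.1, h1⟩
    · simp only [h1, if_false]
      push Not at h1
      exact B.hm (t - w) ⟨by linarith, by linarith [ht.2]⟩
  · simp [hw, a0]
  · by_cases h1 : w' = 0
    · subst h1
      simp [a1, ← b1, b0]
    · have : 0 < w' := lt_of_le_of_ne hw' (Ne.symm h1)
      simp [this, b1]
  · have := (glue_right hw hw' (Lg_int H A hw 1) (Lg_int H B hw' 1)).2
    have h2 : ∀ t, Lg h 1 (fun u => if u ≤ w then p u else q (u - w)) (fun u => if u ≤ w then p' u else q' (u - w)) t
      = if t ≤ w then Lg h 1 p p' t else Lg h 1 q q' (t - w) := by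
      intro t
      unfold Lg
      dsimp only
      split_ifs <;> rfl
    simp only [h2]
    rw [this]
    linarith

lemma Seg.linear {h : ℝ → ℝ} (H : HH h) {w y₀ y₁ m : ℝ} (hw : 0 < w) (h0 : y₀ ∈ Icc (0:ℝ) 1)
    (h1 : y₁ ∈ Icc (0:ℝ) 1) (hm : m ∈ Icc (0:ℝ) 1) (hm0 : m ≤ y₀) (hm1 : m ≤ y₁) :
    Seg h w (Real.sqrt (w ^ 2 * h m ^ 2 + (y₁ - y₀) ^ 2 / 4)) y₀ y₁ := by
  have A : Arc 0 1 (fun t => y₀ + t * (y₁ - y₀)) (fun _ => y₁ - y₀) := by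
    refine ⟨by simp, ?_, ?_⟩
    · intro t ht
      simp [mul_sub]
    · intro t ht
      obtain ⟨_, _⟩ := h0
      obtain ⟨_, _⟩ := h1
      obtain ⟨_, _⟩ := ht
      constructor <;> nlinarith
  obtain ⟨p, p', B, b0, b1, be⟩ := A.toSeg (h := h) zero_le_one hw
  simp only [sub_zero, mul_one] at B be b1
  refine ⟨p, p', B, by simp [b0], by simp [b1], be.trans ?_⟩
  have : ∫ t in (0:ℝ)..1, (Real.sqrt (w ^ 2 * h m ^ 2 + (y₁ - y₀) ^ 2 / 4)) = (Real.sqrt (w ^ 2 * h m ^ 2 + (y₁ - y₀) ^ 2 / 4)) := by simp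
  rw [← this]
  apply intervalIntegral.integral_mono_on zero_le_one (Lg_int H A zero_le_one w) (by simp)
  intro t ht
  unfold Lg
  apply Real.sqrt_le_sqrt
  have h3 := A.hm t ht
  have h2 : h (y₀ + t * (y₁ - y₀)) ≤ h m := by
    apply H.anti.antitoneOn hm h3
    nlinarith [ht.1, ht.2]
  have h4 := H.nonneg h3
  have : h (y₀ + t * (y₁ - y₀)) ^ 2 ≤ h m ^ 2 := by gcongr
  gcongr

lemma Seg.const {h : ℝ → ℝ} (H : HH h) {w y : ℝ} (hw : 0 < w) (h0 : y ∈ Icc (0:ℝ) 1) :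
    Seg h w (w * h y) y y := by
  have := Seg.linear H hw h0 h0 h0 le_rfl le_rfl
  have h2 : Real.sqrt (w ^ 2 * h y ^ 2 + (y - y) ^ 2 / 4) = w * h y := by
    rw [← Real.sqrt_sq (mul_nonneg hw.le (H.nonneg h0))]
    congr 1; ring
  rwa [h2] at this

/-- A minimizer of the energy with parameter `s`, with energy below one. -/
structure Mini (h : ℝ → ℝ) (s : ℝ) (γ γ' : ℝ → ℝ) : Prop where
  hs : 0 < s
  arc : Arc 0 1 γ γ'
  g0 : γ 0 = 0
  g1 : γ 1 = 0
  lt : ∫ t in (0:ℝ)..1, Lg h s γ γ' t < 1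
  hmin : ∀ e, Seg h s e 0 0 → ∫ t in (0:ℝ)..1, Lg h s γ γ' t ≤ e
lemma Lg_ge_h {h : ℝ → ℝ} {l : ℝ} {γ γ' : ℝ → ℝ} {t : ℝ} : l * h (γ t) ≤ Lg h l γ γ' t := by
  apply Real.le_sqrt_of_sq_le
  nlinarith [sq_nonneg (γ' t)]

lemma Lg_ge_d {h : ℝ → ℝ} {l : ℝ} {γ γ' : ℝ → ℝ} {t : ℝ} : γ' t / 2 ≤ Lg h l γ γ' t := by
  apply Real.le_sqrt_of_sq_le
  nlinarith [sq_nonneg (l * h (γ t))]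

lemma Lg_ge_d' {h : ℝ → ℝ} {l : ℝ} {γ γ' : ℝ → ℝ} {t : ℝ} : -(γ' t / 2) ≤ Lg h l γ γ' t := by
  apply Real.le_sqrt_of_sq_le
  nlinarith [sq_nonneg (l * h (γ t))]

lemma Mini.lint {h : ℝ → ℝ} (H : HH h) {s : ℝ} {γ γ' : ℝ → ℝ} (m : Mini h s γ γ')
    {a b : ℝ} (ha : 0 ≤ a) (hab : a ≤ b) (hb : b ≤ 1) (l : ℝ) :
    IntervalIntegrable (Lg h l γ γ') volume a b :=
  Lg_int H (m.arc.sub ha hab hb) hab l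

lemma Mini.localMin {h : ℝ → ℝ} (H : HH h) {s : ℝ} {γ γ' : ℝ → ℝ} (m : Mini h s γ γ')
    {a b : ℝ} (ha : 0 ≤ a) (hab : a ≤ b) (hb : b ≤ 1) {e : ℝ}
    (S : Seg h (s * (b - a)) e (γ a) (γ b)) : ∫ t in a..b, Lg h s γ γ' t ≤ e := by
  have hs := m.hs
  have S1 := (m.arc.sub le_rfl ha (hab.trans hb)).toSeg (h := h) ha hs
  have S2 := (m.arc.sub (ha.trans hab) hb le_rfl).toSeg (h := h) hb hs
  have w1 : 0 ≤ s * (b - a) := mul_nonneg hs.le (by linarith)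
  have w2 : 0 ≤ s * (1 - b) := mul_nonneg hs.le (by linarith)
  have w0 : 0 ≤ s * (a - 0) := mul_nonneg hs.le (by linarith)
  have S3 := S1.trans H w0 (by linarith) (S.trans H w1 w2 S2)
  rw [m.g0, m.g1, show s * (a - 0) + (s * (b - a) + s * (1 - b)) = s by ring] at S3
  have := m.hmin _ S3
  rw [← intervalIntegral.integral_add_adjacent_intervals (m.lint H le_rfl ha (hab.trans hb) s)
    (m.lint H ha (hab.trans hb) le_rfl s), ← intervalIntegral.integral_add_adjacent_intervals
    (m.lint H ha hab hb s) (m.lint H (ha.trans hab) hb le_rfl s)] at this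
  linarith

lemma Mini.lt_one {h : ℝ → ℝ} (H : HH h) {s : ℝ} {γ γ' : ℝ → ℝ} (m : Mini h s γ γ')
    {t : ℝ} (ht : t ∈ Icc (0:ℝ) 1) : γ t < 1 := by
  have h1 := m.lt
  rw [← intervalIntegral.integral_add_adjacent_intervals (m.lint H le_rfl ht.1 ht.2 s)
    (m.lint H ht.1 ht.2 le_rfl s)] at h1
  have i1 := m.arc.hisub le_rfl ht.1 ht.2
  have i2 := m.arc.hisub ht.1 ht.2 le_rfl
  have h2 := intervalIntegral.integral_mono_on ht.1 (i1.div_const 2) (m.lint H le_rfl ht.1 ht.2 s)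
    (fun x _ => Lg_ge_d)
  have h3 := intervalIntegral.integral_mono_on ht.2 (i2.div_const 2).neg (m.lint H ht.1 ht.2 le_rfl s)
    (fun x _ => Lg_ge_d')
  have h4 := m.arc.diff le_rfl ht.1 ht.2
  have h5 := m.arc.diff ht.1 ht.2 le_rfl
  simp only [intervalIntegral.integral_div] at h2
  simp only [Pi.neg_apply, intervalIntegral.integral_neg, intervalIntegral.integral_div] at h3
  rw [m.g0] at h4
  rw [m.g1] at h5
  linarith

lemma Mini.mem {h : ℝ → ℝ} {s : ℝ} {γ γ' : ℝ → ℝ} (m : Mini h s γ γ')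
    {t : ℝ} (ht : t ∈ Icc (0:ℝ) 1) : γ t ∈ Icc (0:ℝ) 1 := m.arc.hm t ht

lemma Mini.hpos {h : ℝ → ℝ} (H : HH h) {s : ℝ} {γ γ' : ℝ → ℝ} (m : Mini h s γ γ')
    {t : ℝ} (ht : t ∈ Icc (0:ℝ) 1) : 0 < h (γ t) := H.pos (m.mem ht) (m.lt_one H ht)

lemma sqrt_quad {A B : ℝ} (hA : 0 < A) : Real.sqrt (A ^ 2 + B ^ 2 / 4) ≤ A + B ^ 2 / (8 * A) := by
  rw [Real.sqrt_le_iff]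
  refine ⟨by positivity, ?_⟩
  have : (A + B ^ 2 / (8 * A)) ^ 2 = A ^ 2 + B ^ 2 / 4 + (B ^ 2 / (8 * A)) ^ 2 := by
    field_simp; ring
  rw [this]
  nlinarith [sq_nonneg (B ^ 2 / (8 * A))]

lemma Mini.no_plateau {h : ℝ → ℝ} (H : HH h) {s : ℝ} {γ γ' : ℝ → ℝ} (m : Mini h s γ γ')
    {a b M : ℝ} (ha : 0 ≤ a) (hab : a < b) (hb : b ≤ 1) (hM : ∀ t ∈ Icc a b, γ t = M) : False := by
  have hs := m.hs
  have haM : γ a = M := hM a ⟨le_rfl, hab.le⟩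
  have hbM : γ b = M := hM b ⟨hab.le, le_rfl⟩
  have hM0 : M ∈ Icc (0:ℝ) 1 := haM ▸ m.mem ⟨ha, by linarith⟩
  have hM1 : M < 1 := haM ▸ m.lt_one H ⟨ha, by linarith⟩
  have hp : 0 < h M := H.pos hM0 hM1
  set K := h M with hK
  obtain ⟨σ, hσ⟩ : ∃ σ, σ = s * (b - a) / 4 := ⟨_, rfl⟩
  have hσ0 : 0 < σ := by
    rw [hσ]; have := mul_pos hs (sub_pos.2 hab); positivity
  obtain ⟨θ, hθ0, hθ1, hθ2⟩ : ∃ θ : ℝ, 0 < θ ∧ θ < 1 ∧ θ < 8 * (σ * K) ^ 2 := by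
    refine ⟨min (1 / 2) (4 * (σ * K) ^ 2), by positivity, ?_, ?_⟩
    · exact lt_of_le_of_lt (min_le_left _ _) (by norm_num)
    · refine lt_of_le_of_lt (min_le_right _ _) ?_
      have : 0 < (σ * K) ^ 2 := by positivity
      linarith
  obtain ⟨ε, hε⟩ : ∃ ε, ε = θ * (1 - M) := ⟨_, rfl⟩
  have hε0 : 0 < ε := by rw [hε]; exact mul_pos hθ0 (by linarith)
  have hε1 : ε ≤ θ := by rw [hε]; nlinarith [hM0.1]
  have hN : M + ε ∈ Icc (0:ℝ) 1 := ⟨by linarith [hM0.1], by rw [hε]; nlinarith [hM0.1]⟩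
  have hcv : h (M + ε) ≤ (1 - θ) * K := by
    have := H.conv.2 hM0 (show (1:ℝ) ∈ Icc (0:ℝ) 1 by simp) (show 0 ≤ 1 - θ by linarith) hθ0.le (by ring)
    simp only [smul_eq_mul, H.h1] at this
    rw [show (1 - θ) * M + θ * 1 = M + ε by rw [hε]; ring] at this
    linarith
  have L1 := Seg.linear H hσ0 hM0 hN hM0 le_rfl (by linarith)
  have L2 := Seg.const H (show 0 < 2 * σ by linarith) hN
  have L3 := Seg.linear H hσ0 hN hM0 hM0 (by linarith) le_rfl
  have S := L1.trans H hσ0.le (by linarith) (L2.trans H (by linarith) hσ0.le L3)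
  rw [show σ + (2 * σ + σ) = s * (b - a) by rw [hσ]; ring] at S
  have e1 := m.localMin H ha hab.le hb (by rw [haM, hbM]; exact S)
  have e2 : ∫ t in a..b, s * K ≤ ∫ t in a..b, Lg h s γ γ' t := by
    apply intervalIntegral.integral_mono_on hab.le (by simp) (m.lint H ha hab.le hb s)
    intro x hx
    have := Lg_ge_h (h := h) (l := s) (γ := γ) (γ' := γ') (t := x)
    rwa [hM x hx] at this
  rw [intervalIntegral.integral_const, smul_eq_mul] at e2
  have q1 := sqrt_quad (A := σ * K) (B := ε) (by positivity)
  have e3 : Real.sqrt (σ ^ 2 * K ^ 2 + (M + ε - M) ^ 2 / 4) = Real.sqrt ((σ * K) ^ 2 + ε ^ 2 / 4) := by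
    congr 1; ring
  have e4 : Real.sqrt (σ ^ 2 * K ^ 2 + (M - (M + ε)) ^ 2 / 4) = Real.sqrt ((σ * K) ^ 2 + ε ^ 2 / 4) := by
    congr 1; ring
  rw [← hK, e3, e4] at e1
  have q2 : ε ^ 2 / (8 * (σ * K)) < σ * K * θ := by
    rw [div_lt_iff₀ (by positivity)]
    nlinarith
  have q3 : (b - a) * (s * K) = 4 * (σ * K) := by rw [hσ]; ring
  nlinarith

lemma Mini.exists_max {h : ℝ → ℝ} {s : ℝ} {γ γ' : ℝ → ℝ} (m : Mini h s γ γ') :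
    ∃ T ∈ Icc (0:ℝ) 1, ∀ t ∈ Icc (0:ℝ) 1, γ t ≤ γ T := by
  obtain ⟨T, hT, h⟩ := isCompact_Icc.exists_isMaxOn ⟨0, by simp⟩ (m.arc.cont zero_le_one)
  exact ⟨T, hT, h⟩

/-- Insertion of a plateau. -/
lemma Mini.insert {h : ℝ → ℝ} (H : HH h) {s₁ s₂ : ℝ} {γ₁ γ₁' γ₂ γ₂' : ℝ → ℝ}
    (m₁ : Mini h s₁ γ₁ γ₁') (m₂ : Mini h s₂ γ₂ γ₂') (hs : s₁ < s₂) {T : ℝ} (hT : T ∈ Icc (0:ℝ) 1) :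
    ∫ t in (0:ℝ)..1, Lg h s₂ γ₂ γ₂' t ≤
      (∫ t in (0:ℝ)..1, Lg h s₁ γ₁ γ₁' t) + (s₂ - s₁) * h (γ₁ T) := by
  have hs1 := m₁.hs
  have S1 := (m₁.arc.sub le_rfl hT.1 hT.2).toSeg (h := h) hT.1 hs1
  have S2 := (m₁.arc.sub hT.1 hT.2 le_rfl).toSeg (h := h) hT.2 hs1
  have w0 : 0 ≤ s₁ * (T - 0) := mul_nonneg hs1.le (by linarith [hT.1])
  have w2 : 0 ≤ s₁ * (1 - T) := mul_nonneg hs1.le (by linarith [hT.2])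
  have S := S1.trans H w0 (by linarith) ((Seg.const H (sub_pos.2 hs) (m₁.mem hT)).trans H (by linarith) w2 S2)
  rw [m₁.g0, m₁.g1, show s₁ * (T - 0) + (s₂ - s₁ + s₁ * (1 - T)) = s₂ by ring] at S
  have := m₂.hmin _ S
  rw [← intervalIntegral.integral_add_adjacent_intervals (m₁.lint H le_rfl hT.1 hT.2 s₁)
    (m₁.lint H hT.1 hT.2 le_rfl s₁)]
  linarith

/-- Removal of a vertical strip. -/
lemma Mini.cut {h : ℝ → ℝ} (H : HH h) {s₁ s₂ : ℝ} {γ₁ γ₁' γ₂ γ₂' : ℝ → ℝ}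
    (m₁ : Mini h s₁ γ₁ γ₁') (m₂ : Mini h s₂ γ₂ γ₂') (hs : s₁ < s₂) {T : ℝ} (hT : T ∈ Icc (0:ℝ) 1)
    (hmax : ∀ t ∈ Icc (0:ℝ) 1, γ₂ t ≤ γ₂ T) :
    (∫ t in (0:ℝ)..1, Lg h s₁ γ₁ γ₁' t) + (s₂ - s₁) * h (γ₂ T) < 
    ∫ t in (0:ℝ)..1, Lg h s₂ γ₂ γ₂' t := by
  have hs1 := m₁.hs
  have hs2 := m₂.hs
  obtain ⟨w, hw⟩ : ∃ w, w = (s₂ - s₁) / s₂ := ⟨_, rfl⟩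
  have hw0 : 0 < w := by rw [hw]; exact div_pos (by linarith) hs2
  have hw1 : w < 1 := by rw [hw, div_lt_one hs2]; linarith
  have hsw : s₂ * w = s₂ - s₁ := by rw [hw]; field_simp
  obtain ⟨a, ha, hab⟩ : ∃ a ∈ Icc (0:ℝ) (1 - w), γ₂ (a + w) = γ₂ a := by
    have hc : ContinuousOn (fun t => γ₂ (t + w) - γ₂ t) (Icc 0 (1 - w)) := by
      have hc := m₂.arc.cont zero_le_one
      refine ContinuousOn.sub (hc.comp (by fun_prop) ?_) (hc.mono (Icc_subset_Icc le_rfl (by linarith)))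
      intro x hx
      exact ⟨by linarith [hx.1], by linarith [hx.2]⟩
    have := intermediate_value_Icc' (show (0:ℝ) ≤ 1 - w by linarith) hc
    have h0 : (0:ℝ) ∈ Icc (γ₂ (1 - w + w) - γ₂ (1 - w)) (γ₂ (0 + w) - γ₂ 0) := by
      rw [sub_add_cancel, zero_add, m₂.g0, m₂.g1]
      exact ⟨by linarith [(m₂.mem (t := 1 - w) ⟨by linarith, by linarith⟩).1],
        by linarith [(m₂.mem (t := w) ⟨by linarith, by linarith⟩).1]⟩
    obtain ⟨a, ha, h⟩ := this h0
    exact ⟨a, ha, by dsimp only at h; linarith⟩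
  have hb : a + w ≤ 1 := by linarith [ha.2]
  have hb0 : 0 ≤ a + w := by linarith [ha.1]
  have haw : a < a + w := by linarith
  have S1 := (m₂.arc.sub le_rfl ha.1 (haw.le.trans hb)).toSeg (h := h) ha.1 hs2
  have S2 := (m₂.arc.sub hb0 hb le_rfl).toSeg (h := h) hb hs2
  rw [hab] at S2
  have w0 : 0 ≤ s₂ * (a - 0) := mul_nonneg hs2.le (by linarith [ha.1])
  have w2 : 0 ≤ s₂ * (1 - (a + w)) := mul_nonneg hs2.le (by linarith)
  have S := S1.trans H w0 w2 S2
  rw [m₂.g0, m₂.g1, show s₂ * (a - 0) + s₂ * (1 - (a + w)) = s₁ by linarith] at S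
  have e1 := m₁.hmin _ S
  have e2 : ∫ t in a..(a + w), s₂ * h (γ₂ T) < ∫ t in a..(a + w), s₂ * h (γ₂ t) := by
    apply intervalIntegral.integral_lt_integral_of_continuousOn_of_le_of_exists_lt haw continuousOn_const
      (continuousOn_const.mul ((m₂.arc.sub ha.1 haw.le hb).hcont H haw.le))
    · intro x hx
      have hx' : x ∈ Icc (0:ℝ) 1 := ⟨by linarith [ha.1, hx.1], by linarith [hx.2]⟩
      exact mul_le_mul_of_nonneg_left (H.anti.antitoneOn (m₂.mem hx') (m₂.mem hT) (hmax x hx')) hs2.le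
    · by_contra hcon
      push Not at hcon
      refine m₂.no_plateau H ha.1 haw hb (M := γ₂ T) fun x hx => ?_
      have hx' : x ∈ Icc (0:ℝ) 1 := ⟨by linarith [ha.1, hx.1], by linarith [hx.2]⟩
      by_contra hne
      have hlt := lt_of_le_of_ne (hmax x hx') hne
      have := mul_lt_mul_of_pos_left (H.anti (m₂.mem hx') (m₂.mem hT) hlt) hs2
      have h7 := hcon x hx
      simp only [Pi.mul_apply] at h7
      linarith
  have e3 : ∫ t in a..(a + w), s₂ * h (γ₂ t) ≤ ∫ t in a..(a + w), Lg h s₂ γ₂ γ₂' t := by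
    apply intervalIntegral.integral_mono_on haw.le _ (m₂.lint H ha.1 haw.le hb s₂) (fun x _ => Lg_ge_h)
    exact ContinuousOn.intervalIntegrable_of_Icc haw.le 
      (continuousOn_const.mul ((m₂.arc.sub ha.1 haw.le hb).hcont H haw.le))
  rw [intervalIntegral.integral_const, smul_eq_mul, add_sub_cancel_left, ← mul_assoc, mul_comm w, hsw] at e2
  rw [← intervalIntegral.integral_add_adjacent_intervals (m₂.lint H le_rfl ha.1 (haw.le.trans hb) s₂)
    (m₂.lint H ha.1 (haw.le.trans hb) le_rfl s₂), ← intervalIntegral.integral_add_adjacent_intervals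
    (m₂.lint H ha.1 haw.le hb s₂) (m₂.lint H hb0 hb le_rfl s₂)]
  linarith

lemma Mini.max_lt {h : ℝ → ℝ} (H : HH h) {s₁ s₂ : ℝ} {γ₁ γ₁' γ₂ γ₂' : ℝ → ℝ}
    (m₁ : Mini h s₁ γ₁ γ₁') (m₂ : Mini h s₂ γ₂ γ₂') (hs : s₁ < s₂) {T₁ T₂ : ℝ}
    (hT₁ : T₁ ∈ Icc (0:ℝ) 1) (hT₂ : T₂ ∈ Icc (0:ℝ) 1)
    (hmax : ∀ t ∈ Icc (0:ℝ) 1, γ₂ t ≤ γ₂ T₂) : h (γ₂ T₂) < h (γ₁ T₁) := by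
  have h1 := m₁.insert H m₂ hs hT₁
  have h2 := m₁.cut H m₂ hs hT₂ hmax
  have h3 : (s₂ - s₁) * h (γ₂ T₂) < (s₂ - s₁) * h (γ₁ T₁) := by linarith
  exact lt_of_mul_lt_mul_left h3 (by linarith)
lemma lin_zero {X Y : ℝ} (h : ∀ ε : ℝ, |ε| ≤ 1 / 2 → 0 ≤ ε * X + ε ^ 2 * Y) : X = 0 := by
  by_contra hX
  have hX2 : 0 < X ^ 2 := by positivity
  obtain ⟨δ, hδ⟩ : ∃ δ, δ = 1 / (2 * (|X| + |Y| + 1)) := ⟨_, rfl⟩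
  have hδ0 : 0 < δ := by rw [hδ]; positivity
  have hd : δ * (2 * (|X| + |Y| + 1)) = 1 := by rw [hδ]; field_simp
  have h1 := h (-X * δ) (by
    rw [abs_mul, abs_neg, abs_of_pos hδ0]
    nlinarith [mul_nonneg hδ0.le (abs_nonneg Y)])
  have h2 : δ * Y ≤ 1 / 2 := by
    nlinarith [mul_nonneg hδ0.le (abs_nonneg X), mul_le_mul_of_nonneg_left (le_abs_self Y) hδ0.le]
  have h3 : 0 ≤ (δ * X ^ 2) * (-1 + δ * Y) := by nlinarith
  have h4 : 0 < δ * X ^ 2 := by positivity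
  nlinarith

lemma Mini.Lpos {h : ℝ → ℝ} (H : HH h) {s : ℝ} {γ γ' : ℝ → ℝ} (m : Mini h s γ γ')
    {t : ℝ} (ht : t ∈ Icc (0:ℝ) 1) : 0 < Lg h s γ γ' t :=
  lt_of_lt_of_le (mul_pos m.hs (m.hpos H ht)) Lg_ge_h

lemma Mini.perturb {h : ℝ → ℝ} (H : HH h) {s : ℝ} {γ γ' : ℝ → ℝ} (m : Mini h s γ γ')
    {t : ℝ} (ht : t ∈ Icc (0:ℝ) 1) {δ : ℝ} :
    Lg h (s * (1 + δ)) γ γ' t ≤ Lg h s γ γ' t + δ * (s ^ 2 * h (γ t) ^ 2 / Lg h s γ γ' t)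
      + δ ^ 2 / 2 * (s ^ 2 * h (γ t) ^ 2 / Lg h s γ γ' t) := by
  have hL := m.Lpos H ht
  have hsq : Lg h s γ γ' t ^ 2 = s ^ 2 * h (γ t) ^ 2 + γ' t ^ 2 / 4 := by
    unfold Lg; rw [Real.sq_sqrt (by positivity)]
  have hA : s ^ 2 * h (γ t) ^ 2 ≤ Lg h s γ γ' t ^ 2 := by rw [hsq]; nlinarith [sq_nonneg (γ' t)]
  have hexp : Lg h (s * (1 + δ)) γ γ' t = Real.sqrt ((s * (1 + δ)) ^ 2 * h (γ t) ^ 2 + γ' t ^ 2 / 4) := rfl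
  rw [hexp]
  generalize Lg h s γ γ' t = L at *
  obtain ⟨F, hF⟩ : ∃ F, F = s ^ 2 * h (γ t) ^ 2 / L := ⟨_, rfl⟩
  have hFL : F * L = s ^ 2 * h (γ t) ^ 2 := by rw [hF]; field_simp
  have hF0 : 0 ≤ F := by rw [hF]; positivity
  have hFle : F ≤ L := by
    by_contra hc
    push Not at hc
    nlinarith
  rw [← hF, Real.sqrt_le_iff]
  constructor
  · nlinarith [mul_nonneg hF0 (sq_nonneg (δ + 1))]
  · have : (s * (1 + δ)) ^ 2 * h (γ t) ^ 2 + γ' t ^ 2 / 4 = L ^ 2 + (2 * δ + δ ^ 2) * (F * L) := by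
      rw [hFL, hsq]; ring
    rw [this]
    nlinarith [sq_nonneg (δ * F + δ ^ 2 / 2 * F)]

lemma Mini.Fint {h : ℝ → ℝ} (H : HH h) {s : ℝ} {γ γ' : ℝ → ℝ} (m : Mini h s γ γ')
    {a b : ℝ} (ha : 0 ≤ a) (hab : a ≤ b) (hb : b ≤ 1) :
    IntervalIntegrable (fun t => s ^ 2 * h (γ t) ^ 2 / Lg h s γ γ' t) volume a b := by
  have A := m.arc.sub ha hab hb
  have h1 := ((A.hcont H hab).intervalIntegrable_of_Icc (μ := volume) hab)
  have h2 := Lg_meas H A hab s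
  rw [intervalIntegrable_iff_integrableOn_Ioc_of_le hab]
  refine Integrable.mono' (h1.const_mul s).1 ?_ ?_
  · exact (((h1.1.aestronglyMeasurable.aemeasurable.pow_const 2).const_mul (s^2)).div
      h2.aemeasurable).aestronglyMeasurable
  · refine (ae_restrict_iff' measurableSet_Ioc).2 (Eventually.of_forall fun t ht => ?_)
    have ht' : t ∈ Icc (0:ℝ) 1 := ⟨by linarith [ht.1], by linarith [ht.2]⟩
    have hL := m.Lpos H ht'
    have hh := m.hpos H ht'
    have hs := m.hs
    rw [Real.norm_of_nonneg (by positivity), div_le_iff₀ hL]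
    have := Lg_ge_h (h := h) (l := s) (γ := γ) (γ' := γ') (t := t)
    nlinarith [mul_pos hs hh]

lemma Mini.Fconst {h : ℝ → ℝ} (H : HH h) {s : ℝ} {γ γ' : ℝ → ℝ} (m : Mini h s γ γ')
    {a : ℝ} (ha : a ∈ Ioo (0:ℝ) 1) :
    ∫ t in (0:ℝ)..a, s ^ 2 * h (γ t) ^ 2 / Lg h s γ γ' t =
      a * ∫ t in (0:ℝ)..1, s ^ 2 * h (γ t) ^ 2 / Lg h s γ γ' t := by
  obtain ⟨a0, a1⟩ := ha
  have hs := m.hs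
  have f1 := m.Fint H le_rfl a0.le a1.le
  have f2 := m.Fint H a0.le a1.le le_rfl
  set F := fun t => s ^ 2 * h (γ t) ^ 2 / Lg h s γ γ' t with hF
  change ∫ t in (0:ℝ)..a, F t = a * ∫ t in (0:ℝ)..1, F t
  have piece : ∀ p q δ : ℝ, 0 ≤ p → p ≤ q → q ≤ 1 →
      ∫ t in p..q, Lg h (s * (1 + δ)) γ γ' t ≤ (∫ t in p..q, Lg h s γ γ' t) + δ * (∫ t in p..q, F t)
        + δ ^ 2 / 2 * ∫ t in p..q, F t := by
    intro p q δ hp hpq hq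
    have i1 := m.lint H hp hpq hq s
    have i2 : IntervalIntegrable F volume p q := m.Fint H hp hpq hq
    rw [← intervalIntegral.integral_const_mul, ← intervalIntegral.integral_const_mul,
      ← intervalIntegral.integral_add i1 (i2.const_mul _), 
      ← intervalIntegral.integral_add (i1.add (i2.const_mul _)) (i2.const_mul _)]
    apply intervalIntegral.integral_mono_on hpq (m.lint H hp hpq hq _)
      ((i1.add (i2.const_mul _)).add (i2.const_mul _))
    intro t ht
    exact m.perturb H ⟨by linarith [ht.1], by linarith [ht.2]⟩
  have key : (1 - a) * (∫ t in (0:ℝ)..a, F t) - a * (∫ t in a..1, F t) = 0 := by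
    apply lin_zero (Y := (1 - a) ^ 2 / 2 * (∫ t in (0:ℝ)..a, F t) + a ^ 2 / 2 * (∫ t in a..1, F t))
    intro ε hε
    obtain ⟨e1, e2⟩ := abs_le.1 hε
    have l1 : 0 < 1 + (1 - a) * ε := by nlinarith
    have l2 : 0 < 1 + -a * ε := by nlinarith
    have S1 := (m.arc.sub le_rfl a0.le a1.le).toSeg (h := h) a0.le (mul_pos hs l1)
    have S2 := (m.arc.sub a0.le a1.le le_rfl).toSeg (h := h) a1.le (mul_pos hs l2)
    have S := S1.trans H (mul_nonneg (mul_pos hs l1).le (by linarith)) 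
      (mul_nonneg (mul_pos hs l2).le (by linarith)) S2
    rw [m.g0, m.g1, show s * (1 + (1 - a) * ε) * (a - 0) + s * (1 + -a * ε) * (1 - a) = s by ring] at S
    have h1 := m.hmin _ S
    have h2 := piece 0 a ((1 - a) * ε) le_rfl a0.le a1.le
    have h3 := piece a 1 (-a * ε) a0.le a1.le le_rfl
    rw [← intervalIntegral.integral_add_adjacent_intervals (m.lint H le_rfl a0.le a1.le s)
      (m.lint H a0.le a1.le le_rfl s)] at h1
    nlinarith
  rw [← intervalIntegral.integral_add_adjacent_intervals f1 f2]
  linarith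

lemma Mini.clairaut {h : ℝ → ℝ} (H : HH h) {s : ℝ} {γ γ' : ℝ → ℝ} (m : Mini h s γ γ') :
    ∃ κ : ℝ, 0 < κ ∧ ∀ᵐ t, t ∈ Ioo (0:ℝ) 1 → Lg h s γ γ' t = s * h (γ t) ^ 2 / κ := by
  have hs := m.hs
  have fi := m.Fint H le_rfl zero_le_one le_rfl
  have fc := fun a => m.Fconst H (a := a)
  set F := fun t => s ^ 2 * h (γ t) ^ 2 / Lg h s γ γ' t with hF
  have hFp : ∀ t ∈ Ioo (0:ℝ) 1, 0 < F t := by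
    intro t ht
    have := m.hpos H (Ioo_subset_Icc_self ht)
    have := m.Lpos H (Ioo_subset_Icc_self ht)
    simp only [hF]
    positivity
  have hc := intervalIntegral.intervalIntegral_pos_of_pos_on fi hFp zero_lt_one
  change ∀ a, _ → ∫ t in (0:ℝ)..a, F t = a * ∫ t in (0:ℝ)..1, F t at fc
  set c := ∫ t in (0:ℝ)..1, F t with hcdef
  refine ⟨c / s, by positivity, ?_⟩
  filter_upwards [fi.ae_hasDerivAt_integral] with t ht ht'
  rw [uIcc_of_le zero_le_one] at ht
  have d1 := ht (Ioo_subset_Icc_self ht') 0 (by simp)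
  have d2 : HasDerivAt (fun x : ℝ => x * c) c t := by simpa using (hasDerivAt_id t).mul_const c
  have d3 : HasDerivAt (fun x => ∫ t in (0:ℝ)..x, F t) c t := by
    refine d2.congr_of_eventuallyEq ?_
    filter_upwards [Ioo_mem_nhds ht'.1 ht'.2] with x hx
    exact fc x hx
  have e := d1.unique d3
  have hL := m.Lpos H (Ioo_subset_Icc_self ht')
  simp only [hF] at e
  rw [div_eq_iff hL.ne'] at e
  field_simp
  linarith

lemma Mini.kappa_le {h : ℝ → ℝ} (H : HH h) {s κ : ℝ} {γ γ' : ℝ → ℝ} (m : Mini h s γ γ')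
    (hκ : 0 < κ) (hcl : ∀ᵐ t, t ∈ Ioo (0:ℝ) 1 → Lg h s γ γ' t = s * h (γ t) ^ 2 / κ)
    {t : ℝ} (ht : t ∈ Icc (0:ℝ) 1) : κ ≤ h (γ t) := by
  have hc := m.arc.hcont H zero_le_one
  have hs := m.hs
  have : EqOn (fun t => max (h (γ t)) κ) (fun t => h (γ t)) (Icc 0 1) := by
    apply Measure.eqOn_Icc_of_ae_eq volume zero_ne_one _ (hc.sup continuousOn_const) hc
    rw [← restrict_Ioo_eq_restrict_Icc]
    refine (ae_restrict_iff' measurableSet_Ioo).2 ?_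
    filter_upwards [hcl] with x hx hx'
    have h1 := hx hx'
    have h2 := Lg_ge_h (h := h) (l := s) (γ := γ) (γ' := γ') (t := x)
    have h3 := m.hpos H (Ioo_subset_Icc_self hx')
    rw [h1, le_div_iff₀ hκ] at h2
    rw [max_eq_left_iff]
    by_contra hc
    push Not at hc
    nlinarith [mul_pos hs h3]
  have h1 := this ht
  exact max_eq_left_iff.1 h1

lemma Mini.lower {h : ℝ → ℝ} (H : HH h) {s : ℝ} {γ γ' : ℝ → ℝ} (m : Mini h s γ γ')
    {a b y : ℝ} (ha : 0 ≤ a) (hab : a < b) (hb : b ≤ 1) (hay : γ a = y) (hby : γ b = y) :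
    ∫ t in a..b, Lg h s γ γ' t ≤ s * (b - a) * h y := by
  apply m.localMin H ha hab.le hb
  rw [hay, hby]
  exact Seg.const H (mul_pos m.hs (by linarith)) (hay ▸ m.mem ⟨ha, by linarith⟩)

lemma Mini.max_pos {h : ℝ → ℝ} (H : HH h) {s : ℝ} {γ γ' : ℝ → ℝ} (m : Mini h s γ γ')
    {T : ℝ} (hmax : ∀ t ∈ Icc (0:ℝ) 1, γ t ≤ γ T) : 0 < γ T := by
  by_contra hc
  push Not at hc
  refine m.no_plateau H le_rfl zero_lt_one le_rfl (M := 0) fun t ht => ?_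
  exact le_antisymm ((hmax t ht).trans hc) (m.mem ht).1

lemma Mini.corner {h : ℝ → ℝ} (H : HH h) {s κ : ℝ} {γ γ' : ℝ → ℝ} (m : Mini h s γ γ')
    (hκ : 0 < κ) (hcl : ∀ᵐ t, t ∈ Ioo (0:ℝ) 1 → Lg h s γ γ' t = s * h (γ t) ^ 2 / κ)
    {T : ℝ} (hT : T ∈ Icc (0:ℝ) 1) (hmax : ∀ t ∈ Icc (0:ℝ) 1, γ t ≤ γ T) : h (γ T) ≤ κ := by
  have hs := m.hs
  have hM := m.max_pos H hmax
  have hp := m.hpos H hT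
  have hc := m.arc.cont zero_le_one
  have key : ∀ y ∈ Ioo 0 (γ T), h (γ T) ^ 2 / κ ≤ h y := by
    intro y hy
    obtain ⟨a, ha, hay⟩ := intermediate_value_Icc hT.1 (hc.mono (Icc_subset_Icc le_rfl hT.2))
      (show y ∈ Icc (γ 0) (γ T) from ⟨by rw [m.g0]; exact hy.1.le, hy.2.le⟩)
    obtain ⟨b, hb, hby⟩ := intermediate_value_Icc' hT.2 (hc.mono (Icc_subset_Icc hT.1 le_rfl))
      (show y ∈ Icc (γ 1) (γ T) from ⟨by rw [m.g1]; exact hy.1.le, hy.2.le⟩)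
    have haT : a < T := lt_of_le_of_ne ha.2 (by rintro rfl; linarith [hy.2])
    have hTb : T < b := lt_of_le_of_ne hb.1 (by rintro rfl; linarith [hy.2])
    have e1 := m.lower H ha.1 (haT.trans hTb) hb.2 hay hby
    have e2 : ∫ t in a..b, s * (h (γ T) ^ 2 / κ) ≤ ∫ t in a..b, Lg h s γ γ' t := by
      apply intervalIntegral.integral_mono_ae_restrict (haT.trans hTb).le (by simp)
        (m.lint H ha.1 (haT.trans hTb).le hb.2 s)
      rw [← restrict_Ioo_eq_restrict_Icc]
      refine (ae_restrict_iff' measurableSet_Ioo).2 ?_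
      filter_upwards [hcl] with x hx hx'
      have hx1 : x ∈ Ioo (0:ℝ) 1 := ⟨by linarith [ha.1, hx'.1], by linarith [hb.2, hx'.2]⟩
      rw [hx hx1, mul_div_assoc]
      have := H.anti.antitoneOn (m.mem (Ioo_subset_Icc_self hx1)) (m.mem hT) (hmax x (Ioo_subset_Icc_self hx1))
      gcongr
    rw [intervalIntegral.integral_const, smul_eq_mul] at e2
    have : 0 < s * (b - a) := mul_pos hs (by linarith)
    have e3 : (s * (b - a)) * (h (γ T) ^ 2 / κ) ≤ (s * (b - a)) * h y := by linarith
    exact le_of_mul_le_mul_left e3 this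
  have hlim : Tendsto h (nhdsWithin (γ T) (Ioo 0 (γ T))) (nhds (h (γ T))) := by
    have := H.cont (γ T) (m.mem hT)
    exact this.mono (fun x hx => ⟨hx.1.le, hx.2.le.trans (m.mem hT).2⟩)
  have : (nhdsWithin (γ T) (Ioo 0 (γ T))).NeBot := by
    rw [nhdsWithin_Ioo_eq_nhdsLT hM]; infer_instance
  have := ge_of_tendsto hlim (eventually_mem_nhdsWithin.mono key)
  rw [div_le_iff₀ hκ] at this
  nlinarith

lemma Mini.mono {h : ℝ → ℝ} (H : HH h) {s : ℝ} {γ γ' : ℝ → ℝ} (m : Mini h s γ γ')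
    {T : ℝ} (hT : T ∈ Icc (0:ℝ) 1) (hmax : ∀ t ∈ Icc (0:ℝ) 1, γ t ≤ γ T) :
    MonotoneOn γ (Icc 0 T) := by
  have hs := m.hs
  have hc := m.arc.cont zero_le_one
  intro a ha b hb hab
  by_contra hlt
  push Not at hlt
  have hb1 : b ≤ 1 := hb.2.trans hT.2
  have hca : ContinuousOn γ (Icc a b) := hc.mono (Icc_subset_Icc ha.1 hb1)
  have hcb : ContinuousOn γ (Icc b T) := hc.mono (Icc_subset_Icc hb.1 hT.2)
  obtain ⟨p, ⟨hp1, hp2⟩, hp3⟩ : ∃ x, IsGreatest (Icc a b ∩ γ ⁻¹' (Ici (γ a))) x :=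
    (isCompact_Icc.of_isClosed_subset (hca.preimage_isClosed_of_isClosed isClosed_Icc isClosed_Ici)
      inter_subset_left).exists_isGreatest ⟨a, ⟨le_rfl, hab⟩, le_refl (γ a)⟩
  obtain ⟨q, ⟨hq1, hq2⟩, hq3⟩ : ∃ x, IsLeast (Icc b T ∩ γ ⁻¹' (Ici (γ a))) x :=
    (isCompact_Icc.of_isClosed_subset (hcb.preimage_isClosed_of_isClosed isClosed_Icc isClosed_Ici)
      inter_subset_left).exists_isLeast ⟨T, ⟨hb.2, le_rfl⟩, hmax a ⟨ha.1, ha.2.trans hT.2⟩⟩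
  simp only [mem_preimage, mem_Ici] at hp2 hq2
  have hpb : p < b := lt_of_le_of_ne hp1.2 (by rintro rfl; linarith)
  have hbq : b < q := lt_of_le_of_ne hq1.1 (by rintro rfl; linarith)
  have hp : γ p = γ a := by
    obtain ⟨x, hx, hxe⟩ := intermediate_value_Icc' hpb.le (hca.mono (Icc_subset_Icc hp1.1 le_rfl))
      (show γ a ∈ Icc (γ b) (γ p) from ⟨hlt.le, hp2⟩)
    have := hp3 ⟨⟨hp1.1.trans hx.1, hx.2⟩, hxe.ge⟩
    rw [← hxe, le_antisymm this hx.1]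
  have hq : γ q = γ a := by
    obtain ⟨x, hx, hxe⟩ := intermediate_value_Icc hbq.le (hcb.mono (Icc_subset_Icc le_rfl hq1.2))
      (show γ a ∈ Icc (γ b) (γ q) from ⟨hlt.le, hq2⟩)
    have := hq3 ⟨⟨hx.1, hx.2.trans hq1.2⟩, hxe.ge⟩
    rw [← hxe, le_antisymm this hx.2]
  have hp0 : 0 ≤ p := ha.1.trans hp1.1
  have hq1' : q ≤ 1 := hq1.2.trans hT.2
  have hpq := hpb.trans hbq
  have ham : γ a ∈ Icc (0:ℝ) 1 := m.mem ⟨ha.1, hab.trans hb1⟩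
  have e1 := m.lower H hp0 hpq hq1' hp hq
  have hcc : ContinuousOn (fun t => s * h (γ t)) (Icc p q) :=
    continuousOn_const.mul ((m.arc.sub hp0 hpq.le hq1').hcont H hpq.le)
  have e2 : ∫ t in p..q, s * h (γ a) < ∫ t in p..q, s * h (γ t) := by
    apply intervalIntegral.integral_lt_integral_of_continuousOn_of_le_of_exists_lt hpq continuousOn_const hcc
    · intro x hx
      have hx' : x ∈ Icc (0:ℝ) 1 := ⟨by linarith [hx.1], by linarith [hx.2]⟩
      refine mul_le_mul_of_nonneg_left (H.anti.antitoneOn (m.mem hx') ham ?_) hs.le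
      by_contra hcon
      push Not at hcon
      rcases le_total x b with hxb | hxb
      · have := hp3 ⟨⟨hp1.1.trans hx.1.le, hxb⟩, hcon.le⟩
        linarith [hx.1]
      · have := hq3 ⟨⟨hxb, hx.2.trans hq1.2⟩, hcon.le⟩
        have hxq := le_antisymm hx.2 this
        rw [hxq, hq] at hcon
        exact lt_irrefl _ hcon
    · exact ⟨b, ⟨hpb.le, hbq.le⟩, mul_lt_mul_of_pos_left (H.anti (m.mem ⟨hb.1, hb1⟩) ham hlt) hs⟩
  have e3 : ∫ t in p..q, s * h (γ t) ≤ ∫ t in p..q, Lg h s γ γ' t :=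
    intervalIntegral.integral_mono_on hpq.le (hcc.intervalIntegrable_of_Icc hpq.le)
      (m.lint H hp0 hpq.le hq1' s) (fun x _ => Lg_ge_h)
  rw [intervalIntegral.integral_const, smul_eq_mul] at e2
  linarith

lemma Mini.deriv_nonneg {h : ℝ → ℝ} (H : HH h) {s : ℝ} {γ γ' : ℝ → ℝ} (m : Mini h s γ γ')
    {T : ℝ} (hT : T ∈ Icc (0:ℝ) 1) (hmax : ∀ t ∈ Icc (0:ℝ) 1, γ t ≤ γ T) :
    ∀ᵐ t, t ∈ Ioo (0:ℝ) T → 0 ≤ γ' t := by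
  have hm := m.mono H hT hmax
  filter_upwards [m.arc.hi.ae_hasDerivAt_integral] with t ht ht'
  rw [uIcc_of_le zero_le_one] at ht
  have d := ht ⟨ht'.1.le, ht'.2.le.trans hT.2⟩ 0 (by simp)
  have d2 : HasDerivAt γ (γ' t) t := by
    refine d.congr_of_eventuallyEq ?_
    filter_upwards [Ioo_mem_nhds ht'.1 ht'.2] with x hx
    rw [m.arc.hv x ⟨hx.1.le, hx.2.le.trans hT.2⟩, m.g0, zero_add]
  refine d2.hasDerivWithinAt.nonneg_of_monotoneOn (s := Ioo 0 T) ?_ (hm.mono Ioo_subset_Icc_self)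
  have hn : Ioo 0 T ∈ nhds t := Ioo_mem_nhds ht'.1 ht'.2
  rw [accPt_principal_iff_nhdsWithin]
  have : nhdsWithin t (Ioo 0 T \ {t}) = nhdsWithin t {t}ᶜ := by
    rw [diff_eq, inter_comm]
    exact nhdsWithin_inter_of_mem' (mem_nhdsWithin_of_mem_nhds hn)
  rw [this]; infer_instance

noncomputable def GG (h : ℝ → ℝ) (s κ y : ℝ) : ℝ :=
  2 * Real.sqrt ((s * h y ^ 2 / κ) ^ 2 - (s * h y) ^ 2)

lemma Mini.deriv_abs {h : ℝ → ℝ} {s κ : ℝ} {γ γ' : ℝ → ℝ}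
    {t : ℝ} (hx : Lg h s γ γ' t = s * h (γ t) ^ 2 / κ) : |γ' t| = GG h s κ (γ t) := by
  unfold GG
  rw [← hx]
  unfold Lg
  rw [Real.sq_sqrt (by positivity)]
  have : s ^ 2 * h (γ t) ^ 2 + γ' t ^ 2 / 4 - (s * h (γ t)) ^ 2 = (γ' t / 2) ^ 2 := by ring
  rw [this, Real.sqrt_sq_eq_abs, abs_div]
  norm_num
  ring

lemma Mini.GG_cont {h : ℝ → ℝ} (H : HH h) {s κ : ℝ} {γ γ' : ℝ → ℝ} (m : Mini h s γ γ') :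
    ContinuousOn (fun t => GG h s κ (γ t)) (Icc 0 1) := by
  have hc := m.arc.hcont H zero_le_one
  unfold GG
  apply continuousOn_const.mul
  apply Real.continuous_sqrt.comp_continuousOn
  exact (((continuousOn_const.mul (hc.pow 2)).div_const κ).pow 2).sub
    ((continuousOn_const.mul hc).pow 2)

lemma GG_lt {s₁ s₂ κ₁ κ₂ a b : ℝ} (h1 : 0 < s₁) (hs : s₁ < s₂) (hκ₂ : 0 < κ₂)
    (hκ : κ₂ < κ₁) (ha : κ₁ ≤ a) (hab : a ≤ b) :
    2 * Real.sqrt ((s₁ * a ^ 2 / κ₁) ^ 2 - (s₁ * a) ^ 2) <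
      2 * Real.sqrt ((s₂ * b ^ 2 / κ₂) ^ 2 - (s₂ * b) ^ 2) := by
  have hκ₁ : 0 < κ₁ := hκ₂.trans hκ
  have ha0 : 0 < a := hκ₁.trans_le ha
  have e1 : (s₁ * a ^ 2 / κ₁) ^ 2 - (s₁ * a) ^ 2 = (s₁ * a) ^ 2 * ((a / κ₁) ^ 2 - 1) := by
    field_simp
  have e2 : (s₂ * b ^ 2 / κ₂) ^ 2 - (s₂ * b) ^ 2 = (s₂ * b) ^ 2 * ((b / κ₂) ^ 2 - 1) := by
    field_simp
  rw [e1, e2]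
  have r1 : 1 ≤ a / κ₁ := by rwa [le_div_iff₀ hκ₁, one_mul]
  have r2 : a / κ₁ < b / κ₂ := by
    rw [div_lt_div_iff₀ hκ₁ hκ₂]
    nlinarith
  have p1 : s₁ * a < s₂ * b := by nlinarith
  have p0 : 0 < s₁ * a := mul_pos h1 ha0
  have q1 : (s₁ * a) ^ 2 < (s₂ * b) ^ 2 := by gcongr
  have q2 : (a / κ₁) ^ 2 < (b / κ₂) ^ 2 := by gcongr
  have q3 : 1 ≤ (a / κ₁) ^ 2 := by nlinarith
  have : (s₁ * a) ^ 2 * ((a / κ₁) ^ 2 - 1) < (s₂ * b) ^ 2 * ((b / κ₂) ^ 2 - 1) := by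
    apply mul_lt_mul' q1.le (by linarith) (by linarith) (by nlinarith)
  have := Real.sqrt_lt_sqrt (mul_nonneg (sq_nonneg _) (by linarith)) this
  linarith

lemma Mini.comp_left {h : ℝ → ℝ} (H : HH h) {s₁ s₂ : ℝ} {γ₁ γ₁' γ₂ γ₂' : ℝ → ℝ}
    (m₁ : Mini h s₁ γ₁ γ₁') (m₂ : Mini h s₂ γ₂ γ₂') (hs : s₁ < s₂) {T : ℝ}
    (hT : T ∈ Icc (0:ℝ) 1) (hmax : ∀ t ∈ Icc (0:ℝ) 1, γ₂ t ≤ γ₂ T) {t₀ : ℝ}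
    (h0 : 0 < t₀) (h1 : t₀ ≤ T) : γ₁ t₀ < γ₂ t₀ := by
  by_contra hneg
  push Not at hneg
  obtain ⟨T₁, hT₁, hmax₁⟩ := m₁.exists_max
  obtain ⟨κ₁, hκ₁, hc₁⟩ := m₁.clairaut H
  obtain ⟨κ₂, hκ₂, hc₂⟩ := m₂.clairaut H
  have k : κ₂ < κ₁ := (m₂.kappa_le H hκ₂ hc₂ hT).trans_lt
    ((m₁.max_lt H m₂ hs hT₁ hT hmax).trans_le (m₁.corner H hκ₁ hc₁ hT₁ hmax₁))
  have c₁ := m₁.arc.cont zero_le_one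
  have c₂ := m₂.arc.cont zero_le_one
  have ht01 : t₀ ≤ 1 := h1.trans hT.2
  have hsub : Icc 0 t₀ ⊆ Icc (0:ℝ) 1 := Icc_subset_Icc le_rfl ht01
  obtain ⟨w, hw0, hwt, hwneg, hwmin⟩ : ∃ w, 0 < w ∧ w ≤ t₀ ∧ γ₂ w - γ₁ w ≤ 0 ∧
      ∀ u ∈ Icc 0 w, γ₂ w - γ₁ w ≤ γ₂ u - γ₁ u := by
    obtain ⟨w, hw, hwm⟩ := isCompact_Icc.exists_isMinOn ⟨0, left_mem_Icc.2 h0.le⟩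
      ((c₂.sub c₁).mono hsub)
    have hwm' : ∀ u ∈ Icc 0 t₀, γ₂ w - γ₁ w ≤ γ₂ u - γ₁ u := fun u hu => hwm hu
    have hwt := hwm' t₀ ⟨h0.le, le_rfl⟩
    rcases hw.1.eq_or_lt with e | e
    · refine ⟨t₀, h0, le_rfl, by linarith, fun u hu => ?_⟩
      have := hwm' u hu
      rw [← e, m₁.g0, m₂.g0] at this
      linarith
    · exact ⟨w, e, hw.2, by linarith, fun u hu => hwm' u ⟨hu.1, hu.2.trans hw.2⟩⟩
  have hw1 : w ∈ Icc (0:ℝ) 1 := ⟨hw0.le, hwt.trans ht01⟩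
  have hG : GG h s₁ κ₁ (γ₁ w) < GG h s₂ κ₂ (γ₂ w) := by
    apply GG_lt m₁.hs hs hκ₂ k (m₁.kappa_le H hκ₁ hc₁ hw1)
    exact H.anti.antitoneOn (m₂.mem hw1) (m₁.mem hw1) (by linarith)
  have gc := (m₂.GG_cont H (κ := κ₂)).sub (m₁.GG_cont H (κ := κ₁))
  have ev : ∀ᶠ u in nhdsWithin w (Icc 0 1), 0 < GG h s₂ κ₂ (γ₂ u) - GG h s₁ κ₁ (γ₁ u) :=
    (gc w hw1).eventually (lt_mem_nhds (sub_pos.2 hG))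
  rw [eventually_nhdsWithin_iff, Metric.eventually_nhds_iff] at ev
  obtain ⟨ε, hε, hev⟩ := ev
  obtain ⟨u, hu⟩ : ∃ u, u = max 0 (w - ε / 2) := ⟨_, rfl⟩
  have hu0 : 0 ≤ u := hu ▸ le_max_left _ _
  have huε : w - ε / 2 ≤ u := hu ▸ le_max_right _ _
  have huw : u < w := by rw [hu]; exact _root_.max_lt hw0 (by linarith)
  have hpos : ∀ x ∈ Icc u w, 0 < GG h s₂ κ₂ (γ₂ x) - GG h s₁ κ₁ (γ₁ x) := by
    intro x hx
    apply hev
    · rw [Real.dist_eq, abs_lt]; constructor <;> linarith [hx.1, hx.2]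
    · exact ⟨hu0.trans hx.1, hx.2.trans hw1.2⟩
  have gc' : ContinuousOn (fun x => GG h s₂ κ₂ (γ₂ x) - GG h s₁ κ₁ (γ₁ x)) (Icc u w) :=
    gc.mono (Icc_subset_Icc hu0 hw1.2)
  have I1 : 0 < ∫ x in u..w, (GG h s₂ κ₂ (γ₂ x) - GG h s₁ κ₁ (γ₁ x)) :=
    intervalIntegral.intervalIntegral_pos_of_pos_on (gc'.intervalIntegrable_of_Icc huw.le)
      (fun x hx => hpos x (Ioo_subset_Icc_self hx)) huw
  have i₂ := m₂.arc.hisub hu0 huw.le hw1.2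
  have i₁ := m₁.arc.hisub hu0 huw.le hw1.2
  have I2 : ∫ x in u..w, (GG h s₂ κ₂ (γ₂ x) - GG h s₁ κ₁ (γ₁ x)) ≤
      ∫ x in u..w, (γ₂' x - γ₁' x) := by
    apply intervalIntegral.integral_mono_ae_restrict huw.le (gc'.intervalIntegrable_of_Icc huw.le)
      (i₂.sub i₁)
    rw [← restrict_Ioo_eq_restrict_Icc]
    refine (ae_restrict_iff' measurableSet_Ioo).2 ?_
    filter_upwards [hc₁, hc₂, m₂.deriv_nonneg H hT hmax] with x hx1 hx2 hx3 hx
    have hx0 : x ∈ Ioo (0:ℝ) 1 := ⟨hu0.trans_lt hx.1, hx.2.trans_le hw1.2⟩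
    have hxT : x ∈ Ioo 0 T := ⟨hx0.1, hx.2.trans_le (hwt.trans h1)⟩
    have d1 := Mini.deriv_abs (hx1 hx0)
    have d2 := Mini.deriv_abs (hx2 hx0)
    rw [abs_of_nonneg (hx3 hxT)] at d2
    have := le_abs_self (γ₁' x)
    show _ - _ ≤ _ - _
    linarith
  rw [intervalIntegral.integral_sub i₂ i₁] at I2
  have e1 := m₁.arc.diff hu0 huw.le hw1.2
  have e2 := m₂.arc.diff hu0 huw.le hw1.2
  have := hwmin u ⟨hu0, huw.le⟩
  linarith

lemma Mini.refl {h : ℝ → ℝ} {s : ℝ} {γ γ' : ℝ → ℝ} (m : Mini h s γ γ') :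
    Mini h s (fun t => γ (1 - t)) (fun t => -γ' (1 - t)) := by
  have E : ∫ t in (0:ℝ)..1, Lg h s (fun t => γ (1 - t)) (fun t => -γ' (1 - t)) t =
      ∫ t in (0:ℝ)..1, Lg h s γ γ' t := by
    have : ∀ t, Lg h s (fun t => γ (1 - t)) (fun t => -γ' (1 - t)) t = Lg h s γ γ' (1 - t) := by
      intro t
      simp only [Lg, neg_sq]
    simp only [this]
    rw [intervalIntegral.integral_comp_sub_left (fun t => Lg h s γ γ' t)]
    norm_num
  refine ⟨m.hs, ⟨?_, ?_, ?_⟩, by simp [m.g1], by simp [m.g0], E ▸ m.lt, fun e he => E ▸ m.hmin e he⟩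
  · have := (m.arc.hi.comp_sub_left 1).neg.symm
    rw [sub_zero, sub_self] at this
    exact this
  · intro t ht
    simp only [intervalIntegral.integral_neg]
    rw [intervalIntegral.integral_comp_sub_left (fun t => γ' t)]
    have := m.arc.diff (c := 1 - t) (d := 1) (by linarith [ht.2]) (by linarith [ht.1]) le_rfl
    simp only [sub_zero]
    linarith
  · intro t ht
    exact m.arc.hm _ ⟨by linarith [ht.2], by linarith [ht.1]⟩

lemma Mini.pos_left {h : ℝ → ℝ} (H : HH h) {s : ℝ} {γ γ' : ℝ → ℝ} (m : Mini h s γ γ') {T : ℝ}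
    (hT : T ∈ Icc (0:ℝ) 1) (hmax : ∀ t ∈ Icc (0:ℝ) 1, γ t ≤ γ T) {t : ℝ}
    (h0 : 0 < t) (h1 : t ≤ T) : 0 < γ t := by
  have ht1 : t ≤ 1 := h1.trans hT.2
  by_contra hc
  push Not at hc
  refine m.no_plateau H le_rfl h0 ht1 (M := 0) fun u hu => ?_
  have hu1 : u ∈ Icc (0:ℝ) 1 := ⟨hu.1, hu.2.trans ht1⟩
  have := m.mono H hT hmax ⟨hu.1, hu.2.trans h1⟩ ⟨h0.le, h1⟩ hu.2
  exact le_antisymm (this.trans hc) (m.mem hu1).1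

lemma Mini.main {h : ℝ → ℝ} (H : HH h) {s₁ s₂ : ℝ} {γ₁ γ₁' γ₂ γ₂' : ℝ → ℝ}
    (m₁ : Mini h s₁ γ₁ γ₁') (m₂ : Mini h s₂ γ₂ γ₂') (hs : s₁ < s₂) {t : ℝ}
    (ht : t ∈ Ioo (0:ℝ) 1) : 0 < γ₁ t ∧ γ₁ t < γ₂ t := by
  have rm : ∀ {γ : ℝ → ℝ} {T : ℝ}, (∀ t ∈ Icc (0:ℝ) 1, γ t ≤ γ T) →
      ∀ t ∈ Icc (0:ℝ) 1, (fun t => γ (1 - t)) t ≤ (fun t => γ (1 - t)) (1 - T) := by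
    intro γ T hm t ht
    simp only [sub_sub_cancel]
    exact hm _ ⟨by linarith [ht.2], by linarith [ht.1]⟩
  obtain ⟨T₁, hT₁, hmax₁⟩ := m₁.exists_max
  obtain ⟨T₂, hT₂, hmax₂⟩ := m₂.exists_max
  constructor
  · rcases le_total t T₁ with hh | hh
    · exact m₁.pos_left H hT₁ hmax₁ ht.1 hh
    · have := m₁.refl.pos_left H (T := 1 - T₁) ⟨by linarith [hT₁.2], by linarith [hT₁.1]⟩
        (rm hmax₁) (t := 1 - t) (by linarith [ht.2]) (by linarith)
      simpa using this
  · rcases le_total t T₂ with hh | hh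
    · exact m₁.comp_left H m₂ hs hT₂ hmax₂ ht.1 hh
    · have := m₁.refl.comp_left H m₂.refl hs (T := 1 - T₂)
        ⟨by linarith [hT₂.2], by linarith [hT₂.1]⟩
        (rm hmax₂) (t₀ := 1 - t) (by linarith [ht.2]) (by linarith)
      simpa using this

lemma F1Hyp.toHH {ℓ ℓ₁ : ℝ} {f₁ : ℝ → ℝ} (hf : F1Hyp ℓ ℓ₁ f₁) : HH (fun u => f₁ (Real.sqrt u)) := by
  have mp : ∀ u ∈ Icc (0:ℝ) 1, Real.sqrt u ∈ Icc (0:ℝ) 1 := fun u hu =>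
    ⟨Real.sqrt_nonneg _, Real.sqrt_le_one.2 hu.2⟩
  refine ⟨hf.cont.comp Real.continuous_sqrt.continuousOn mp, ?_, hf.convexSqrt, by simp [hf.f11]⟩
  intro a ha b hb hab
  exact hf.anti (mp a ha) (mp b hb) (Real.sqrt_lt_sqrt ha.1 hab)

lemma Admissible.toArc {γ γ' : ℝ → ℝ} (ha : Admissible γ γ') : Arc 0 1 γ γ' := by
  obtain ⟨h1, h2, h3, h4, h5⟩ := ha
  refine ⟨?_, fun t ht => by rw [h4, zero_add]; exact h2 t ht, fun t ht => h3 t ht⟩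
  rw [intervalIntegrable_iff_integrableOn_Icc_of_le zero_le_one]
  exact h1

lemma g0_le {f₁ : ℝ → ℝ} {s : ℝ} {γ γ' : ℝ → ℝ} (ha : Admissible γ γ') :
    g0 f₁ s ≤ energy f₁ s γ γ' := by
  apply csInf_le
  · refine ⟨0, ?_⟩
    rintro x ⟨p, p', -, rfl⟩
    exact intervalIntegral.integral_nonneg zero_le_one fun _ _ => Real.sqrt_nonneg _
  · exact ⟨γ, γ', ha, rfl⟩

lemma Seg.g0_le {f₁ : ℝ → ℝ} {s e : ℝ} (hs : 0 < s)
    (S : Seg (fun u => f₁ (Real.sqrt u)) s e 0 0) : g0 f₁ s ≤ e := by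
  obtain ⟨γ, γ', A, a0, a1, ae⟩ := S
  have key : ∀ (f : ℝ → ℝ) (x : ℝ), ∫ u in (0:ℝ)..x, s * f (s * u) = ∫ u in (0:ℝ)..(s * x), f u := by
    intro f x
    rw [intervalIntegral.integral_const_mul, intervalIntegral.mul_integral_comp_mul_left, mul_zero]
  have adm : Admissible (fun t => γ (s * t)) (fun t => s * γ' (s * t)) := by
    refine ⟨?_, ?_, ?_, by simp [a0], by simp [a1]⟩
    · rw [← intervalIntegrable_iff_integrableOn_Icc_of_le zero_le_one]
      have := (A.hi.comp_mul_left (c := s)).const_mul s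
      simpa [hs.ne'] using this
    · intro t ht
      rw [key]
      have := A.hv (s * t) ⟨mul_nonneg hs.le ht.1, by nlinarith [ht.2]⟩
      rw [a0, zero_add] at this
      exact this
    · intro t ht
      exact A.hm (s * t) ⟨mul_nonneg hs.le ht.1, by nlinarith [ht.2]⟩
  refine (_root_.g0_le adm).trans (le_trans (le_of_eq ?_) ae)
  have : ∀ t, Real.sqrt (s ^ 2 * (f₁ (Real.sqrt (γ (s * t)))) ^ 2 + (s * γ' (s * t)) ^ 2 / 4) =
      s * Lg (fun u => f₁ (Real.sqrt u)) 1 γ γ' (s * t) := by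
    intro t
    have e : s ^ 2 * (f₁ (Real.sqrt (γ (s * t)))) ^ 2 + (s * γ' (s * t)) ^ 2 / 4 =
      s ^ 2 * (1 ^ 2 * (f₁ (Real.sqrt (γ (s * t)))) ^ 2 + (γ' (s * t)) ^ 2 / 4) := by ring
    rw [e, Real.sqrt_mul (sq_nonneg s), Real.sqrt_sq hs.le]
    rfl
  simp only [energy, this]
  rw [key, mul_one]

theorem stmt_9 (ℓ ℓ₁ : ℝ) (f₁ : ℝ → ℝ) (hf : F1Hyp ℓ ℓ₁ f₁)
    (s₁ s₂ : ℝ) (h1 : 0 < s₁) (h12 : s₁ < s₂) (h2 : g0 f₁ s₂ < 1)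
    (γ₁ γ₁' γ₂ γ₂' : ℝ → ℝ)
    (ha1 : Admissible γ₁ γ₁') (he1 : energy f₁ s₁ γ₁ γ₁' = g0 f₁ s₁)
    (ha2 : Admissible γ₂ γ₂') (he2 : energy f₁ s₂ γ₂ γ₂' = g0 f₁ s₂) :
    ∀ t ∈ Ioo (0:ℝ) 1, 0 < γ₁ t ∧ γ₁ t < γ₂ t := by
  have H := hf.toHH
  have hs2 : 0 < s₂ := h1.trans h12
  have le12 : energy f₁ s₁ γ₂ γ₂' ≤ energy f₁ s₂ γ₂ γ₂' := by
    apply intervalIntegral.integral_mono_on zero_le_one (Lg_int H ha2.toArc zero_le_one s₁)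
      (Lg_int H ha2.toArc zero_le_one s₂)
    intro t _
    unfold Lg
    gcongr
  have lt1 : energy f₁ s₁ γ₁ γ₁' < 1 := by
    have := g0_le (f₁ := f₁) (s := s₁) ha2
    linarith
  have m₁ : Mini (fun u => f₁ (Real.sqrt u)) s₁ γ₁ γ₁' :=
    ⟨h1, ha1.toArc, ha1.2.2.2.1, ha1.2.2.2.2, lt1, fun e he => he1.le.trans (he.g0_le h1)⟩
  have m₂ : Mini (fun u => f₁ (Real.sqrt u)) s₂ γ₂ γ₂' :=
    ⟨hs2, ha2.toArc, ha2.2.2.2.1, ha2.2.2.2.2, he2.trans_lt h2,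
      fun e he => he2.le.trans (he.g0_le hs2)⟩
  exact fun t ht => m₁.main H m₂ h12 ht
end
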